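/- Let V = V_3 ⊕ V_4 (one cubic form and one quartic form) and R = O(V)^{SL(2,ℂ)}. Then R has a homogeneous system of parameters consisting of six invariants, of degrees 2, 3, 4, 5, 6, 7, and the minimal number of algebra generators of R equals 20 (with 1 generator in each of the degrees 2, 3, 4, then 2 of degree 5, 2 of degree 6, 3 of degree 7, 3 of degree 8, 4 of degree 9, 2 of degree 10, and 1 of degree 11). -/

import Mathlib

open MvPolynomial

noncomputable section

namespace BinInv

/-- `k`-fold partial derivative with respect to the variable `v`. -/
def pd {A : Type*} [CommSemiring A] (v : Fin 2) (k : ℕ)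
    (f : MvPolynomial (Fin 2) A) : MvPolynomial (Fin 2) A :=
  (fun g => MvPolynomial.pderiv v g)^[k] f

/-- The `p`-th transvectant of binary forms `g`, `h` of degrees `m`, `n`,
with coefficients in a commutative `ℂ`-algebra `A`. -/
def transvectant {A : Type*} [CommRing A] [Algebra ℂ A] (m n p : ℕ)
    (g h : MvPolynomial (Fin 2) A) : MvPolynomial (Fin 2) A :=
  algebraMap ℂ (MvPolynomial (Fin 2) A)
      ((((m - p).factorial * (n - p).factorial : ℕ) : ℂ) /
        (((m.factorial * n.factorial : ℕ)) : ℂ)) *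
    ∑ i ∈ Finset.range (p + 1),
      algebraMap ℂ (MvPolynomial (Fin 2) A) ((-1 : ℂ) ^ i * (p.choose i : ℂ)) *
        (pd 0 (p - i) (pd 1 i g) * pd 0 i (pd 1 (p - i) h))

variable {p : ℕ}

/-- Index type for the coefficients of a system of binary forms of degrees `n 0, …, n (p-1)`:
the space `V = V_{n 0} ⊕ … ⊕ V_{n (p-1)}` is identified with `Idx n → ℂ`. -/
abbrev Idx (n : Fin p → ℕ) : Type := Σ i : Fin p, Fin (n i + 1)

/-- The binary form of degree `n i` with coefficient vector `c`. -/
def formAt (n : Fin p → ℕ) (c : Idx n → ℂ) (i : Fin p) : MvPolynomial (Fin 2) ℂ :=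
  ∑ k : Fin (n i + 1), C (c ⟨i, k⟩) * X 0 ^ (n i - (k : ℕ)) * X 1 ^ (k : ℕ)

/-- The substitution action of `SL(2,ℂ)` on binary forms: `(g • f)(v) = f (g⁻¹ • v)`. -/
def sl2Act (g : Matrix.SpecialLinearGroup (Fin 2) ℂ) (f : MvPolynomial (Fin 2) ℂ) :
    MvPolynomial (Fin 2) ℂ :=
  aeval (fun i => ∑ j, C ((↑(g⁻¹) : Matrix (Fin 2) (Fin 2) ℂ) i j) * X j) f

/-- The coefficient of `x^(n-k) y^k` in a binary form. -/
def coeffAt (n : Fin p → ℕ) (j : Idx n) (f : MvPolynomial (Fin 2) ℂ) : ℂ :=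
  MvPolynomial.coeff
    (Finsupp.single 0 (n j.1 - (j.2 : ℕ)) + Finsupp.single 1 (j.2 : ℕ)) f

/-- The induced action of `SL(2,ℂ)` on points of `V`, in coefficient coordinates. -/
def actPt (n : Fin p → ℕ) (g : Matrix.SpecialLinearGroup (Fin 2) ℂ) (c : Idx n → ℂ) :
    Idx n → ℂ :=
  fun j => coeffAt n j (sl2Act g (formAt n c j.1))

/-- A polynomial function on `V` is invariant if it is constant on `SL(2,ℂ)`-orbits. -/
def IsInvariant (n : Fin p → ℕ) (P : MvPolynomial (Idx n) ℂ) : Prop :=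
  ∀ (g : Matrix.SpecialLinearGroup (Fin 2) ℂ) (c : Idx n → ℂ),
    eval (actPt n g c) P = eval c P

/-- The invariant ring `R = O(V)^{SL(2,ℂ)}` as a subalgebra of `O(V)`. -/
def invariantRing (n : Fin p → ℕ) : Subalgebra ℂ (MvPolynomial (Idx n) ℂ) where
  carrier := {P | IsInvariant n P}
  mul_mem' := fun ha hb g c => by
    simp only [map_mul]; rw [ha g c, hb g c]
  one_mem' := fun g c => by simp
  add_mem' := fun ha hb g c => by
    simp only [map_add]; rw [ha g c, hb g c]
  zero_mem' := fun g c => by simp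
  algebraMap_mem' := fun r g c => by simp

/-- The nullcone: the points of `V` where every homogeneous invariant of positive
degree vanishes. -/
def Nullcone (n : Fin p → ℕ) : Set (Idx n → ℂ) :=
  {c | ∀ P ∈ invariantRing n, ∀ d : ℕ, 0 < d → P.IsHomogeneous d → eval c P = 0}

/-- `P` is a homogeneous system of parameters of the invariant ring, with degrees `d`:
the `P j` are homogeneous invariants of positive degrees `d j`, algebraically independent
over `ℂ`, and the invariant ring is integral over the subalgebra they generate. -/
def IsHSOP (n : Fin p → ℕ) {k : ℕ} (P : Fin k → MvPolynomial (Idx n) ℂ)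
    (d : Fin k → ℕ) : Prop :=
  (∀ j, P j ∈ invariantRing n) ∧ (∀ j, 0 < d j) ∧
    (∀ j, (P j).IsHomogeneous (d j)) ∧ AlgebraicIndependent ℂ P ∧
    ∀ x ∈ invariantRing n, IsIntegral (↥(Algebra.adjoin ℂ (Set.range P))) x

/-- `r` is the minimal number of generators of the invariant ring. -/
def IsMinimalNumGens (n : Fin p → ℕ) (r : ℕ) : Prop :=
  IsLeast {k | ∃ S : Finset (MvPolynomial (Idx n) ℂ),
    S.card = k ∧ Algebra.adjoin ℂ (S : Set (MvPolynomial (Idx n) ℂ)) = invariantRing n} r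

/-- The invariant ring has minimal number of generators `r`, realized by a minimal
system of homogeneous generators of degrees `d 0, …, d (r-1)`. -/
def HasMinimalGens (n : Fin p → ℕ) {r : ℕ} (d : Fin r → ℕ) : Prop :=
  IsMinimalNumGens n r ∧
    ∃ G : Fin r → MvPolynomial (Idx n) ℂ, Function.Injective G ∧
      (∀ j, (G j).IsHomogeneous (d j)) ∧
      Algebra.adjoin ℂ (Set.range G) = invariantRing n

/-- The generic binary form of degree `n i`, whose coefficients are the corresponding
coordinate functions on `V`. -/
def genForm (n : Fin p → ℕ) (i : Fin p) :
    MvPolynomial (Fin 2) (MvPolynomial (Idx n) ℂ) :=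
  ∑ k : Fin (n i + 1), C (X ⟨i, k⟩) * X 0 ^ (n i - (k : ℕ)) * X 1 ^ (k : ℕ)

end BinInv

end

namespace CubicQuartic

/-- The operations used to compute with coefficient lists of binary forms. -/
structure Ops (α : Type*) where
  zero : α
  add : α → α → α
  mul : α → α → α
  neg : α → α
  nsmul : ℕ → α → α

/-- The operations of a commutative ring. -/
def Ops.ofRing (A : Type*) [CommRing A] : Ops A where
  zero := 0
  add := (· + ·)
  mul := (· * ·)
  neg := (- ·)
  nsmul := (· • ·)

namespace Ops

section Defs

variable {α : Type*} (o : Ops α)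

/-- Sum of coefficient lists. -/
def addL : List α → List α → List α
  | [], b => b
  | a :: as, [] => a :: as
  | a :: as, b :: bs => o.add a b :: addL as bs

/-- Product of coefficient lists. -/
def mulL : List α → List α → List α
  | [], _ => []
  | [a], b => b.map (o.mul a)
  | a :: a' :: as, b => o.addL (b.map (o.mul a)) (o.zero :: mulL (a' :: as) b)

/-- Derivative with respect to the first variable. -/
def dx : List α → List α
  | [] => []
  | [_] => []
  | a :: b :: t => o.nsmul (t.length + 1) a :: dx (b :: t)

/-- Auxiliary function for `Ops.dy`: the operator `k + y ∂/∂y`. -/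
def dyAux : ℕ → List α → List α
  | _, [] => []
  | k, a :: t => o.nsmul k a :: dyAux (k + 1) t

/-- Derivative with respect to the second variable. -/
def dy (l : List α) : List α := o.dyAux 1 l.tail

/-- The (unnormalised) `k`-th transvectant of coefficient lists. -/
def tr : ℕ → List α → List α → List α
  | 0, a, b => o.mulL a b
  | k + 1, a, b => o.addL (tr k (o.dx a) (o.dy b)) ((tr k (o.dy a) (o.dx b)).map o.neg)

/-- Auxiliary function for `Ops.pair`. -/
def pairAux : ℕ → List α → List α → α
  | _, [], _ => o.zero
  | _, _ :: _, [] => o.zero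
  | i, x :: xs, y :: ys =>
    o.add ((if i % 2 = 0 then id else o.neg)
      (o.nsmul (i.factorial * xs.length.factorial) (o.mul x y))) (pairAux (i + 1) xs ys)

/-- The invariant pairing of two forms of the same degree. -/
def pair (a b : List α) : α := o.pairAux 0 a b.reverse

variable (c f : List α)

/-- Hessian of the cubic. -/
def hessC : List α := o.tr 2 c c
/-- Cubic covariant of the cubic. -/
def jacC : List α := o.tr 1 c (o.hessC c)
/-- Hessian of the quartic. -/
def hessF : List α := o.tr 2 f f
/-- Sextic covariant of the quartic. -/
def jacF : List α := o.tr 1 f (o.hessF f)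
/-- The square of the cubic. -/
def c2 : List α := o.mulL c c
/-- The fourth power of the cubic. -/
def c4 : List α := o.mulL (o.c2 c) (o.c2 c)
/-- A covariant of the cubic of order 8. -/
def c2De : List α := o.mulL (o.c2 c) (o.hessC c)
/-- A covariant of the cubic of order 6. -/
def cQ : List α := o.mulL c (o.jacC c)
/-- A covariant of the cubic of order 8. -/
def cQDe : List α := o.mulL (o.cQ c) (o.hessC c)
/-- A covariant of the cubic of order 12. -/
def c3Q : List α := o.mulL (o.c2 c) (o.cQ c)
/-- A covariant of the cubic of order 4. -/
def De2 : List α := o.mulL (o.hessC c) (o.hessC c)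
/-- A covariant of the cubic of order 6. -/
def De3 : List α := o.mulL (o.De2 c) (o.hessC c)
/-- The square of the quartic. -/
def f2 : List α := o.mulL f f
/-- The product of the quartic and its Hessian. -/
def fH : List α := o.mulL f (o.hessF f)
/-- The square of the Hessian of the quartic. -/
def hh : List α := o.mulL (o.hessF f) (o.hessF f)
/-- The cube of the quartic. -/
def f3 : List α := o.mulL f (o.f2 f)
/-- A covariant of the quartic of order 12. -/
def f2H : List α := o.mulL f (o.fH f)
/-- A covariant of the quartic of order 12. -/
def fHH : List α := o.mulL f (o.hh f)

/-- The six primary invariants. -/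
def prim : Fin 6 → α := ![
  o.pair f f,
  o.pair f (o.hessF f),
  o.pair (o.hessC c) (o.hessC c),
  o.add (o.pair (o.De2 c) f) (o.pair (o.c2 c) (o.jacF f)),
  o.pair (o.De2 c) (o.hessF f),
  o.pair (o.c4 c) (o.f3 f)]

/-- The fourteen remaining generating invariants. -/
def scd : Fin 14 → α := ![
  o.pair (o.De2 c) f,
  o.pair (o.c2De c) (o.f2 f),
  o.pair (o.cQ c) (o.jacF f),
  o.pair (o.c2De c) (o.fH f),
  o.pair (o.cQDe c) (o.f2 f),
  o.pair (o.c2De c) (o.hh f),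
  o.pair (o.c4 c) (o.f2H f),
  o.pair (o.De3 c) (o.jacF f),
  o.pair (o.cQDe c) (o.fH f),
  o.pair (o.c3Q c) (o.f3 f),
  o.pair (o.c4 c) (o.fHH f),
  o.pair (o.cQDe c) (o.hh f),
  o.pair (o.c3Q c) (o.f2H f),
  o.pair (o.c3Q c) (o.fHH f)]

end Defs

/-- Compatibility of a relation with two systems of operations. -/
structure Rel {α β : Type*} (o : Ops α) (o' : Ops β) (R : α → β → Prop) : Prop where
  zero : R o.zero o'.zero
  add : ∀ {a a' b b'}, R a a' → R b b' → R (o.add a b) (o'.add a' b')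
  mul : ∀ {a a' b b'}, R a a' → R b b' → R (o.mul a b) (o'.mul a' b')
  neg : ∀ {a a'}, R a a' → R (o.neg a) (o'.neg a')
  nsmul : ∀ (k : ℕ) {a a'}, R a a' → R (o.nsmul k a) (o'.nsmul k a')

namespace Rel

variable {α β : Type*} {o : Ops α} {o' : Ops β} {R : α → β → Prop}

theorem addL (h : Rel o o' R) {a b : List α} {a' b' : List β}
    (ha : List.Forall₂ R a a') (hb : List.Forall₂ R b b') :
    List.Forall₂ R (o.addL a b) (o'.addL a' b') := by
  induction ha generalizing b b' with
  | nil => simpa [Ops.addL] using hb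
  | cons h1 h2 ih =>
    cases hb with
    | nil => simpa [Ops.addL] using ⟨h1, h2⟩
    | cons h3 h4 => exact .cons (h.add h1 h3) (ih h4)

theorem map_mul (h : Rel o o' R) {x : α} {x' : β} {b : List α} {b' : List β}
    (hx : R x x') (hb : List.Forall₂ R b b') :
    List.Forall₂ R (b.map (o.mul x)) (b'.map (o'.mul x')) := by
  induction hb with
  | nil => simp
  | cons h1 h2 ih => exact .cons (h.mul hx h1) ih

theorem mulL (h : Rel o o' R) {a b : List α} {a' b' : List β}
    (ha : List.Forall₂ R a a') (hb : List.Forall₂ R b b') :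
    List.Forall₂ R (o.mulL a b) (o'.mulL a' b') := by
  induction ha with
  | nil => simp [Ops.mulL]
  | cons h1 h2 ih =>
    cases h2 with
    | nil => exact h.map_mul h1 hb
    | cons h3 h4 => exact h.addL (h.map_mul h1 hb) (.cons h.zero ih)

theorem dx (h : Rel o o' R) {a : List α} {a' : List β}
    (ha : List.Forall₂ R a a') : List.Forall₂ R (o.dx a) (o'.dx a') := by
  induction ha with
  | nil => simp [Ops.dx]
  | cons h1 h2 ih =>
    cases h2 with
    | nil => simp [Ops.dx]
    | cons h3 h4 =>
      simp only [Ops.dx, h4.length_eq]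
      exact .cons (h.nsmul _ h1) ih

theorem dyAux (h : Rel o o' R) {a : List α} {a' : List β} (k : ℕ)
    (ha : List.Forall₂ R a a') : List.Forall₂ R (o.dyAux k a) (o'.dyAux k a') := by
  induction ha generalizing k with
  | nil => simp [Ops.dyAux]
  | cons h1 h2 ih => exact .cons (h.nsmul _ h1) (ih _)

theorem dy (h : Rel o o' R) {a : List α} {a' : List β}
    (ha : List.Forall₂ R a a') : List.Forall₂ R (o.dy a) (o'.dy a') := by
  cases ha with
  | nil => simp [Ops.dy, Ops.dyAux]
  | cons h1 h2 => exact h.dyAux 1 h2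

theorem tr (h : Rel o o' R) (k : ℕ) {a b : List α} {a' b' : List β}
    (ha : List.Forall₂ R a a') (hb : List.Forall₂ R b b') :
    List.Forall₂ R (o.tr k a b) (o'.tr k a' b') := by
  induction k generalizing a b a' b' with
  | zero => exact h.mulL ha hb
  | succ k ih =>
    refine h.addL (ih (h.dx ha) (h.dy hb)) ?_
    rw [List.forall₂_map_left_iff, List.forall₂_map_right_iff]
    exact (ih (h.dy ha) (h.dx hb)).imp fun _ _ => h.neg

theorem pairAux (h : Rel o o' R) (i : ℕ) {a b : List α} {a' b' : List β}
    (ha : List.Forall₂ R a a') (hb : List.Forall₂ R b b') :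
    R (o.pairAux i a b) (o'.pairAux i a' b') := by
  induction ha generalizing i b b' with
  | nil => exact h.zero
  | cons h1 h2 ih =>
    cases hb with
    | nil => exact h.zero
    | cons h3 h4 =>
      refine h.add ?_ (ih _ h4)
      rw [h2.length_eq]
      split_ifs
      · exact h.nsmul _ (h.mul h1 h3)
      · exact h.neg (h.nsmul _ (h.mul h1 h3))

theorem pair (h : Rel o o' R) {a b : List α} {a' b' : List β}
    (ha : List.Forall₂ R a a') (hb : List.Forall₂ R b b') :
    R (o.pair a b) (o'.pair a' b') :=
  h.pairAux 0 ha (List.rel_reverse hb)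

variable {c f : List α} {c' f' : List β}

theorem prim (h : Rel o o' R) (hc : List.Forall₂ R c c') (hf : List.Forall₂ R f f')
    (i : Fin 6) : R (o.prim c f i) (o'.prim c' f' i) := by
  fin_cases i <;>
  repeat' first | exact hc | exact hf | apply h.pair | apply h.mulL | apply h.tr | apply h.add

theorem scd (h : Rel o o' R) (hc : List.Forall₂ R c c') (hf : List.Forall₂ R f f')
    (i : Fin 14) : R (o.scd c f i) (o'.scd c' f' i) := by
  fin_cases i <;>
  repeat' first | exact hc | exact hf | apply h.pair | apply h.mulL | apply h.tr

theorem ofRingHom {A B : Type*} [CommRing A] [CommRing B] (φ : A →+* B) :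
    Rel (ofRing A) (ofRing B) (fun a b => φ a = b) where
  zero := map_zero φ
  add := by rintro _ _ _ _ rfl rfl; exact map_add φ _ _
  mul := by rintro _ _ _ _ rfl rfl; exact _root_.map_mul φ _ _
  neg := by rintro _ _ rfl; exact map_neg φ _
  nsmul := by rintro k _ _ rfl; exact map_nsmul φ _ _

end Rel

theorem map_prim {A B : Type*} [CommRing A] [CommRing B] (φ : A →+* B) (c f : List A)
    (i : Fin 6) : φ ((ofRing A).prim c f i) = (ofRing B).prim (c.map φ) (f.map φ) i :=
  (Rel.ofRingHom φ).prim (by simp [List.forall₂_map_right_iff, List.forall₂_same])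
    (by simp [List.forall₂_map_right_iff, List.forall₂_same]) i

theorem map_scd {A B : Type*} [CommRing A] [CommRing B] (φ : A →+* B) (c f : List A)
    (i : Fin 14) : φ ((ofRing A).scd c f i) = (ofRing B).scd (c.map φ) (f.map φ) i :=
  (Rel.ofRingHom φ).scd (by simp [List.forall₂_map_right_iff, List.forall₂_same])
    (by simp [List.forall₂_map_right_iff, List.forall₂_same]) i

end Ops
end CubicQuartic

namespace CubicQuartic

section Forms

variable {A : Type*} [CommRing A]

/-- The binary form with given list of coefficients. -/
noncomputable def form : List A → MvPolynomial (Fin 2) A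
  | [] => 0
  | a :: t => C a * X 0 ^ t.length + X 1 * form t

/-- The transvectant of two binary forms (unnormalised). -/
noncomputable def trans : ℕ → MvPolynomial (Fin 2) A → MvPolynomial (Fin 2) A →
    MvPolynomial (Fin 2) A
  | 0, a, b => a * b
  | k + 1, a, b => trans k (pderiv 0 a) (pderiv 1 b) - trans k (pderiv 1 a) (pderiv 0 b)

theorem trans_add_left (k : ℕ) (a a' b : MvPolynomial (Fin 2) A) :
    trans k (a + a') b = trans k a b + trans k a' b := by
  induction k generalizing a a' b with
  | zero => simp [trans, add_mul]
  | succ k ih => simp only [trans, map_add, ih]; ring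

theorem trans_add_right (k : ℕ) (a b b' : MvPolynomial (Fin 2) A) :
    trans k a (b + b') = trans k a b + trans k a b' := by
  induction k generalizing a b b' with
  | zero => simp [trans, mul_add]
  | succ k ih => simp only [trans, map_add, ih]; ring

theorem trans_C_mul_left (k : ℕ) (r : A) (a b : MvPolynomial (Fin 2) A) :
    trans k (C r * a) b = C r * trans k a b := by
  induction k generalizing a b with
  | zero => simp [trans, mul_assoc]
  | succ k ih => simp only [trans, pderiv_C_mul, ih]; ring

theorem trans_C_mul_right (k : ℕ) (r : A) (a b : MvPolynomial (Fin 2) A) :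
    trans k a (C r * b) = C r * trans k a b := by
  induction k generalizing a b with
  | zero => simp [trans]; ring
  | succ k ih => simp only [trans, pderiv_C_mul, ih]; ring

/-- Linear substitution of the variables. -/
noncomputable def subst (m : Fin 2 → Fin 2 → A) :
    MvPolynomial (Fin 2) A →ₐ[A] MvPolynomial (Fin 2) A :=
  aeval fun i => ∑ j, C (m i j) * X j

theorem pderiv_subst (m : Fin 2 → Fin 2 → A) (j : Fin 2) (a : MvPolynomial (Fin 2) A) :
    pderiv j (subst m a) =
      C (m 0 j) * subst m (pderiv 0 a) + C (m 1 j) * subst m (pderiv 1 a) := by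
  induction a using MvPolynomial.induction_on with
  | C a => simp [subst]
  | add p q hp hq => simp only [map_add, hp, hq]; ring
  | mul_X p i hp =>
    have h : pderiv j (subst m (X i)) = C (m i j) := by
      fin_cases i <;> fin_cases j <;> simp [subst, pderiv_X]
    simp only [map_mul, pderiv_mul, hp, h, map_add]
    fin_cases i <;> simp [pderiv_X] <;> ring

theorem trans_subst (m : Fin 2 → Fin 2 → A) (hm : m 0 0 * m 1 1 - m 0 1 * m 1 0 = 1) (k : ℕ)
    (a b : MvPolynomial (Fin 2) A) :
    trans k (subst m a) (subst m b) = subst m (trans k a b) := by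
  induction k generalizing a b with
  | zero => simp [trans]
  | succ k ih =>
    have h : (C (m 0 0) * C (m 1 1) - C (m 0 1) * C (m 1 0) : MvPolynomial (Fin 2) A) = 1 := by
      rw [← C_mul, ← C_mul, ← C_sub, hm, C_1]
    simp only [trans, pderiv_subst, trans_add_left, trans_add_right, trans_C_mul_left,
      trans_C_mul_right, ih, map_sub]
    linear_combination (subst m (trans k (pderiv 0 a) (pderiv 1 b)) -
      subst m (trans k (pderiv 1 a) (pderiv 0 b))) * h

end Forms

namespace Ops

variable {A : Type*} [CommRing A]

theorem form_map_mul (x : A) (b : List A) :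
    form (b.map ((ofRing A).mul x)) = C x * form b := by
  induction b with
  | nil => simp [form]
  | cons y t ih => simp only [List.map_cons, form, ih, List.length_map]; simp [ofRing]; ring

theorem form_map_neg (b : List A) :
    form (b.map (ofRing A).neg) = - form b := by
  induction b with
  | nil => simp [form]
  | cons y t ih => simp only [List.map_cons, form, ih, List.length_map]; simp [ofRing]; ring

theorem length_addL {α : Type*} (o : Ops α) (a b : List α) :
    (o.addL a b).length = max a.length b.length := by
  induction a generalizing b with
  | nil => simp [addL]
  | cons x t ih => cases b <;> simp [addL, ih]

theorem form_addL (a b : List A) :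
    form ((ofRing A).addL a b) =
      X 0 ^ (max a.length b.length - a.length) * form a +
      X 0 ^ (max a.length b.length - b.length) * form b := by
  induction a generalizing b with
  | nil => simp [addL, form]
  | cons x t ih =>
    cases b with
    | nil => simp [addL, form]
    | cons y s =>
      simp only [addL, form, ih, length_addL, List.length_cons, Nat.add_sub_add_right,
        Nat.succ_max_succ, Nat.succ_eq_add_one]
      have h1 : (X 0 : MvPolynomial (Fin 2) A) ^ max t.length s.length =
        X 0 ^ (max t.length s.length - t.length) * X 0 ^ t.length := by
        rw [← pow_add]; congr 1; omega
      have h2 : (X 0 : MvPolynomial (Fin 2) A) ^ max t.length s.length =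
        X 0 ^ (max t.length s.length - s.length) * X 0 ^ s.length := by
        rw [← pow_add]; congr 1; omega
      have h3 : (C ((ofRing A).add x y) : MvPolynomial (Fin 2) A) = C x + C y := by
        simp [ofRing]
      rw [h3, add_mul]
      nth_rewrite 1 [h1]
      nth_rewrite 1 [h2]
      ring

theorem form_addL_of_length_eq {a b : List A} (h : a.length = b.length) :
    form ((ofRing A).addL a b) = form a + form b := by
  simp [form_addL, h]

theorem length_mulL {α : Type*} (o : Ops α) (x : α) (t : List α) {b : List α} (hb : b ≠ []) :
    (o.mulL (x :: t) b).length = t.length + b.length := by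
  induction t generalizing x with
  | nil => simp [mulL]
  | cons y t ih =>
    have := List.length_pos_iff.2 hb
    simp [mulL, length_addL, ih]; omega

theorem form_mulL (a : List A) {b : List A} (hb : b ≠ []) :
    form ((ofRing A).mulL a b) = form a * form b := by
  induction a with
  | nil => simp [mulL, form]
  | cons x t ih =>
    cases t with
    | nil => simp [mulL, form, form_map_mul]
    | cons y t =>
      have hb' := List.length_pos_iff.2 hb
      have h0 : (C (ofRing A).zero : MvPolynomial (Fin 2) A) = 0 := by simp [ofRing]
      rw [mulL, form_addL, form, ih, form_map_mul, form.eq_2 x, h0]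
      simp only [List.length_cons, List.length_map, length_mulL _ _ _ hb]
      rw [show max b.length (t.length + b.length + 1) - b.length = t.length + 1 by omega,
        show max b.length (t.length + b.length + 1) - (t.length + b.length + 1) = 0 by omega]
      ring

theorem length_dx {α : Type*} (o : Ops α) (l : List α) : (o.dx l).length = l.length - 1 := by
  induction l with
  | nil => simp [dx]
  | cons x t ih => cases t <;> simp_all [dx]

theorem length_dyAux {α : Type*} (o : Ops α) (k : ℕ) (l : List α) :
    (o.dyAux k l).length = l.length := by
  induction l generalizing k with
  | nil => simp [dyAux]
  | cons x t ih => simp [dyAux, ih]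

theorem length_dy {α : Type*} (o : Ops α) (l : List α) : (o.dy l).length = l.length - 1 := by
  simp [dy, length_dyAux]

theorem C_nsmul' (k : ℕ) (a : A) :
    (C ((ofRing A).nsmul k a) : MvPolynomial (Fin 2) A) = (k : MvPolynomial (Fin 2) A) * C a := by
  simp [ofRing]

theorem form_dx (l : List A) : form ((ofRing A).dx l) = pderiv 0 (form l) := by
  induction l with
  | nil => simp [dx, form]
  | cons x t ih =>
    cases t with
    | nil => simp [dx, form]
    | cons y t =>
      rw [dx, form, ih, C_nsmul', form.eq_2 x]
      simp only [map_add, pderiv_mul, pderiv_pow, List.length_cons, length_dx]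
      simp; ring

theorem form_dyAux (k : ℕ) (l : List A) :
    form ((ofRing A).dyAux k l) = (k : MvPolynomial (Fin 2) A) * form l + X 1 * pderiv 1 (form l) := by
  induction l generalizing k with
  | nil => simp [dyAux, form]
  | cons x t ih =>
    rw [dyAux, form, ih, C_nsmul', form]
    simp only [map_add, pderiv_mul, pderiv_pow, length_dyAux]
    simp; ring

theorem form_dy (l : List A) : form ((ofRing A).dy l) = pderiv 1 (form l) := by
  cases l with
  | nil => simp [dy, dyAux, form]
  | cons x t =>
    rw [dy, List.tail_cons, form_dyAux, form]
    simp only [map_add, pderiv_mul, pderiv_pow]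
    simp

theorem length_tr {α : Type*} (o : Ops α) (k : ℕ) {a b : List α} (ha : k < a.length)
    (hb : k < b.length) : (o.tr k a b).length = a.length + b.length - 1 - 2 * k := by
  induction k generalizing a b with
  | zero =>
    cases a with
    | nil => simp at ha
    | cons x t =>
      rw [tr, length_mulL _ _ _ (List.length_pos_iff.1 hb)]; simp only [List.length_cons]; omega
  | succ k ih =>
    rw [tr, length_addL, List.length_map, ih, ih]
    all_goals simp only [length_dx, length_dy]
    all_goals omega

theorem form_tr (k : ℕ) {a b : List A} (ha : k < a.length) (hb : k < b.length) :
    form ((ofRing A).tr k a b) = trans k (form a) (form b) := by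
  induction k generalizing a b with
  | zero => exact form_mulL a (List.length_pos_iff.1 hb)
  | succ k ih =>
    have h1 : k < ((ofRing A).dx a).length := by rw [length_dx]; omega
    have h2 : k < ((ofRing A).dx b).length := by rw [length_dx]; omega
    have h3 : k < ((ofRing A).dy a).length := by rw [length_dy]; omega
    have h4 : k < ((ofRing A).dy b).length := by rw [length_dy]; omega
    rw [tr, form_addL_of_length_eq, form_map_neg, ih h1 h4, ih h3 h2, form_dx, form_dx, form_dy,
      form_dy, trans, sub_eq_add_neg]
    rw [List.length_map, length_tr _ _ h1 h4, length_tr _ _ h3 h2]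
    simp [length_dx, length_dy]

theorem pairAux_eq_sum (i : ℕ) {a b : List A} (h : a.length = b.length) :
    (ofRing A).pairAux i a b = ∑ j ∈ Finset.range a.length,
      (-1) ^ (i + j) * ((i + j).factorial * (a.length - 1 - j).factorial : ℕ) *
        (a.getD j 0 * b.getD j 0) := by
  induction a generalizing i b with
  | nil => simp [pairAux, ofRing]
  | cons x t ih =>
    cases b with
    | nil => simp at h
    | cons y s =>
      rw [pairAux, ih (i + 1) (by simpa using h), List.length_cons, Finset.sum_range_succ']
      change (_ + _ : A) = _
      rw [add_comm]
      simp only [List.getD_cons_succ, List.getD_cons_zero, Nat.add_sub_cancel, add_zero,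
        Nat.sub_zero]
      refine congrArg₂ (fun u v : A => u + v) (Finset.sum_congr rfl fun j _ => ?_) ?_
      · rw [show i + 1 + j = i + (j + 1) by ring, show t.length - 1 - j = t.length - (j + 1) by omega]
      · rcases Nat.even_or_odd i with hi | hi
        · simp [ofRing, Nat.even_iff.1 hi, hi.neg_one_pow]
        · simp [ofRing, Nat.odd_iff.1 hi, hi.neg_one_pow]

theorem pair_eq_sum {n : ℕ} {a b : List A} (ha : a.length = n + 1) (hb : b.length = n + 1) :
    (ofRing A).pair a b = ∑ j ∈ Finset.range (n + 1),
      (-1) ^ j * (j.factorial * (n - j).factorial : ℕ) * (a.getD j 0 * b.getD (n - j) 0) := by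
  rw [pair, pairAux_eq_sum _ (by simp [ha, hb]), ha]
  refine Finset.sum_congr rfl fun j hj => ?_
  have hj := Finset.mem_range.1 hj
  rw [zero_add, Nat.add_sub_cancel]
  congr 2
  rw [List.getD_eq_getElem?_getD, List.getD_eq_getElem?_getD, List.getElem?_reverse (by omega), hb,
    Nat.add_sub_cancel]

theorem getD_dx {n : ℕ} {a : List A} (ha : a.length = n + 1) (j : ℕ) (hj : j ≤ n) :
    ((ofRing A).dx a).getD j 0 = (n - j : ℕ) * a.getD j 0 := by
  induction a generalizing n j with
  | nil => simp at ha
  | cons x t ih =>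
    cases t with
    | nil =>
      simp only [List.length_cons, List.length_nil] at ha
      rw [show n - j = 0 by omega]
      simp [dx]
    | cons y t =>
      simp at ha
      subst ha
      cases j with
      | zero => simp [dx, ofRing]
      | succ j => rw [dx, List.getD_cons_succ, ih rfl j (by simpa using hj)]; simp

theorem getD_dyAux (k : ℕ) (a : List A) (j : ℕ) :
    ((ofRing A).dyAux k a).getD j 0 = (k + j : ℕ) * a.getD j 0 := by
  induction a generalizing k j with
  | nil => simp [dyAux]
  | cons x t ih =>
    cases j with
    | zero => simp [dyAux, ofRing]
    | succ j => rw [dyAux, List.getD_cons_succ, ih]; simp; ring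

theorem getD_dy (a : List A) (j : ℕ) :
    ((ofRing A).dy a).getD j 0 = (1 + j : ℕ) * a.getD (j + 1) 0 := by
  rw [dy, getD_dyAux]
  cases a <;> simp

theorem pair_rec {n : ℕ} {a b : List A} (ha : a.length = n + 2) (hb : b.length = n + 2) :
    (ofRing A).pair ((ofRing A).dx a) ((ofRing A).dy b) -
      (ofRing A).pair ((ofRing A).dy a) ((ofRing A).dx b) =
      ((n + 1 : ℕ) : A) * (ofRing A).pair a b := by
  rw [pair_eq_sum (n := n) (by simp [length_dx, ha]) (by simp [length_dy, hb]),
    pair_eq_sum (n := n) (by simp [length_dy, ha]) (by simp [length_dx, hb]),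
    pair_eq_sum ha hb]
  have h1 : ∀ j ∈ Finset.range (n + 1), (-1 : A) ^ j * (j.factorial * (n - j).factorial : ℕ) *
      (((ofRing A).dx a).getD j 0 * ((ofRing A).dy b).getD (n - j) 0) =
      (-1) ^ j * (j.factorial * (n + 1 - j).factorial : ℕ) *
        (a.getD j 0 * b.getD (n + 1 - j) 0) * (n + 1 - j : ℕ) := by
    intro j hj
    have hj := Finset.mem_range.1 hj
    rw [getD_dx ha j (by omega), getD_dy, show n + 1 - j = n - j + 1 by omega,
      Nat.factorial_succ]
    push_cast
    ring
  have h2 : ∀ j ∈ Finset.range (n + 1), (-1 : A) ^ j * (j.factorial * (n - j).factorial : ℕ) *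
      (((ofRing A).dy a).getD j 0 * ((ofRing A).dx b).getD (n - j) 0) =
      -((-1) ^ (j + 1) * ((j + 1).factorial * (n + 1 - (j + 1)).factorial : ℕ) *
        (a.getD (j + 1) 0 * b.getD (n + 1 - (j + 1)) 0) * (j + 1 : ℕ)) := by
    intro j hj
    have hj := Finset.mem_range.1 hj
    rw [getD_dx hb _ (by omega), getD_dy, show n + 1 - (n - j) = j + 1 by omega,
      show n + 1 - (j + 1) = n - j by omega, Nat.factorial_succ]
    push_cast
    ring
  rw [Finset.sum_congr rfl h1, Finset.sum_congr rfl h2, Finset.sum_neg_distrib, sub_neg_eq_add,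
    Finset.mul_sum]
  have h3 := Finset.sum_range_succ (fun j => (-1 : A) ^ j *
    (j.factorial * (n + 1 - j).factorial : ℕ) *
        (a.getD j 0 * b.getD (n + 1 - j) 0) * (n + 1 - j : ℕ)) (n + 1)
  have h4 := Finset.sum_range_succ' (fun j => (-1 : A) ^ j *
    (j.factorial * (n + 1 - j).factorial : ℕ) *
        (a.getD j 0 * b.getD (n + 1 - j) 0) * (j : ℕ)) (n + 1)
  simp only [Nat.sub_self, Nat.cast_zero, mul_zero, add_zero] at h3 h4
  rw [← h3, ← h4, ← Finset.sum_add_distrib]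
  refine Finset.sum_congr rfl fun j hj => ?_
  have hj := Finset.mem_range.1 hj
  rw [Nat.cast_sub (show j ≤ n + 1 by omega)]
  ring

theorem trans_form_eq_pair {n : ℕ} {a b : List A} (ha : a.length = n + 1)
    (hb : b.length = n + 1) :
    trans n (form a) (form b) = C ((n.factorial : A) * (ofRing A).pair a b) := by
  induction n generalizing a b with
  | zero =>
    obtain ⟨x, rfl⟩ := List.length_eq_one_iff.1 ha
    obtain ⟨y, rfl⟩ := List.length_eq_one_iff.1 hb
    simp [trans, form, pair, pairAux, ofRing]
  | succ n ih =>
    rw [trans, ← form_dx, ← form_dx, ← form_dy, ← form_dy,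
      ih (by simp [length_dx, ha]) (by simp [length_dy, hb]),
      ih (by simp [length_dy, ha]) (by simp [length_dx, hb]), ← C_sub, ← mul_sub,
      pair_rec ha hb, Nat.factorial_succ]
    push_cast
    ring_nf

end Ops
end CubicQuartic

namespace CubicQuartic

/-- Two coefficient lists of forms of degree `n`, the first being the transform of the second. -/
structure Transformed {A : Type*} [CommRing A] (m : Fin 2 → Fin 2 → A) (n : ℕ)
    (a' a : List A) : Prop where
  length_left : a'.length = n + 1
  length_right : a.length = n + 1
  form_eq : form a' = subst m (form a)

namespace Transformed

open Ops

variable {A : Type*} [CommRing A] {m : Fin 2 → Fin 2 → A} {n k : ℕ} {a a' b b' : List A}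

theorem tr (hm : m 0 0 * m 1 1 - m 0 1 * m 1 0 = 1) (l p : ℕ) (ha : Transformed m n a' a)
    (hb : Transformed m k b' b) (hn : p ≤ n := by decide) (hk : p ≤ k := by decide)
    (hl : n + k = l + 2 * p := by decide) :
    Transformed m l ((ofRing A).tr p a' b') ((ofRing A).tr p a b) := by
  obtain ⟨h1, h2, h3⟩ := ha
  obtain ⟨h4, h5, h6⟩ := hb
  refine ⟨?_, ?_, ?_⟩
  · rw [length_tr _ _ (by omega) (by omega)]; omega
  · rw [length_tr _ _ (by omega) (by omega)]; omega
  · rw [form_tr _ (by omega) (by omega), form_tr _ (by omega) (by omega), h3, h6,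
      trans_subst m hm]

theorem mulL (l : ℕ) (ha : Transformed m n a' a) (hb : Transformed m k b' b)
    (hl : n + k = l := by decide) :
    Transformed m l ((ofRing A).mulL a' b') ((ofRing A).mulL a b) := by
  obtain ⟨h1, h2, h3⟩ := ha
  obtain ⟨h4, h5, h6⟩ := hb
  have e (x y : List A) : (ofRing A).mulL x y = (ofRing A).tr 0 x y := rfl
  refine ⟨?_, ?_, ?_⟩
  · rw [e, length_tr _ _ (by omega) (by omega)]; omega
  · rw [e, length_tr _ _ (by omega) (by omega)]; omega
  · rw [form_mulL _ (by rintro rfl; simp at h4), form_mulL _ (by rintro rfl; simp at h5), h3, h6,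
      map_mul]

theorem pair [IsDomain A] [CharZero A] (hm : m 0 0 * m 1 1 - m 0 1 * m 1 0 = 1)
    (ha : Transformed m n a' a) (hb : Transformed m n b' b) :
    (ofRing A).pair a' b' = (ofRing A).pair a b := by
  have h1 := trans_form_eq_pair ha.length_left hb.length_left
  rw [ha.form_eq, hb.form_eq, trans_subst m hm,
    trans_form_eq_pair ha.length_right hb.length_right] at h1
  have h2 := C_injective _ _ ((algHom_C (subst m) _).symm.trans h1)
  exact (mul_left_cancel₀ (Nat.cast_ne_zero.2 n.factorial_ne_zero) h2).symm

variable [IsDomain A] [CharZero A]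

theorem prim_eq (hm : m 0 0 * m 1 1 - m 0 1 * m 1 0 = 1) {c c' f f' : List A}
    (hc : Transformed m 3 c' c) (hf : Transformed m 4 f' f) (i : Fin 6) :
    (ofRing A).prim c' f' i = (ofRing A).prim c f i := by
  have hDe := hc.tr hm 2 2 hc
  have hH := hf.tr hm 4 2 hf
  have hT := hf.tr hm 6 1 hH
  have hc2 := hc.mulL 6 hc
  have hc4 := hc2.mulL 12 hc2
  have hf2 := hf.mulL 8 hf
  have hf3 := hf.mulL 12 hf2
  have hDe2 := hDe.mulL 4 hDe
  fin_cases i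
  · exact hf.pair hm hf
  · exact hf.pair hm hH
  · exact hDe.pair hm hDe
  · exact congrArg₂ (· + ·) (hDe2.pair hm hf) (hc2.pair hm hT)
  · exact hDe2.pair hm hH
  · exact hc4.pair hm hf3

theorem scd_eq (hm : m 0 0 * m 1 1 - m 0 1 * m 1 0 = 1) {c c' f f' : List A}
    (hc : Transformed m 3 c' c) (hf : Transformed m 4 f' f) (i : Fin 14) :
    (ofRing A).scd c' f' i = (ofRing A).scd c f i := by
  have hDe := hc.tr hm 2 2 hc
  have hQ := hc.tr hm 3 1 hDe
  have hH := hf.tr hm 4 2 hf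
  have hT := hf.tr hm 6 1 hH
  have hc2 := hc.mulL 6 hc
  have hc4 := hc2.mulL 12 hc2
  have hf2 := hf.mulL 8 hf
  have hf3 := hf.mulL 12 hf2
  have hDe2 := hDe.mulL 4 hDe
  have hDe3 := hDe2.mulL 6 hDe
  have hc2De := hc2.mulL 8 hDe
  have hcQ := hc.mulL 6 hQ
  have hcQDe := hcQ.mulL 8 hDe
  have hc3Q := hc2.mulL 12 hcQ
  have hfH := hf.mulL 8 hH
  have hhh := hH.mulL 8 hH
  have hf2H := hf.mulL 12 hfH
  have hfHH := hf.mulL 12 hhh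
  fin_cases i
  · exact hDe2.pair hm hf
  · exact hc2De.pair hm hf2
  · exact hcQ.pair hm hT
  · exact hc2De.pair hm hfH
  · exact hcQDe.pair hm hf2
  · exact hc2De.pair hm hhh
  · exact hc4.pair hm hf2H
  · exact hDe3.pair hm hT
  · exact hcQDe.pair hm hfH
  · exact hc3Q.pair hm hf3
  · exact hc4.pair hm hfHH
  · exact hcQDe.pair hm hhh
  · exact hc3Q.pair hm hf2H
  · exact hc3Q.pair hm hfHH

end Transformed

/-- The list of coefficients of the `i`-th form. -/
def coeffL {A : Type*} (v : BinInv.Idx ![3, 4] → A) (i : Fin 2) : List A :=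
  List.ofFn fun k : Fin ((![3, 4] : Fin 2 → ℕ) i + 1) => v ⟨i, k⟩

theorem map_coeffL {A B : Type*} (g : A → B) (v : BinInv.Idx ![3, 4] → A) (i : Fin 2) :
    (coeffL v i).map g = coeffL (g ∘ v) i := by
  simp [coeffL, List.map_ofFn, Function.comp_def]

theorem form_ofFn {A : Type*} [CommRing A] (n : ℕ) (v : Fin (n + 1) → A) :
    form (List.ofFn v) = ∑ k : Fin (n + 1), C (v k) * X 0 ^ (n - (k : ℕ)) * X 1 ^ (k : ℕ) := by
  induction n with
  | zero => simp [form]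
  | succ n ih =>
    rw [List.ofFn_succ, form, ih, Finset.mul_sum]
    conv_rhs => rw [Fin.sum_univ_succ]
    simp only [List.length_ofFn, Fin.val_zero, Nat.sub_zero, pow_zero, mul_one, Fin.val_succ,
      Nat.add_sub_add_right]
    congr 1
    refine Finset.sum_congr rfl fun k _ => ?_
    ring

theorem form_coeffL (c : BinInv.Idx ![3, 4] → ℂ) (i : Fin 2) :
    form (coeffL c i) = BinInv.formAt ![3, 4] c i :=
  form_ofFn _ _

theorem eq_sum_of_isHomogeneous {F : MvPolynomial (Fin 2) ℂ} {n : ℕ} (hF : F.IsHomogeneous n) :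
    F = ∑ k : Fin (n + 1), C (coeff (Finsupp.single 0 (n - (k : ℕ)) + Finsupp.single 1 (k : ℕ)) F) *
      X 0 ^ (n - (k : ℕ)) * X 1 ^ (k : ℕ) := by
  have hmon (k : ℕ) (a : ℂ) : C a * X 0 ^ (n - k) * X 1 ^ k =
      monomial (Finsupp.single (0 : Fin 2) (n - k) + Finsupp.single 1 k) a := by
    rw [monomial_eq, Finsupp.prod_add_index' (by simp) (by simp [pow_add])]
    simp [mul_assoc]
  ext d
  simp only [hmon, coeff_sum, coeff_monomial]
  by_cases hd : d 0 + d 1 = n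
  · have hd' : Finsupp.single 0 (n - d 1) + Finsupp.single 1 (d 1) = d := by
      ext j; fin_cases j <;> simp; omega
    rw [Finset.sum_eq_single ⟨d 1, by omega⟩]
    · dsimp only
      rw [if_pos hd', hd']
    · intro k _ hk
      rw [if_neg]
      rintro rfl
      apply hk
      ext
      simp
    · simp
  · rw [Finset.sum_eq_zero]
    · by_contra h
      have := hF h
      rw [Finsupp.weight_apply, Finsupp.sum_fintype _ _ (by simp)] at this
      simp at this
      exact hd this
    · intro k _
      rw [if_neg]
      rintro rfl
      apply hd
      have := k.2
      simp; omega

theorem isHomogeneous_formAt {p : ℕ} (n : Fin p → ℕ) (c : BinInv.Idx n → ℂ) (i : Fin p) :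
    (BinInv.formAt n c i).IsHomogeneous (n i) := by
  refine IsHomogeneous.sum _ _ _ fun k _ => ?_
  have := ((isHomogeneous_C (Fin 2) (c ⟨i, k⟩)).mul (isHomogeneous_X_pow 0 (n i - (k : ℕ)))).mul
    (isHomogeneous_X_pow (R := ℂ) 1 (k : ℕ))
  convert this using 1
  have := k.2
  omega

theorem isHomogeneous_sl2Act (g : Matrix.SpecialLinearGroup (Fin 2) ℂ)
    {F : MvPolynomial (Fin 2) ℂ} {n : ℕ} (hF : F.IsHomogeneous n) :
    (BinInv.sl2Act g F).IsHomogeneous n := by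
  have := hF.aeval (fun i => ∑ j, C ((↑(g⁻¹) : Matrix (Fin 2) (Fin 2) ℂ) i j) * X j) (n := 1)
    fun i => IsHomogeneous.sum _ _ _ fun j _ => by
      exact (isHomogeneous_C (Fin 2) _).mul (isHomogeneous_X ℂ j)
  rw [one_mul] at this
  exact this

theorem transformed_coeffL (g : Matrix.SpecialLinearGroup (Fin 2) ℂ)
    (c : BinInv.Idx ![3, 4] → ℂ) (i : Fin 2) :
    Transformed (fun i j => (↑(g⁻¹) : Matrix (Fin 2) (Fin 2) ℂ) i j) ((![3, 4] : Fin 2 → ℕ) i)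
      (coeffL (BinInv.actPt ![3, 4] g c) i) (coeffL c i) := by
  refine ⟨by simp [coeffL], by simp [coeffL], ?_⟩
  rw [form_coeffL c]
  refine Eq.trans ?_ (eq_sum_of_isHomogeneous
    (isHomogeneous_sl2Act g (isHomogeneous_formAt ![3, 4] c i))).symm
  exact form_ofFn _ _

theorem det_inv_eq_one (g : Matrix.SpecialLinearGroup (Fin 2) ℂ) :
    (↑(g⁻¹) : Matrix (Fin 2) (Fin 2) ℂ) 0 0 * (↑(g⁻¹) : Matrix (Fin 2) (Fin 2) ℂ) 1 1 -
      (↑(g⁻¹) : Matrix (Fin 2) (Fin 2) ℂ) 0 1 * (↑(g⁻¹) : Matrix (Fin 2) (Fin 2) ℂ) 1 0 = 1 := by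
  rw [← Matrix.det_fin_two]
  exact (g⁻¹).2

/-- The ring of polynomial functions on the space of pairs of a cubic and a quartic. -/
abbrev Poly (A : Type*) [CommRing A] : Type _ := MvPolynomial (BinInv.Idx ![3, 4]) A

/-- The primary invariants as polynomials in the coefficients. -/
noncomputable def P (A : Type*) [CommRing A] (i : Fin 6) : Poly A :=
  (Ops.ofRing (Poly A)).prim (coeffL X 0) (coeffL X 1) i

/-- The secondary generating invariants as polynomials in the coefficients. -/
noncomputable def S (A : Type*) [CommRing A] (i : Fin 14) : Poly A :=
  (Ops.ofRing (Poly A)).scd (coeffL X 0) (coeffL X 1) i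

theorem map_P {A B : Type*} [CommRing A] [CommRing B] (φ : Poly A →+* B) (i : Fin 6) :
    φ (P A i) = (Ops.ofRing B).prim (coeffL (φ ∘ X) 0) (coeffL (φ ∘ X) 1) i := by
  rw [P, Ops.map_prim, map_coeffL, map_coeffL]

theorem map_S {A B : Type*} [CommRing A] [CommRing B] (φ : Poly A →+* B) (i : Fin 14) :
    φ (S A i) = (Ops.ofRing B).scd (coeffL (φ ∘ X) 0) (coeffL (φ ∘ X) 1) i := by
  rw [S, Ops.map_scd, map_coeffL, map_coeffL]

theorem P_mem (i : Fin 6) : P ℂ i ∈ BinInv.invariantRing ![3, 4] := by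
  intro g c
  have h (v : BinInv.Idx ![3, 4] → ℂ) : (eval v) ∘ X = v := by ext; simp
  rw [map_P, map_P, h, h]
  exact (transformed_coeffL g c 0).prim_eq (det_inv_eq_one g) (transformed_coeffL g c 1) i

theorem S_mem (i : Fin 14) : S ℂ i ∈ BinInv.invariantRing ![3, 4] := by
  intro g c
  have h (v : BinInv.Idx ![3, 4] → ℂ) : (eval v) ∘ X = v := by ext; simp
  rw [map_S, map_S, h, h]
  exact (transformed_coeffL g c 0).scd_eq (det_inv_eq_one g) (transformed_coeffL g c 1) i

section Homogeneous

variable {σ A : Type*} [CommRing A]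

/-- All entries of a list are homogeneous of degree `d`. -/
def HomL (d : ℕ) (l : List (MvPolynomial σ A)) : Prop := ∀ x ∈ l, x.IsHomogeneous d

namespace HomL

open Ops

variable {d e : ℕ} {a b : List (MvPolynomial σ A)}

theorem addL (ha : HomL d a) (hb : HomL d b) : HomL d ((ofRing _).addL a b) := by
  induction a generalizing b with
  | nil => simpa [Ops.addL]
  | cons x t ih =>
    cases b with
    | nil => simpa [Ops.addL]
    | cons y s =>
      simp only [HomL, List.forall_mem_cons] at ha hb
      simp only [HomL, Ops.addL, List.forall_mem_cons]
      exact ⟨ha.1.add hb.1, ih ha.2 hb.2⟩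

theorem mulL (ha : HomL d a) (hb : HomL e b) : HomL (d + e) ((ofRing _).mulL a b) := by
  induction a with
  | nil => simp [Ops.mulL, HomL]
  | cons x t ih =>
    simp only [HomL, List.forall_mem_cons] at ha
    have h1 : HomL (d + e) (b.map ((ofRing _).mul x)) := by
      intro y hy
      obtain ⟨z, hz, rfl⟩ := List.mem_map.1 hy
      exact ha.1.mul (hb z hz)
    cases t with
    | nil => exact h1
    | cons y t =>
      refine h1.addL ?_
      simp only [HomL, List.forall_mem_cons]
      exact ⟨isHomogeneous_zero _ _ _, ih ha.2⟩

theorem _root_.CubicQuartic.isHomogeneous_nsmul {x : MvPolynomial σ A} (hx : x.IsHomogeneous d)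
    (k : ℕ) : ((ofRing _).nsmul k x).IsHomogeneous d := by
  change (k • x).IsHomogeneous d
  rw [nsmul_eq_mul]
  simpa using (isHomogeneous_C σ (k : A)).mul hx

theorem dx (ha : HomL d a) : HomL d ((ofRing _).dx a) := by
  induction a with
  | nil => simp [Ops.dx, HomL]
  | cons x t ih =>
    simp only [HomL, List.forall_mem_cons] at ha
    cases t with
    | nil => simp [Ops.dx, HomL]
    | cons y t =>
      simp only [HomL, Ops.dx, List.forall_mem_cons]
      exact ⟨isHomogeneous_nsmul ha.1 _, ih ha.2⟩

theorem dyAux (k : ℕ) (ha : HomL d a) : HomL d ((ofRing _).dyAux k a) := by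
  induction a generalizing k with
  | nil => simp [Ops.dyAux, HomL]
  | cons x t ih =>
    simp only [HomL, List.forall_mem_cons] at ha
    simp only [HomL, Ops.dyAux, List.forall_mem_cons]
    exact ⟨isHomogeneous_nsmul ha.1 _, ih _ ha.2⟩

theorem dy (ha : HomL d a) : HomL d ((ofRing _).dy a) :=
  dyAux 1 fun x hx => ha x (List.mem_of_mem_tail hx)

theorem tr (p : ℕ) (ha : HomL d a) (hb : HomL e b) : HomL (d + e) ((ofRing _).tr p a b) := by
  induction p generalizing a b with
  | zero => exact ha.mulL hb
  | succ p ih =>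
    refine (ih ha.dx hb.dy).addL fun y hy => ?_
    obtain ⟨z, hz, rfl⟩ := List.mem_map.1 hy
    exact (ih ha.dy hb.dx z hz).neg

theorem pairAux (i : ℕ) (ha : HomL d a) (hb : HomL e b) :
    ((ofRing _).pairAux i a b).IsHomogeneous (d + e) := by
  induction a generalizing i b with
  | nil => exact isHomogeneous_zero _ _ _
  | cons x t ih =>
    cases b with
    | nil => exact isHomogeneous_zero _ _ _
    | cons y s =>
      simp only [HomL, List.forall_mem_cons] at ha hb
      refine IsHomogeneous.add ?_ (ih _ ha.2 hb.2)
      split_ifs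
      · exact isHomogeneous_nsmul (ha.1.mul hb.1) _
      · exact (isHomogeneous_nsmul (ha.1.mul hb.1) _).neg

theorem pair (ha : HomL d a) (hb : HomL e b) :
    ((ofRing _).pair a b).IsHomogeneous (d + e) :=
  pairAux 0 ha fun x hx => hb x (List.mem_reverse.1 hx)

end HomL

end Homogeneous

theorem homL_coeffL (A : Type*) [CommRing A] (i : Fin 2) :
    HomL 1 (coeffL (X : _ → Poly A) i) := by
  intro x hx
  obtain ⟨k, rfl⟩ := List.mem_ofFn.1 hx
  exact isHomogeneous_X _ _

theorem isHomogeneous_P (A : Type*) [CommRing A] (i : Fin 6) :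
    (P A i).IsHomogeneous (![2, 3, 4, 5, 6, 7] i) := by
  have hc := homL_coeffL A 0
  have hf := homL_coeffL A 1
  have hDe : HomL 2 ((Ops.ofRing (Poly A)).hessC (coeffL X 0)) := hc.tr 2 hc
  have hH : HomL 2 ((Ops.ofRing (Poly A)).hessF (coeffL X 1)) := hf.tr 2 hf
  have hT : HomL 3 ((Ops.ofRing (Poly A)).jacF (coeffL X 1)) := hf.tr 1 hH
  have hc2 : HomL 2 ((Ops.ofRing (Poly A)).c2 (coeffL X 0)) := hc.mulL hc
  have hc4 : HomL 4 ((Ops.ofRing (Poly A)).c4 (coeffL X 0)) := hc2.mulL hc2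
  have hf2 : HomL 2 ((Ops.ofRing (Poly A)).f2 (coeffL X 1)) := hf.mulL hf
  have hf3 : HomL 3 ((Ops.ofRing (Poly A)).f3 (coeffL X 1)) := hf.mulL hf2
  have hDe2 : HomL 4 ((Ops.ofRing (Poly A)).De2 (coeffL X 0)) := hDe.mulL hDe
  rw [P, Ops.prim]
  fin_cases i <;> simp only [Fin.zero_eta, Fin.mk_one, Fin.reduceFinMk, Matrix.cons_val, Matrix.cons_val_zero, Matrix.cons_val_one]
  · exact hf.pair hf
  · exact hf.pair hH
  · exact hDe.pair hDe
  · exact (hDe2.pair hf).add (hc2.pair hT)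
  · exact hDe2.pair hH
  · exact hc4.pair hf3

/-- The degrees of the secondary generating invariants. -/
def degS : Fin 14 → ℕ := ![5, 6, 7, 7, 8, 8, 8, 9, 9, 9, 9, 10, 10, 11]

theorem isHomogeneous_S (A : Type*) [CommRing A] (i : Fin 14) :
    (S A i).IsHomogeneous (degS i) := by
  have hc := homL_coeffL A 0
  have hf := homL_coeffL A 1
  have hDe : HomL 2 ((Ops.ofRing (Poly A)).hessC (coeffL X 0)) := hc.tr 2 hc
  have hQ : HomL 3 ((Ops.ofRing (Poly A)).jacC (coeffL X 0)) := hc.tr 1 hDe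
  have hH : HomL 2 ((Ops.ofRing (Poly A)).hessF (coeffL X 1)) := hf.tr 2 hf
  have hT : HomL 3 ((Ops.ofRing (Poly A)).jacF (coeffL X 1)) := hf.tr 1 hH
  have hc2 : HomL 2 ((Ops.ofRing (Poly A)).c2 (coeffL X 0)) := hc.mulL hc
  have hc4 : HomL 4 ((Ops.ofRing (Poly A)).c4 (coeffL X 0)) := hc2.mulL hc2
  have hf2 : HomL 2 ((Ops.ofRing (Poly A)).f2 (coeffL X 1)) := hf.mulL hf
  have hf3 : HomL 3 ((Ops.ofRing (Poly A)).f3 (coeffL X 1)) := hf.mulL hf2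
  have hDe2 : HomL 4 ((Ops.ofRing (Poly A)).De2 (coeffL X 0)) := hDe.mulL hDe
  have hDe3 : HomL 6 ((Ops.ofRing (Poly A)).De3 (coeffL X 0)) := hDe2.mulL hDe
  have hc2De : HomL 4 ((Ops.ofRing (Poly A)).c2De (coeffL X 0)) := hc2.mulL hDe
  have hcQ : HomL 4 ((Ops.ofRing (Poly A)).cQ (coeffL X 0)) := hc.mulL hQ
  have hcQDe : HomL 6 ((Ops.ofRing (Poly A)).cQDe (coeffL X 0)) := hcQ.mulL hDe
  have hc3Q : HomL 6 ((Ops.ofRing (Poly A)).c3Q (coeffL X 0)) := hc2.mulL hcQ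
  have hfH : HomL 3 ((Ops.ofRing (Poly A)).fH (coeffL X 1)) := hf.mulL hH
  have hhh : HomL 4 ((Ops.ofRing (Poly A)).hh (coeffL X 1)) := hH.mulL hH
  have hf2H : HomL 4 ((Ops.ofRing (Poly A)).f2H (coeffL X 1)) := hf.mulL hfH
  have hfHH : HomL 5 ((Ops.ofRing (Poly A)).fHH (coeffL X 1)) := hf.mulL hhh
  rw [S, Ops.scd, degS]
  fin_cases i <;> simp only [Fin.zero_eta, Fin.mk_one, Fin.reduceFinMk, Matrix.cons_val, Matrix.cons_val_zero, Matrix.cons_val_one]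
  · exact hDe2.pair hf
  · exact hc2De.pair hf2
  · exact hcQ.pair hT
  · exact hc2De.pair hfH
  · exact hcQDe.pair hf2
  · exact hc2De.pair hhh
  · exact hc4.pair hf2H
  · exact hDe3.pair hT
  · exact hcQDe.pair hfH
  · exact hc3Q.pair hf3
  · exact hc4.pair hfHH
  · exact hcQDe.pair hhh
  · exact hc3Q.pair hf2H
  · exact hc3Q.pair hfHH

end CubicQuartic

namespace CubicQuartic

namespace Packed

/-- The radix in which elements of `𝔽₁₀₁[θ]`, `θ ^ 20 = 2`, are packed into natural numbers. -/
abbrev radix : ℕ := 1048576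

/-- Reduce the first `k` digits modulo `101`. -/
def normalize : ℕ → ℕ → ℕ
  | 0, _ => 0
  | k + 1, N => N % 1048576 % 101 + 1048576 * normalize k (N / 1048576)

/-- Addition of packed elements. -/
def add (a b : ℕ) : ℕ := normalize 20 (a + b)

/-- Replace `θ ^ 20` by `2`. -/
def fold (N : ℕ) : ℕ := normalize 20 (N % 2 ^ 400 + 2 * (N / 2 ^ 400))

/-- Multiplication of packed elements. -/
def mul (a b : ℕ) : ℕ := fold (a * b)

/-- Natural multiples of packed elements. -/
def nsmul (k a : ℕ) : ℕ := normalize 20 (k % 101 * a)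

/-- The operations on packed elements. -/
def ops : Ops ℕ := ⟨0, add, mul, nsmul 100, nsmul⟩

/-- The operations on packed dual numbers. -/
def dualOps : Ops (ℕ × ℕ) where
  zero := (0, 0)
  add x y := (add x.1 y.1, add x.2 y.2)
  mul x y := (mul x.1 y.1, add (mul x.1 y.2) (mul y.1 x.2))
  neg x := (nsmul 100 x.1, nsmul 100 x.2)
  nsmul k x := (nsmul k x.1, nsmul k x.2)

/-- The value at `b` of the polynomial with coefficient list `l`. -/
def horner {R : Type*} [CommSemiring R] (b : R) (l : List ℕ) : R :=
  l.foldr (fun (d : ℕ) r => (d : R) + b * r) 0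

/-- The packed natural number `a` represents `x`. -/
def Rep {K : Type*} [CommRing K] (θ : K) (a : ℕ) (x : K) : Prop :=
  ∃ l : List ℕ, l.length = 20 ∧ (∀ d ∈ l, d < 101) ∧ a = horner radix l ∧
    x = horner θ l

/-- Operations on natural numbers, used for lists of digits. -/
def natOps : Ops ℕ := ⟨0, (· + ·), (· * ·), id, (· * ·)⟩

section

variable {R : Type*} [CommSemiring R] (b : R)

@[simp] theorem horner_nil : horner b [] = 0 := rfl

@[simp] theorem horner_cons (d : ℕ) (l : List ℕ) :
    horner b (d :: l) = (d : R) + b * horner b l := rfl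

theorem horner_append (l m : List ℕ) :
    horner b (l ++ m) = horner b l + b ^ l.length * horner b m := by
  induction l with
  | nil => simp
  | cons x t ih => simp only [List.cons_append, horner_cons, ih, List.length_cons]; ring

theorem horner_addL (l m : List ℕ) :
    horner b (natOps.addL l m) = horner b l + horner b m := by
  induction l generalizing m with
  | nil => simp [Ops.addL]
  | cons x t ih =>
    cases m with
    | nil => simp [Ops.addL]
    | cons y s =>
      have h : natOps.addL (x :: t) (y :: s) = (x + y) :: natOps.addL t s := rfl
      rw [h, horner_cons, ih, horner_cons, horner_cons]; push_cast; ring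

theorem horner_map_mul (k : ℕ) (l : List ℕ) :
    horner b (l.map (k * ·)) = k * horner b l := by
  induction l with
  | nil => simp
  | cons x t ih => simp only [List.map_cons, horner_cons, ih]; push_cast; ring

theorem horner_mulL (l m : List ℕ) :
    horner b (natOps.mulL l m) = horner b l * horner b m := by
  induction l with
  | nil => simp [Ops.mulL]
  | cons x t ih =>
    have h : horner b (m.map (natOps.mul x)) = x * horner b m :=
      horner_map_mul b x m
    cases t with
    | nil => simp [Ops.mulL, h, horner_cons]
    | cons y s =>
      have e : natOps.mulL (x :: y :: s) m =
        natOps.addL (m.map (natOps.mul x)) (0 :: natOps.mulL (y :: s) m) := rfl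
      rw [e, horner_addL, h, horner_cons, ih, horner_cons b x]
      push_cast; ring

theorem horner_lt {b : ℕ} (l : List ℕ) (hl : ∀ d ∈ l, d < b) : horner b l < b ^ l.length := by
  induction l with
  | nil => simp
  | cons x t ih =>
    simp only [List.forall_mem_cons] at hl
    have h1 := ih hl.2
    have h2 := Nat.mul_le_mul_left b (Nat.succ_le_of_lt h1)
    have h3 := hl.1
    rw [horner_cons, List.length_cons, pow_succ, Nat.cast_id]
    rw [Nat.mul_succ] at h2
    rw [mul_comm (b ^ _)]; omega

end

theorem forall_addL {l m : List ℕ} {u v : ℕ} (hl : ∀ d ∈ l, d ≤ u) (hm : ∀ d ∈ m, d ≤ v) :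
    ∀ d ∈ natOps.addL l m, d ≤ u + v := by
  induction l generalizing m with
  | nil => intro d hd; exact (hm d hd).trans (by omega)
  | cons x t ih =>
    cases m with
    | nil => intro d hd; exact (hl d hd).trans (by omega)
    | cons y s =>
      simp only [List.forall_mem_cons, Ops.addL] at hl hm ⊢
      exact ⟨Nat.add_le_add hl.1 hm.1, ih hl.2 hm.2⟩

theorem forall_map_mul {l : List ℕ} {k v : ℕ} (hl : ∀ d ∈ l, d ≤ v) :
    ∀ d ∈ l.map (k * ·), d ≤ k * v := by
  intro d hd
  obtain ⟨e, he, rfl⟩ := List.mem_map.1 hd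
  exact Nat.mul_le_mul_left _ (hl e he)

theorem forall_mulL {l m : List ℕ} {u v : ℕ} (hl : ∀ d ∈ l, d ≤ u) (hm : ∀ d ∈ m, d ≤ v) :
    ∀ d ∈ natOps.mulL l m, d ≤ l.length * (u * v) := by
  induction l with
  | nil => simp [Ops.mulL]
  | cons x t ih =>
    simp only [List.forall_mem_cons] at hl
    have h1 : ∀ d ∈ m.map (natOps.mul x), d ≤ u * v := fun d hd =>
      (forall_map_mul hm d hd).trans (Nat.mul_le_mul_right _ hl.1)
    cases t with
    | nil => simpa [Ops.mulL] using h1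
    | cons y s =>
      rw [Ops.mulL, List.length_cons, Nat.add_mul, Nat.add_comm, Nat.one_mul]
      refine forall_addL h1 ?_
      simp only [List.forall_mem_cons]
      exact ⟨Nat.zero_le _, ih hl.2⟩

theorem normalize_horner (k : ℕ) (l : List ℕ) (hk : l.length = k) (hl : ∀ d ∈ l, d < radix) :
    normalize k (horner radix l) = horner radix (l.map (· % 101)) := by
  induction l generalizing k with
  | nil => subst hk; simp [normalize]
  | cons x t ih =>
    subst hk
    simp only [List.forall_mem_cons] at hl
    rw [List.length_cons, normalize, List.map_cons, horner_cons, horner_cons]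
    rw [Nat.cast_id, Nat.cast_id]
    have h1 : (x + radix * horner radix t) % 1048576 = x := by
      rw [Nat.add_mul_mod_self_left, Nat.mod_eq_of_lt hl.1]
    have h2 : (x + radix * horner radix t) / 1048576 = horner radix t := by
      rw [Nat.add_mul_div_left _ _ (by norm_num), Nat.div_eq_of_lt hl.1, zero_add]
    rw [h1, h2, ih _ rfl hl.2]

theorem rep_zero {K : Type*} [CommRing K] {θ : K} : Rep θ 0 (0 : K) :=
  ⟨List.replicate 20 0, by simp, by simp, by simp [List.replicate], by simp [List.replicate]⟩

section

variable {K : Type*} [CommRing K] [CharP K 101] {θ : K}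

theorem horner_map_mod (l : List ℕ) :
    horner θ (l.map (· % 101)) = horner θ l := by
  induction l with
  | nil => rfl
  | cons x t ih => rw [List.map_cons, horner_cons, horner_cons, ih,
      CharP.cast_eq_mod K 101 x]

theorem rep_normalize (l : List ℕ) (hk : l.length = 20) (hl : ∀ d ∈ l, d < radix) :
    Rep θ (normalize 20 (horner radix l)) (horner θ l) := by
  refine ⟨l.map (· % 101), by simpa, ?_, normalize_horner 20 l hk hl, (horner_map_mod l).symm⟩
  intro d hd
  obtain ⟨e, -, rfl⟩ := List.mem_map.1 hd
  exact Nat.mod_lt _ (by norm_num)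

theorem rep_add {a b : ℕ} {x y : K} (ha : Rep θ a x) (hb : Rep θ b y) :
    Rep θ (add a b) (x + y) := by
  obtain ⟨l, hl, hl', rfl, rfl⟩ := ha
  obtain ⟨m, hm, hm', rfl, rfl⟩ := hb
  rw [add, ← horner_addL, ← horner_addL]
  refine rep_normalize _ (by simp [Ops.length_addL, hl, hm]) fun d hd => ?_
  have := forall_addL (fun d hd => (hl' d hd).le) (fun d hd => (hm' d hd).le) d hd
  exact this.trans_lt (by norm_num)

theorem rep_nsmul {a : ℕ} {x : K} (k : ℕ) (ha : Rep θ a x) :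
    Rep θ (nsmul k a) (k • x) := by
  obtain ⟨l, hl, hl', rfl, rfl⟩ := ha
  have h1 := horner_map_mul radix (k % 101) l
  simp only [Nat.cast_id] at h1
  rw [nsmul, nsmul_eq_mul, CharP.cast_eq_mod K 101 k, ← h1, ← horner_map_mul]
  refine rep_normalize _ (by simpa) fun d hd => ?_
  have := forall_map_mul (fun d hd => (hl' d hd).le) d hd
  have h2 := Nat.mul_le_mul_right 101 (Nat.mod_lt k (show 101 > 0 by norm_num)).le
  exact (this.trans h2).trans_lt (by norm_num)

theorem rep_neg {a : ℕ} {x : K} (ha : Rep θ a x) : Rep θ (nsmul 100 a) (-x) := by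
  have h : (101 : K) = 0 := by exact_mod_cast CharP.cast_eq_zero K 101
  have h1 : -x = 100 • x := by
    rw [nsmul_eq_mul]; push_cast; linear_combination -x * h
  rw [h1]
  exact rep_nsmul 100 ha

theorem rep_mul (hθ : θ ^ 20 = 2) {a b : ℕ} {x y : K} (ha : Rep θ a x) (hb : Rep θ b y) :
    Rep θ (mul a b) (x * y) := by
  obtain ⟨l, hl, hl', rfl, rfl⟩ := ha
  obtain ⟨m, hm, hm', rfl, rfl⟩ := hb
  rw [mul, ← horner_mulL, ← horner_mulL, fold]
  have hb := forall_mulL (fun d hd => Nat.le_of_lt_succ (hl' d hd))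
    (fun d hd => Nat.le_of_lt_succ (hm' d hd))
  rw [hl] at hb
  have hlen : (natOps.mulL l m).length = 39 := by
    cases l with
    | nil => simp at hl
    | cons x t =>
      simp only [List.length_cons] at hl
      rw [Ops.length_mulL _ _ _ (by rintro rfl; simp at hm)]; omega
  generalize natOps.mulL l m = w at hb hlen
  have hr : radix ^ 20 = 2 ^ 400 := by rw [show radix = 2 ^ 20 by norm_num, ← pow_mul]
  have hw := horner_append radix (w.take 20) (w.drop 20)
  have hw' := horner_append θ (w.take 20) (w.drop 20)
  have ht : (w.take 20).length = 20 := by simp [hlen]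
  have hlt : horner radix (w.take 20) < 2 ^ 400 := by
    have := horner_lt (b := radix) (w.take 20)
      fun d hd => (hb d (List.mem_of_mem_take hd)).trans_lt (by norm_num)
    rwa [ht, show radix ^ 20 = 2 ^ 400 from hr] at this
  rw [List.take_append_drop, ht] at hw hw'
  rw [show radix ^ 20 = 2 ^ 400 from hr] at hw
  have h1 : horner radix w % 2 ^ 400 = horner radix (w.take 20) := by
    rw [hw, Nat.add_mul_mod_self_left, Nat.mod_eq_of_lt hlt]
  have h2 : horner radix w / 2 ^ 400 = horner radix (w.drop 20) := by
    rw [hw, Nat.add_mul_div_left _ _ (by positivity), Nat.div_eq_of_lt hlt, zero_add]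
  have h3 := horner_map_mul radix 2 (w.drop 20)
  have h4 := horner_map_mul θ 2 (w.drop 20)
  simp only [Nat.cast_id] at h3
  rw [hθ] at hw'
  rw [h1, h2, ← h3, hw', show (2 : K) = ((2 : ℕ) : K) by norm_num, ← h4, ← horner_addL,
    ← horner_addL]
  refine rep_normalize _ (by simp [Ops.length_addL, hlen]) fun d hd => ?_
  have := forall_addL (fun d hd => hb d (List.mem_of_mem_take hd))
    (forall_map_mul (k := 2) fun d hd => hb d (List.mem_of_mem_drop hd)) d hd
  exact this.trans_lt (by norm_num)


theorem rel_ops (hθ : θ ^ 20 = 2) : Ops.Rel ops (Ops.ofRing K) (Rep θ) where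
  zero := rep_zero
  add := rep_add
  mul := rep_mul hθ
  neg := rep_neg
  nsmul := fun k _ _ h => rep_nsmul k h

theorem rel_dualOps (hθ : θ ^ 20 = 2) :
    Ops.Rel dualOps (Ops.ofRing (DualNumber K))
      (fun a x => Rep θ a.1 x.fst ∧ Rep θ a.2 x.snd) where
  zero := ⟨rep_zero, rep_zero⟩
  add h h' := ⟨rep_add h.1 h'.1, rep_add h.2 h'.2⟩
  mul := by
    intro a a' b b' h h'
    refine ⟨rep_mul hθ h.1 h'.1, ?_⟩
    have e : ((Ops.ofRing (DualNumber K)).mul a' b').snd = a'.fst * b'.snd + b'.fst * a'.snd := by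
      change (a' * b').snd = _
      rw [TrivSqZeroExt.snd_mul, smul_eq_mul, op_smul_eq_mul, mul_comm a'.snd]
    rw [e]
    exact rep_add (rep_mul hθ h.1 h'.2) (rep_mul hθ h'.1 h.2)
  neg h := ⟨rep_neg h.1, rep_neg h.2⟩
  nsmul := fun k _ _ h => ⟨rep_nsmul k h.1, rep_nsmul k h.2⟩

end

end Packed
end CubicQuartic

namespace CubicQuartic
namespace Packed

/-- Packed coefficients of the cubic and the quartic at the base point. -/
def point : Fin 2 → List ℕ := ![[
  132981789701176509173247110279364868820178838147843615687707626137670605285881837449554943405326183144537430854467649,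
  0,
  0,
  34476851712276962054426133607300546600771154584597099607751639511208082781484627143337458804494288165258415025684545], [
  132981982281816119669484302167448905621547062523369431173048807133915413424449843562883249106066239640746458132512839,
  132981789701176509173247110279364868820178838147843615687707626137670605285881837449554943405326183144537430854467649,
  140369874883290340956514304652945824470717620689989341325936723739321090507620430021854244019274624019929181477404756,
  19701111131350905176596567578319212912626413594060078667385847421651922981342229653649233245972703545691836668444737,
  226561627222476018419981382641439045896242204206839230966450624780293877991992040472204741492925955035568381735469153]]

/-- Packed values of the basis invariants at the base point. -/
def basisValue : List ℕ := [
  1,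
  147757600738460680046888276737579505502892365321583396439655322789463020669603232964989053048025245867258430569316366,
  88654664248653191218121415411434716411875333811088992929222497591436184221642717280473700930817916570953659680030788,
  81266851497586469088108139635080764369577089704109307821111417737358341090686800791002229778502589181052473820839971,
  7387953663888218269765627986797131444652579796618997369579548163810547602719519139790486502913083434296338859163666,
  22163642576841618393220185297559854131744149184741767720413292335734687447445477065846550060958511677874654408605795,
  197010103786841736445233124169164432599339205016539362304290929928669599149634761115397243612300795188510160261742681,
  194547534764593547664882868321146276037651609618495764794481297442102665764034139332996498870609651379003141066326045,
  78804089894790499172935131776827174092674103680056912442084175315170039653031157197511254656637051238420198248677466,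
  164995994889324687735600624835016997685636340073112055314567005982940507137645992001114590677862244799040237930020958,
  128056618777283309697817446783978579556667078616348259979503642509173671744529599967736072724841151274747775229624359,
  142832486179450603080512182930023899415034113588866996097575621209066913486713928983953053476460552340074210916302852,
  142832333524061776556730989616711573723319266328383304365135966592711206250435159520340295140281188205881212952117289,
  233949538612573109581400628505544588696119632193132564604231433822397541646713202970945686524724229823381772968132658,
  197010204774280303634293564968813669450522274637327683571053256239029814770896812844567807232812040943160433118806096,
  83729432262547571722672727530778586944250133168894492791082900127940281001698568214552513986867239243831979630657564,
  125594040360708007604742215165120190529123326697124732124931059910155304537791252922728702873383847748402144015810639,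
  88654748796224246828582133537881204346485851535187078274183068875660868853685464631742319058027082028461678201405526,
  236412166348302997186296842261335457959811855857446998689493267015058758783915799515717893812244580120780860044607537,
  93579931463146163893466724432359575910852971289011999823493004536167793470110454900920939730628599641752893061595179]

/-- Six packed tangent directions. -/
def direction : Fin 6 → Fin 2 → List ℕ := ![
  ![[0, 0, 0, 0], [
    152682809239268137241492786310812664770211025373947124561993432529159477112835578659809966020566621354845054684889096,
    59103096190783748388304035917621691362864144203446843751218365405745370320542294923063855234742355524854795573657649,
    192084993925019853425639082467860441989440889046806844142438196424494686724217248752639509365250175672532743715029028,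
    155145432278112196610680118106020415850610712760588485866201610954745577037133906390743851377813158447193462098886685,
    209323296482494678919889628354546470469357099221997006151698658750541009367664596747773334346927799901048008977940487]],
  ![[0, 0, 0, 0], [
    88654542124503839693796032900697670476675915049453692571486010543433693094960698668726038543043350265784981606367234,
    152683001819768883647018393738904775088574531482858813096402599120179877889559590661664983657049474984003513637404705,
    29551593891956560165756136198741457777764511635410309590824191224274189705916096702845776922410390776210481816272896,
    189622359143550230086983408813527430535455723741082460662685386293952289387759378608045068063887518730179278763196421,
    174846423633569645432107180417443028148356658551842700831667508237683956094938694443217215538330707517503832041979947]],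
  ![[0, 0, 0, 83729293698423200966106672139807554443504010713952429980910375787240433338713923803112238395370462456927874170486812], [
    51715166012451262932301890458185977969044008119576021582433435272387231658553241992331219134826783289180788962099216,
    83729277258712471619850853671635093707174148246774249997157310801653118234360610557069829550355333453759803577860166,
    157608203275026983475028178034313957780505671646137705548143509670068249867857020738000190258831386826268194297086049,
    236412095892126302600041412631965355686380528086062543891478355408856230847631445871712702884892208696853049966067723,
    32014155868648672411500698877068690949652164075900261040806540717825831355602115940465514396263940700175363525836806]],
  ![[0, 0, 0, 0], [
    140369679954311964272151400710969938990275251414124842124143125608889451310383596844188881433201911420522570801217561,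
    172383918021780813030706316930494533984249380461266686230327151946784420701624045271196665042461806554225444739088405,
    206860642912684393495231457640741735140161453684468448116074930318629110718446320418840888147051913256854912003735615,
    46789950466161640839391188185945189638154951469096386055763192255704230709231700613699660676596708250474421455683613,
    216711156204527283769008870910314366680293222117639190870971101505467231841031235165435245764391187474107672059445319]],
  ![[0, 0, 0, 0], [
    49252596990153799648008495757873640909001753591691735966364616272810807403962478966108652100933413386847385764757573,
    206860567759341902608262743843329785478640704221855902077917642108047600431732097204520258013736869247530835585794098,
    14775841568371343230629088241086119588385205848722113852525661303839158416446026730918821583354778098233410806874112,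
    68953621225413463930452471081019219445203914366893442856837529386947762226582866993733471210240548267217939355140131,
    214248610667568298069167443204829732558942368235304390136329418861937142537473572171000722174426855142080540718399545]],
  ![[0, 0, 0, 0], [
    19701024235248465503197545590278569285006713557182499206383066764510660244642442033526084376607510561034275993419853,
    157608132818740541227662815716458407935335472743951292953902130048258073110877296623754829147205253572027569055727660,
    118206234655300390239707159344144566527876230044916759531085128879467254778821312062545946051035543828043701070856192,
    118206058514474537221843000724358134530894239703885806875775717947989302616356890823437253692630222143021265335615577,
    86191949616876857562652759770494752922665833501133306276172629512347096239636277219535795226958892368553236615921688]]]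

/-- Coefficients expressing the powers of `θ` through the basis values. -/
def powerCoeff : Fin 20 → List ℕ := ![
  [1, 0, 0, 0, 0, 0, 0, 0, 0, 0, 0, 0, 0, 0, 0, 0, 0, 0, 0, 0],
  [21, 48, 43, 63, 19, 0, 74, 13, 73, 87, 28, 73, 74, 24, 14, 91, 96, 84, 64, 8],
  [99, 90, 37, 72, 86, 3, 98, 4, 9, 23, 39, 64, 44, 31, 15, 45, 16, 16, 57, 13],
  [43, 63, 72, 93, 93, 66, 3, 89, 30, 38, 28, 99, 42, 75, 68, 65, 72, 65, 29, 33],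
  [94, 49, 54, 95, 92, 7, 70, 96, 71, 7, 91, 100, 42, 17, 50, 49, 46, 3, 64, 69],
  [44, 64, 4, 83, 8, 37, 35, 99, 81, 85, 58, 11, 42, 28, 57, 55, 20, 100, 18, 36],
  [59, 98, 74, 58, 56, 84, 36, 62, 70, 44, 28, 21, 16, 17, 41, 32, 89, 60, 55, 41],
  [63, 95, 7, 55, 42, 21, 92, 88, 67, 55, 83, 64, 85, 23, 94, 58, 14, 67, 88, 48],
  [54, 18, 62, 76, 66, 54, 23, 90, 72, 67, 88, 28, 84, 18, 91, 9, 75, 95, 3, 89],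
  [58, 50, 33, 40, 94, 0, 64, 14, 56, 93, 80, 4, 40, 27, 49, 95, 18, 6, 45, 61],
  [67, 90, 89, 37, 35, 3, 57, 62, 75, 38, 45, 100, 88, 66, 87, 53, 45, 42, 22, 91],
  [66, 44, 22, 81, 29, 70, 16, 30, 83, 91, 73, 71, 78, 1, 30, 60, 17, 86, 8, 10],
  [42, 62, 77, 99, 13, 21, 8, 71, 38, 70, 9, 69, 87, 95, 20, 84, 93, 68, 70, 78],
  [94, 32, 70, 7, 55, 13, 53, 62, 65, 34, 68, 87, 60, 41, 45, 42, 93, 2, 23, 24],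
  [37, 7, 37, 43, 42, 49, 33, 72, 20, 3, 64, 55, 82, 46, 16, 87, 10, 29, 29, 25],
  [77, 0, 28, 69, 35, 85, 3, 48, 86, 24, 94, 29, 50, 10, 20, 81, 8, 27, 80, 34],
  [95, 86, 71, 50, 39, 92, 79, 30, 40, 77, 33, 37, 27, 71, 94, 33, 48, 34, 22, 10],
  [27, 96, 76, 88, 50, 87, 2, 78, 57, 59, 8, 60, 2, 50, 51, 66, 33, 35, 35, 62],
  [81, 12, 34, 2, 90, 20, 77, 56, 18, 28, 28, 80, 72, 8, 38, 0, 54, 84, 42, 96],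
  [42, 15, 52, 36, 9, 46, 19, 57, 70, 87, 32, 66, 65, 95, 28, 87, 39, 32, 11, 66]]

/-- The values of the primary invariants at the base point. -/
def primValue : Fin 6 → ℕ := ![0, 44, 21, 35, 52, 14]

/-- The digits of a packed element. -/
def digits : ℕ → ℕ → List ℕ
  | 0, _ => []
  | k + 1, N => N % 1048576 :: digits k (N / 1048576)

/-- The element represented by a packed natural number. -/
def unpack {K : Type*} [CommSemiring K] (θ : K) (N : ℕ) : K := horner θ (digits 20 N)

/-- A packed number is valid if it is made of twenty digits less than `101`. -/
def Valid (N : ℕ) : Prop := (∀ d ∈ digits 20 N, d < 101) ∧ horner radix (digits 20 N) = N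

instance (N : ℕ) : Decidable (Valid N) := inferInstanceAs (Decidable (_ ∧ _))

theorem length_digits (k N : ℕ) : (digits k N).length = k := by
  induction k generalizing N with
  | zero => rfl
  | succ k ih => simp [digits, ih]

theorem digits_horner (l : List ℕ) (hl : ∀ d ∈ l, d < radix) :
    digits l.length (horner radix l) = l := by
  induction l with
  | nil => rfl
  | cons x t ih =>
    simp only [List.forall_mem_cons] at hl
    have h1 : (x + radix * horner radix t) % 1048576 = x := by
      rw [Nat.add_mul_mod_self_left, Nat.mod_eq_of_lt hl.1]
    have h2 : (x + radix * horner radix t) / 1048576 = horner radix t := by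
      rw [Nat.add_mul_div_left _ _ (by norm_num), Nat.div_eq_of_lt hl.1, zero_add]
    rw [List.length_cons, digits, horner_cons, Nat.cast_id, h1, h2, ih hl.2]

theorem valid_point (i : Fin 2) : ∀ a ∈ point i, Valid a := by
  revert i; decide +kernel

theorem valid_direction (l : Fin 6) (i : Fin 2) : ∀ a ∈ direction l i, Valid a := by
  revert l i; decide +kernel

theorem prim_value (k : Fin 6) : ops.prim (point 0) (point 1) k = primValue k := by
  revert k; decide +kernel

theorem scd_value (k : Fin 14) :
    ops.scd (point 0) (point 1) k = basisValue.getD (k + 1) 0 := by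
  revert k; decide +kernel

theorem dual_prim_value (l k : Fin 6) :
    dualOps.prim ((point 0).zip (direction l 0)) ((point 1).zip (direction l 1)) k =
      (primValue k, if k = l then 1 else 0) := by
  revert l k; decide +kernel

theorem product_value :
    mul (basisValue.getD 1 0) (basisValue.getD 1 0) = basisValue.getD 15 0 ∧
    mul (basisValue.getD 1 0) (basisValue.getD 2 0) = basisValue.getD 16 0 ∧
    mul (basisValue.getD 2 0) (basisValue.getD 2 0) = basisValue.getD 17 0 ∧
    mul (basisValue.getD 2 0) (basisValue.getD 3 0) = basisValue.getD 18 0 ∧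
    mul (basisValue.getD 10 0) (basisValue.getD 10 0) = basisValue.getD 19 0 := by
  decide +kernel

theorem power_value (j : Fin 20) :
    ((List.finRange 20).map fun i : Fin 20 =>
      nsmul ((powerCoeff j).getD i 0) (basisValue.getD i 0)).foldr add 0 =
      radix ^ (j : ℕ) := by
  revert j; decide +kernel

end Packed
end CubicQuartic

namespace CubicQuartic

/-- The basis of the invariants as a module over the primary invariants. -/
noncomputable def B (A : Type*) [CommRing A] : Fin 20 → Poly A :=
  ![1, S A 0, S A 1, S A 2, S A 3, S A 4, S A 5, S A 6, S A 7, S A 8, S A 9, S A 10, S A 11,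
    S A 12, S A 13, S A 0 * S A 0, S A 0 * S A 1, S A 1 * S A 1, S A 1 * S A 2, S A 9 * S A 9]

namespace Packed

section

variable {K : Type*} [CommRing K] {θ : K}

theorem rep_unpack {a : ℕ} (ha : Valid a) : Rep θ a (unpack θ a) :=
  ⟨digits 20 a, length_digits 20 a, ha.1, ha.2.symm, rfl⟩

theorem Rep.eq_unpack {a : ℕ} {x : K} (h : Rep θ a x) : x = unpack θ a := by
  obtain ⟨l, hl, hl', rfl, rfl⟩ := h
  have := digits_horner l fun d hd => (hl' d hd).trans (by norm_num)
  rw [hl] at this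
  rw [unpack, this]

theorem forall₂_unpack {l : List ℕ} (h : ∀ a ∈ l, Valid a) :
    List.Forall₂ (Rep θ) l (l.map (unpack θ)) := by
  rw [List.forall₂_map_right_iff, List.forall₂_same]
  exact fun a ha => rep_unpack (h a ha)

theorem unpack_of_lt {n : ℕ} (hn : n < radix) : unpack θ n = n := by
  have h (k : ℕ) : horner θ (digits k 0) = 0 := by
    induction k with
    | zero => rfl
    | succ k ih => simp [digits, ih]
  rw [unpack, digits, horner_cons, Nat.mod_eq_of_lt hn, Nat.div_eq_of_lt hn, h]; simp

theorem horner_replicate {R : Type*} [CommSemiring R] (b : R) (k : ℕ) :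
    horner b (List.replicate k 0) = 0 := by
  induction k with
  | zero => rfl
  | succ k ih => simp [List.replicate_succ, ih]

theorem rep_pow {j : ℕ} (hj : j < 20) : Rep θ (radix ^ j) (θ ^ j) := by
  refine ⟨List.replicate j 0 ++ 1 :: List.replicate (19 - j) 0, ?_, ?_, ?_, ?_⟩
  · simp; omega
  · intro d hd
    simp only [List.mem_append, List.mem_cons, List.mem_replicate] at hd
    omega
  · simp [horner_append, horner_replicate]
  · simp [horner_append, horner_replicate]

/-- The base point over `𝔽₁₀₁[θ]`. -/
def pt (θ : K) (j : BinInv.Idx ![3, 4]) : K := unpack θ ((point j.1).getD j.2 0)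

/-- The tangent directions at the base point. -/
def vec (θ : K) (l : Fin 6) (j : BinInv.Idx ![3, 4]) : K :=
  unpack θ ((direction l j.1).getD j.2 0)

theorem coeffL_pt (i : Fin 2) : coeffL (pt θ) i = (point i).map (unpack θ) := by
  fin_cases i <;> rfl

theorem coeffL_dual (l : Fin 6) (i : Fin 2) :
    coeffL (fun j => TrivSqZeroExt.inl (pt θ j) + TrivSqZeroExt.inr (vec θ l j) :
      BinInv.Idx ![3, 4] → DualNumber K) i =
    ((point i).zip (direction l i)).map fun a =>
      (TrivSqZeroExt.inl (unpack θ a.1) + TrivSqZeroExt.inr (unpack θ a.2) : DualNumber K) := by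
  fin_cases i <;> fin_cases l <;> rfl

variable [CharP K 101] [Algebra (ZMod 101) K]

theorem aeval_P (hθ : θ ^ 20 = 2) (k : Fin 6) :
    aeval (pt θ) (P (ZMod 101) k) = (primValue k : K) := by
  have h := (rel_ops hθ).prim (forall₂_unpack (valid_point 0)) (forall₂_unpack (valid_point 1)) k
  rw [← coeffL_pt, ← coeffL_pt, prim_value] at h
  have h2 := map_P (aeval (pt θ) : Poly (ZMod 101) →ₐ[ZMod 101] K).toRingHom k
  have h3 : ((aeval (pt θ) : Poly (ZMod 101) →ₐ[ZMod 101] K).toRingHom ∘ X) = pt θ := by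
    ext j; simp
  rw [h3] at h2
  refine h2.trans (h.eq_unpack.trans (unpack_of_lt ?_))
  clear h h2
  revert k; decide

theorem aeval_S (hθ : θ ^ 20 = 2) (k : Fin 14) :
    Rep θ (basisValue.getD (k + 1) 0) (aeval (pt θ) (S (ZMod 101) k)) := by
  have h := (rel_ops hθ).scd (forall₂_unpack (valid_point 0)) (forall₂_unpack (valid_point 1)) k
  rw [← coeffL_pt, ← coeffL_pt, scd_value] at h
  have h2 := map_S (aeval (pt θ) : Poly (ZMod 101) →ₐ[ZMod 101] K).toRingHom k
  have h3 : ((aeval (pt θ) : Poly (ZMod 101) →ₐ[ZMod 101] K).toRingHom ∘ X) = pt θ := by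
    ext j; simp
  rw [h3] at h2
  rw [← h2] at h
  exact h

attribute [local irreducible] S in
theorem aeval_B (hθ : θ ^ 20 = 2) (i : Fin 20) :
    Rep θ (basisValue.getD i 0) (aeval (pt θ) (B (ZMod 101) i)) := by
  obtain ⟨h1, h2, h3, h4, h5⟩ := product_value
  have hS (k : Fin 14) (n : ℕ) (hn : (k : ℕ) + 1 = n) :
      Rep θ (basisValue.getD n 0) (aeval (pt θ) (S (ZMod 101) k)) := hn ▸ aeval_S (θ := θ) hθ k
  fin_cases i
  · have h := rep_pow (θ := θ) (j := 0) (by norm_num)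
    rw [pow_zero, pow_zero] at h
    change Rep θ 1 (aeval (pt θ) (1 : Poly (ZMod 101)))
    rwa [map_one]
  · change Rep θ (basisValue.getD 1 0) (aeval (pt θ) (S (ZMod 101) 0))
    exact hS 0 1 rfl
  · change Rep θ (basisValue.getD 2 0) (aeval (pt θ) (S (ZMod 101) 1))
    exact hS 1 2 rfl
  · change Rep θ (basisValue.getD 3 0) (aeval (pt θ) (S (ZMod 101) 2))
    exact hS 2 3 rfl
  · change Rep θ (basisValue.getD 4 0) (aeval (pt θ) (S (ZMod 101) 3))
    exact hS 3 4 rfl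
  · change Rep θ (basisValue.getD 5 0) (aeval (pt θ) (S (ZMod 101) 4))
    exact hS 4 5 rfl
  · change Rep θ (basisValue.getD 6 0) (aeval (pt θ) (S (ZMod 101) 5))
    exact hS 5 6 rfl
  · change Rep θ (basisValue.getD 7 0) (aeval (pt θ) (S (ZMod 101) 6))
    exact hS 6 7 rfl
  · change Rep θ (basisValue.getD 8 0) (aeval (pt θ) (S (ZMod 101) 7))
    exact hS 7 8 rfl
  · change Rep θ (basisValue.getD 9 0) (aeval (pt θ) (S (ZMod 101) 8))
    exact hS 8 9 rfl
  · change Rep θ (basisValue.getD 10 0) (aeval (pt θ) (S (ZMod 101) 9))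
    exact hS 9 10 rfl
  · change Rep θ (basisValue.getD 11 0) (aeval (pt θ) (S (ZMod 101) 10))
    exact hS 10 11 rfl
  · change Rep θ (basisValue.getD 12 0) (aeval (pt θ) (S (ZMod 101) 11))
    exact hS 11 12 rfl
  · change Rep θ (basisValue.getD 13 0) (aeval (pt θ) (S (ZMod 101) 12))
    exact hS 12 13 rfl
  · change Rep θ (basisValue.getD 14 0) (aeval (pt θ) (S (ZMod 101) 13))
    exact hS 13 14 rfl
  · change Rep θ (basisValue.getD 15 0) (aeval (pt θ) (S (ZMod 101) 0 * S (ZMod 101) 0))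
    rw [map_mul, ← h1]
    exact rep_mul hθ (hS 0 1 rfl) (hS 0 1 rfl)
  · change Rep θ (basisValue.getD 16 0) (aeval (pt θ) (S (ZMod 101) 0 * S (ZMod 101) 1))
    rw [map_mul, ← h2]
    exact rep_mul hθ (hS 0 1 rfl) (hS 1 2 rfl)
  · change Rep θ (basisValue.getD 17 0) (aeval (pt θ) (S (ZMod 101) 1 * S (ZMod 101) 1))
    rw [map_mul, ← h3]
    exact rep_mul hθ (hS 1 2 rfl) (hS 1 2 rfl)
  · change Rep θ (basisValue.getD 18 0) (aeval (pt θ) (S (ZMod 101) 1 * S (ZMod 101) 2))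
    rw [map_mul, ← h4]
    exact rep_mul hθ (hS 1 2 rfl) (hS 2 3 rfl)
  · change Rep θ (basisValue.getD 19 0) (aeval (pt θ) (S (ZMod 101) 9 * S (ZMod 101) 9))
    rw [map_mul, ← h5]
    exact rep_mul hθ (hS 9 10 rfl) (hS 9 10 rfl)

theorem pow_mem_span (hθ : θ ^ 20 = 2) (j : Fin 20) :
    θ ^ (j : ℕ) ∈ Submodule.span (ZMod 101)
      (Set.range fun i => aeval (pt θ) (B (ZMod 101) i)) := by
  have h (l : List (Fin 20)) : ∃ x ∈ Submodule.span (ZMod 101)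
      (Set.range fun i => aeval (pt θ) (B (ZMod 101) i)),
      Rep θ ((l.map fun i : Fin 20 =>
        nsmul ((powerCoeff j).getD i 0) (basisValue.getD i 0)).foldr add 0) x := by
    induction l with
    | nil => exact ⟨0, zero_mem _, rep_zero⟩
    | cons i l ih =>
      obtain ⟨x, hx, hx'⟩ := ih
      refine ⟨_, ?_, rep_add (rep_nsmul _ (aeval_B hθ i)) hx'⟩
      exact add_mem (nsmul_mem (Submodule.subset_span (Set.mem_range_self i)) _) hx
  obtain ⟨x, hx, hx'⟩ := h (List.finRange 20)
  rw [power_value] at hx'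
  rw [(rep_pow j.2).eq_unpack, ← hx'.eq_unpack]
  exact hx

theorem snd_aeval_P (hθ : θ ^ 20 = 2) (l k : Fin 6) :
    (aeval (fun j => TrivSqZeroExt.inl (pt θ j) + TrivSqZeroExt.inr (vec θ l j) :
      BinInv.Idx ![3, 4] → DualNumber K) (P (ZMod 101) k)).snd = if k = l then 1 else 0 := by
  set f : BinInv.Idx ![3, 4] → DualNumber K :=
    fun j => TrivSqZeroExt.inl (pt θ j) + TrivSqZeroExt.inr (vec θ l j) with hf
  have hz (i : Fin 2) : List.Forall₂
      (fun (a : ℕ × ℕ) (x : DualNumber K) => Rep θ a.1 x.fst ∧ Rep θ a.2 x.snd)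
      ((point i).zip (direction l i)) (coeffL f i) := by
    rw [hf, coeffL_dual, List.forall₂_map_right_iff, List.forall₂_same]
    rintro ⟨a, b⟩ hab
    have hab := List.of_mem_zip hab
    have h1 : Rep θ a (unpack θ a) := rep_unpack (valid_point i a hab.1)
    have h2 : Rep θ b (unpack θ b) := rep_unpack (valid_direction l i b hab.2)
    simpa using And.intro h1 h2
  have h := ((rel_dualOps hθ).prim (hz 0) (hz 1) k).2
  rw [dual_prim_value] at h
  have h2 := map_P (aeval f : Poly (ZMod 101) →ₐ[ZMod 101] DualNumber K).toRingHom k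
  have h3 : ((aeval f : Poly (ZMod 101) →ₐ[ZMod 101] DualNumber K).toRingHom ∘ X) = f := by
    ext j <;> simp
  rw [h3] at h2
  rw [← h2] at h
  refine h.eq_unpack.trans ?_
  split_ifs
  · rw [unpack_of_lt (by norm_num), Nat.cast_one]
  · rw [unpack_of_lt (by norm_num), Nat.cast_zero]

end

end Packed
end CubicQuartic

namespace CubicQuartic

section Local

variable {σ ι K : Type*} {F : Type*} [Field F] [CommRing K] [Algebra F K]

/-- The generic curve through `c` with velocity in the span of the `v l`. -/
noncomputable def curve (c : σ → K) (v : Fin 6 → σ → K) :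
    MvPolynomial σ F →ₐ[F] Polynomial (MvPolynomial (Fin 6) K) :=
  aeval fun j => Polynomial.C (C (c j)) + Polynomial.X * Polynomial.C (∑ l, C (v l j) * X l)

theorem coeff_zero_curve (c : σ → K) (v : Fin 6 → σ → K) (f : MvPolynomial σ F) :
    (curve c v f).coeff 0 = C (aeval c f) := by
  have h : ((Polynomial.constantCoeff : Polynomial (MvPolynomial (Fin 6) K) →+* _).comp
      (curve c v : MvPolynomial σ F →ₐ[F] _).toRingHom) =
      (C : K →+* MvPolynomial (Fin 6) K).comp (aeval c : MvPolynomial σ F →ₐ[F] K).toRingHom := by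
    apply MvPolynomial.ringHom_ext
    · intro r
      simp [curve, Polynomial.algebraMap_apply, MvPolynomial.algebraMap_apply]
    · intro j
      simp [curve]
  exact congrArg (fun φ => φ f) h

/-- The point `c + ε v` over the dual numbers. -/
def dualPoint (c v : σ → K) (j : σ) : DualNumber K :=
  TrivSqZeroExt.inl (c j) + TrivSqZeroExt.inr (v j)

@[simp] theorem fst_dualPoint (c v : σ → K) (j : σ) : (dualPoint c v j).fst = c j := by
  rw [dualPoint, TrivSqZeroExt.fst_add, TrivSqZeroExt.fst_inl, TrivSqZeroExt.fst_inr, add_zero]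

@[simp] theorem snd_dualPoint (c v : σ → K) (j : σ) : (dualPoint c v j).snd = v j := by
  rw [dualPoint, TrivSqZeroExt.snd_add, TrivSqZeroExt.snd_inl, TrivSqZeroExt.snd_inr, zero_add]

theorem algebraMap_dual (a : F) : algebraMap F (DualNumber K) a =
    TrivSqZeroExt.inl (algebraMap F K a) := rfl

theorem fst_aeval_dualPoint (c v : σ → K) (f : MvPolynomial σ F) :
    (aeval (dualPoint c v) f).fst = aeval c f := by
  induction f using MvPolynomial.induction_on with
  | C a => simp [algebraMap_dual]
  | add p q hp hq => simp [hp, hq]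
  | mul_X p j hp => simp [hp]

theorem coeff_one_curve (c : σ → K) (v : Fin 6 → σ → K) (f : MvPolynomial σ F) :
    (curve c v f).coeff 1 = ∑ l, C (aeval (dualPoint c (v l)) f).snd * X l := by
  induction f using MvPolynomial.induction_on with
  | C a =>
    simp [curve, Polynomial.algebraMap_apply, algebraMap_dual]
  | add p q hp hq => simp only [map_add, Polynomial.coeff_add, hp, hq, TrivSqZeroExt.snd_add,
      add_mul, Finset.sum_add_distrib]
  | mul_X p j hp =>
    have h1 : (curve c v (X j : MvPolynomial σ F)).coeff 1 = ∑ l, C (v l j) * X l := by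
      simp [curve, Polynomial.coeff_C]
    have h2 (l : Fin 6) : (aeval (dualPoint c (v l)) (p * X j)).snd =
        aeval c p * v l j + (aeval (dualPoint c (v l)) p).snd * c j := by
      rw [map_mul, TrivSqZeroExt.snd_mul, fst_aeval_dualPoint, aeval_X, snd_dualPoint,
        fst_dualPoint, smul_eq_mul, op_smul_eq_mul]
    rw [map_mul, Polynomial.mul_coeff_one, coeff_zero_curve, coeff_zero_curve, hp, h1, aeval_X,
      Finset.mul_sum, Finset.sum_mul, ← Finset.sum_add_distrib]
    refine Finset.sum_congr rfl fun l _ => ?_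
    rw [h2, C_add, C_mul, C_mul]
    ring

variable [Fintype ι]

theorem eq_zero_of_local (p : Fin 6 → MvPolynomial σ F) (b : ι → MvPolynomial σ F)
    (c : σ → K) (v : Fin 6 → σ → K) (hp : ∀ k, aeval c (p k) = (0 : K))
    (hv : ∀ l k, (aeval (dualPoint c (v l)) (p k)).snd = if k = l then 1 else 0)
    (hb : LinearIndependent F fun i => (aeval c (b i) : K))
    (q : ι → MvPolynomial (Fin 6) F) (hq : ∑ i, aeval p (q i) * b i = 0) (r : ℕ) :
    ∀ i m, m.degree = r → coeff m (q i) = 0 := by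
  induction r using Nat.strong_induction_on with
  | _ r ih =>
  have hw (k : Fin 6) : ∃ u, curve c v (p k) = Polynomial.X * (Polynomial.C (X k) +
      Polynomial.X * u) := by
    have h0 : (curve c v (p k)).coeff 0 = 0 := by rw [coeff_zero_curve, hp, C_0]
    obtain ⟨u, hu⟩ := Polynomial.X_dvd_iff.2 h0
    have h1 : u.coeff 0 = X k := by
      have := coeff_one_curve c v (p k)
      rw [hu, Polynomial.coeff_X_mul] at this
      rw [this]; simp [hv]
    have h2 : (u - Polynomial.C (X k)).coeff 0 = 0 := by simp [h1]
    obtain ⟨w, hw⟩ := Polynomial.X_dvd_iff.2 h2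
    exact ⟨w, by rw [hu, ← hw]; ring⟩
  choose u hu using hw
  have hcoef (i : ι) : (curve c v (aeval p (q i) * b i)).coeff r =
      ∑ m ∈ (q i).support, if m.degree = r then
        C (coeff m (q i) • aeval c (b i)) * monomial m 1 else 0 := by
    have e : curve c v (aeval p (q i)) = ∑ m ∈ (q i).support,
        Polynomial.X ^ m.degree * (Polynomial.C (C (algebraMap F K (coeff m (q i)))) *
          ∏ k, (Polynomial.C (X k) + Polynomial.X * u k) ^ m k) := by
      rw [← AlgHom.comp_apply, comp_aeval, aeval_def, eval₂_eq']
      refine Finset.sum_congr rfl fun m _ => ?_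
      simp only [hu, mul_pow, Finset.prod_mul_distrib]
      rw [Finset.prod_pow_eq_pow_sum, Finsupp.degree_eq_sum]
      rw [Polynomial.algebraMap_apply, MvPolynomial.algebraMap_apply]
      ring
    rw [map_mul, e, Finset.sum_mul, Polynomial.finsetSum_coeff]
    refine Finset.sum_congr rfl fun m hm => ?_
    rw [mul_assoc, Polynomial.coeff_X_pow_mul']
    split_ifs with h1 h2 h2
    · subst h2
      rw [Nat.sub_self, Polynomial.mul_coeff_zero, coeff_zero_curve, Polynomial.mul_coeff_zero,
        Polynomial.coeff_C_zero, Polynomial.coeff_zero_prod, Algebra.smul_def, map_mul,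
        monomial_eq, C_1, one_mul, Finsupp.prod_fintype _ _ (by simp)]
      have : ∀ k, ((Polynomial.C (X k) + Polynomial.X * u k) ^ m k).coeff 0 =
          (X k : MvPolynomial (Fin 6) K) ^ m k := fun k => by
        rw [Polynomial.coeff_zero_eq_eval_zero]; simp
      simp only [this]; ring
    · exact absurd (ih _ (lt_of_le_of_ne h1 h2) i m rfl) (mem_support_iff.1 hm)
    · omega
    · rfl
  intro i m hm
  have h1 : ∑ i, (curve c v (aeval p (q i) * b i)).coeff r = 0 := by
    rw [← Polynomial.finsetSum_coeff, ← map_sum, hq, map_zero, Polynomial.coeff_zero]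
  have h2 : ∑ i, coeff m (q i) • (aeval c (b i) : K) = 0 := by
    have := congrArg (coeff m) h1
    rw [coeff_sum, coeff_zero] at this
    rw [← this]
    refine Finset.sum_congr rfl fun i _ => ?_
    rw [hcoef, coeff_sum]
    by_cases hs : m ∈ (q i).support
    · rw [Finset.sum_eq_single m]
      · rw [if_pos hm, coeff_C_mul, coeff_monomial, if_pos rfl, mul_one]
      · intro n _ hn
        split_ifs
        · rw [coeff_C_mul, coeff_monomial, if_neg hn, mul_zero]
        · rfl
      · exact fun h => absurd hs h
    · rw [notMem_support_iff.1 hs, zero_smul, Finset.sum_eq_zero]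
      intro n hn
      split_ifs
      · rw [coeff_C_mul, coeff_monomial, if_neg (by rintro rfl; exact hs hn), mul_zero]
      · rfl
  exact Fintype.linearIndependent_iff.1 hb _ h2 i

theorem eq_zero_of_local' (p : Fin 6 → MvPolynomial σ F) (b : ι → MvPolynomial σ F)
    (y : Fin 6 → F)
    (c : σ → K) (v : Fin 6 → σ → K) (hp : ∀ k, aeval c (p k) = algebraMap F K (y k))
    (hv : ∀ l k, (aeval (dualPoint c (v l)) (p k)).snd = if k = l then 1 else 0)
    (hb : LinearIndependent F fun i => (aeval c (b i) : K))
    (q : ι → MvPolynomial (Fin 6) F) (hq : ∑ i, aeval p (q i) * b i = 0) : q = 0 := by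
  let sh : MvPolynomial (Fin 6) F →ₐ[F] MvPolynomial (Fin 6) F := aeval fun k => X k + C (y k)
  let sh' : MvPolynomial (Fin 6) F →ₐ[F] MvPolynomial (Fin 6) F := aeval fun k => X k - C (y k)
  have h1 : (aeval fun k => p k - C (y k)).comp sh = aeval p := by
    ext k; simp [sh]
  have h2 : sh'.comp sh = AlgHom.id F _ := by
    ext k; simp [sh, sh']
  have h3 := eq_zero_of_local (fun k => p k - C (y k)) b c v (by simp [hp])
    (by simp [hv, algebraMap_dual]) hb
    (fun i => sh (q i)) (by simpa only [← h1, AlgHom.comp_apply] using hq)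
  funext i
  have h4 : sh (q i) = 0 := by
    ext m; exact h3 _ i m rfl
  have := congrArg (fun φ => φ (q i)) h2
  simpa [h4] using this.symm

end Local

end CubicQuartic

namespace CubicQuartic

/-- The products of basis elements with monomials in the primary invariants. -/
noncomputable def mon (A : Type*) [CommRing A] (x : Fin 20 × (Fin 6 →₀ ℕ)) : Poly A :=
  aeval (P A) (monomial x.2 (1 : A)) * B A x.1

section

variable {A A' : Type*} [CommRing A] [CommRing A'] (f : A →+* A')

theorem map_P' (i : Fin 6) : MvPolynomial.map f (P A i) = P A' i := by
  rw [map_P]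
  have : (MvPolynomial.map f ∘ X : BinInv.Idx ![3, 4] → Poly A') = X := by ext1 j; simp
  rw [this]; rfl

theorem map_S' (i : Fin 14) : MvPolynomial.map f (S A i) = S A' i := by
  rw [map_S]
  have : (MvPolynomial.map f ∘ X : BinInv.Idx ![3, 4] → Poly A') = X := by ext1 j; simp
  rw [this]; rfl

theorem map_B (i : Fin 20) : MvPolynomial.map f (B A i) = B A' i := by
  fin_cases i <;> simp [B, map_S']

theorem map_mon (x : Fin 20 × (Fin 6 →₀ ℕ)) : MvPolynomial.map f (mon A x) = mon A' x := by
  rw [mon, mon, map_mul, map_B, aeval_monomial, aeval_monomial]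
  simp [Finsupp.prod, map_prod, map_P']

end

/-- The polynomials in six variables with coefficients `l`. -/
noncomputable def polyOf {A : Type*} [CommRing A] (l : Fin 20 × (Fin 6 →₀ ℕ) →₀ A) (i : Fin 20) :
    MvPolynomial (Fin 6) A :=
  l.sum fun x a => if x.1 = i then monomial x.2 a else 0

theorem coeff_polyOf {A : Type*} [CommRing A] (l : Fin 20 × (Fin 6 →₀ ℕ) →₀ A) (i : Fin 20)
    (m : Fin 6 →₀ ℕ) : coeff m (polyOf l i) = l (i, m) := by
  rw [polyOf, Finsupp.sum, coeff_sum]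
  have h (x : Fin 20 × (Fin 6 →₀ ℕ)) : coeff m (if x.1 = i then monomial x.2 (l x) else 0) =
      if x = (i, m) then l x else 0 := by
    obtain ⟨j, n⟩ := x
    by_cases h1 : j = i <;> simp [h1, coeff_monomial]
  simp only [h]
  rw [Finset.sum_ite_eq']
  split_ifs with h1
  · rfl
  · exact (Finsupp.notMem_support_iff.1 h1).symm

theorem sum_mon {A : Type*} [CommRing A] (l : Fin 20 × (Fin 6 →₀ ℕ) →₀ A) :
    l.sum (fun x a => a • mon A x) = ∑ i, aeval (P A) (polyOf l i) * B A i := by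
  simp only [polyOf, Finsupp.sum, map_sum, Finset.sum_mul]
  rw [Finset.sum_comm]
  refine Finset.sum_congr rfl fun x _ => ?_
  rw [Finset.sum_eq_single x.1 (fun i _ hi => by rw [if_neg hi.symm, map_zero, zero_mul])
    (fun h => absurd (Finset.mem_univ _) h), if_pos rfl, mon, ← smul_mul_assoc, ← map_smul,
    smul_monomial, smul_eq_mul, mul_one]

instance : Fact (Nat.Prime 101) := ⟨by norm_num⟩

theorem linearIndependent_aeval_B {K : Type*} [CommRing K] [CharP K 101] [Algebra (ZMod 101) K]
    {θ : K} (hθ : θ ^ 20 = 2) (h : ⊤ ≤ Submodule.span (ZMod 101)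
      (Set.range fun i : Fin 20 => θ ^ (i : ℕ))) (hK : Module.finrank (ZMod 101) K = 20) :
    LinearIndependent (ZMod 101) fun i => aeval (Packed.pt θ) (B (ZMod 101) i) := by
  refine linearIndependent_of_top_le_span_of_card_eq_finrank ?_ (by rw [hK]; rfl)
  refine h.trans (Submodule.span_le.2 ?_)
  rintro _ ⟨j, rfl⟩
  exact Packed.pow_mem_span hθ j

theorem eq_zero_zmod (q : Fin 20 → MvPolynomial (Fin 6) (ZMod 101))
    (hq : ∑ i, aeval (P (ZMod 101)) (q i) * B (ZMod 101) i = 0) : q = 0 := by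
  set g : Polynomial (ZMod 101) := Polynomial.X ^ 20 - Polynomial.C 2 with hg
  have hm : g.Monic := Polynomial.monic_X_pow_sub_C 2 (by norm_num)
  have hd : g.natDegree = 20 := Polynomial.natDegree_X_pow_sub_C
  have : Nontrivial (AdjoinRoot g) := AdjoinRoot.nontrivial g (by
    rw [Polynomial.degree_eq_natDegree hm.ne_zero, hd]; norm_num)
  have : CharP (AdjoinRoot g) 101 := charP_of_injective_algebraMap
    (algebraMap (ZMod 101) (AdjoinRoot g)).injective 101
  have hθ : (AdjoinRoot.root g) ^ 20 = 2 := by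
    have := AdjoinRoot.eval₂_root g
    rw [hg, Polynomial.eval₂_sub, Polynomial.eval₂_X_pow, Polynomial.eval₂_C, sub_eq_zero] at this
    rw [this, map_ofNat]
  have hfin : Module.finrank (ZMod 101) (AdjoinRoot g) = 20 := by
    rw [(AdjoinRoot.powerBasis' hm).finrank, AdjoinRoot.powerBasis'_dim, hd]
  have hspan : ⊤ ≤ Submodule.span (ZMod 101)
      (Set.range fun i : Fin 20 => (AdjoinRoot.root g) ^ (i : ℕ)) := by
    rw [← (AdjoinRoot.powerBasis' hm).basis.span_eq, Submodule.span_le]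
    rintro _ ⟨j, rfl⟩
    rw [PowerBasis.coe_basis]
    refine Submodule.subset_span ⟨⟨j, ?_⟩, ?_⟩
    · exact j.2.trans_eq (by rw [AdjoinRoot.powerBasis'_dim, hd])
    · simp
  exact eq_zero_of_local' (P (ZMod 101)) (B (ZMod 101)) (fun k => (Packed.primValue k : ZMod 101))
    (Packed.pt (AdjoinRoot.root g)) (Packed.vec (AdjoinRoot.root g))
    (fun k => by rw [Packed.aeval_P hθ, map_natCast])
    (fun l k => Packed.snd_aeval_P hθ l k)
    (linearIndependent_aeval_B hθ hspan hfin) q hq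

theorem linearIndependent_mon_zmod : LinearIndependent (ZMod 101) (mon (ZMod 101)) := by
  rw [linearIndependent_iff]
  intro l hl
  rw [Finsupp.linearCombination_apply, sum_mon] at hl
  have := eq_zero_zmod _ hl
  ext ⟨i, m⟩
  have := congrArg (coeff m) (congrFun this i)
  rwa [coeff_polyOf] at this

theorem linearIndependent_mon_int : LinearIndependent ℤ (mon ℤ) := by
  have key (r : ℕ) : ∀ l : Fin 20 × (Fin 6 →₀ ℕ) →₀ ℤ,
      l.sum (fun x a => a • mon ℤ x) = 0 → ∃ l', l = (101 ^ r : ℤ) • l' := by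
    induction r with
    | zero => exact fun l _ => ⟨l, by simp⟩
    | succ r ih =>
      intro l hl
      have h1 : l.sum (fun x a => (a : ZMod 101) • mon (ZMod 101) x) = 0 := by
        have := congrArg (MvPolynomial.map (Int.castRingHom (ZMod 101))) hl
        rw [map_zero, Finsupp.sum, map_sum] at this
        rw [Finsupp.sum, ← this]
        refine Finset.sum_congr rfl fun x _ => ?_
        rw [smul_eq_C_mul, smul_eq_C_mul, map_mul, map_mon, map_C]; rfl
      have h2 (x) : (l x : ZMod 101) = 0 := by
        by_cases hx : x ∈ l.support
        · exact linearIndependent_iff'.1 linearIndependent_mon_zmod l.support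
            (fun x => (l x : ZMod 101)) h1 x hx
        · rw [Finsupp.notMem_support_iff.1 hx, Int.cast_zero]
      have h3 (x) : (101 : ℤ) ∣ l x := (ZMod.intCast_zmod_eq_zero_iff_dvd (l x) 101).1 (h2 x)
      let l' : Fin 20 × (Fin 6 →₀ ℕ) →₀ ℤ := l.mapRange (· / 101) (by simp)
      have h4 : l = (101 : ℤ) • l' := by
        ext x; simp [l', Int.mul_ediv_cancel' (h3 x)]
      have h5 : l'.sum (fun x a => a • mon ℤ x) = 0 := by
        have : (101 : ℤ) • l'.sum (fun x a => a • mon ℤ x) = 0 := by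
          rw [← hl]
          conv_rhs => rw [h4]
          rw [Finsupp.sum_smul_index (by simp), Finsupp.smul_sum]
          simp [mul_smul]
        exact (smul_eq_zero.1 this).resolve_left (by norm_num)
      obtain ⟨l'', h6⟩ := ih l' h5
      exact ⟨l'', by rw [h4, h6, smul_smul, pow_succ']⟩
  rw [linearIndependent_iff]
  intro l hl
  rw [Finsupp.linearCombination_apply] at hl
  ext x
  by_contra hx
  obtain ⟨l', hl'⟩ := key (l x).natAbs l hl
  have h1 : (101 ^ (l x).natAbs : ℤ) ∣ l x := ⟨l' x, by
    conv_lhs => rw [hl']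
    simp⟩
  have h2 := Int.natAbs_dvd_natAbs.2 h1
  rw [Int.natAbs_pow] at h2
  have h3 := Nat.le_of_dvd (Int.natAbs_pos.2 hx) h2
  exact absurd h3 (not_le.2 (Nat.lt_pow_self (by norm_num)))

open TensorProduct in
theorem linearIndependent_mon : LinearIndependent ℂ (mon ℂ) := by
  rw [linearIndependent_iff]
  intro l hl
  rw [Finsupp.linearCombination_apply] at hl
  let t : ℂ ⊗[ℤ] (Fin 20 × (Fin 6 →₀ ℕ) →₀ ℤ) := l.sum fun x z => z ⊗ₜ Finsupp.single x 1
  have h1 : LinearMap.lTensor ℂ (Finsupp.linearCombination ℤ (mon ℤ)) t = 0 := by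
    apply (MvPolynomial.algebraTensorAlgEquiv ℤ (σ := BinInv.Idx ![3, 4]) ℂ).injective
    rw [map_zero, ← hl]
    simp only [t, Finsupp.sum, map_sum, LinearMap.lTensor_tmul,
      Finsupp.linearCombination_single, one_smul]
    refine Finset.sum_congr rfl fun x _ => ?_
    rw [MvPolynomial.algebraTensorAlgEquiv_tmul, ← map_mon (algebraMap ℤ ℂ)]
  have h2 : t = 0 := (map_eq_zero_iff _ (Module.Flat.lTensor_preserves_injective_linearMap _
    linearIndependent_mon_int)).1 h1
  have h3 := congrArg (TensorProduct.finsuppScalarRight ℤ ℤ ℂ (Fin 20 × (Fin 6 →₀ ℕ))) h2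
  ext x
  have h4 := congrArg (fun f => f x) h3
  simp only [t, Finsupp.sum, map_sum, map_zero, TensorProduct.finsuppScalarRight_apply_tmul] at h4
  rw [← h4]
  simp [Finsupp.finsetSum_apply, Finsupp.single_apply]

end CubicQuartic

namespace CubicQuartic

open BinInv

/-- The weight of a coefficient of the cubic or the quartic. -/
def wt (j : Idx ![3, 4]) : ℤ := ((![3, 4] : Fin 2 → ℕ) j.1 : ℤ) - 2 * (j.2 : ℕ)

theorem coeffAt_formAt (c : Idx ![3, 4] → ℂ) (j : Idx ![3, 4]) :
    coeffAt ![3, 4] j (formAt ![3, 4] c j.1) = c j := by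
  have hmon (a b : ℕ) (z : ℂ) : C z * X 0 ^ a * X 1 ^ b =
      monomial (Finsupp.single (0 : Fin 2) a + Finsupp.single 1 b) z := by
    rw [monomial_eq, Finsupp.prod_add_index' (by simp) (by simp [pow_add])]
    simp [mul_assoc]
  obtain ⟨i, k⟩ := j
  simp only [coeffAt, formAt, hmon, coeff_sum, coeff_monomial]
  rw [Finset.sum_eq_single k]
  · simp
  · intro l _ hl
    rw [if_neg]
    intro h
    have := DFunLike.congr_fun h 1
    simp at this
    exact hl (Fin.ext this)
  · simp

/-- The translation of the second variable of binary forms, in coordinates. -/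
noncomputable def flow {A : Type*} [CommRing A] (s : A) (c : Idx ![3, 4] → A)
    (j : Idx ![3, 4]) : A :=
  ∑ k : Fin ((![3, 4] : Fin 2 → ℕ) j.1 + 1), if (k : ℕ) ≤ (j.2 : ℕ) then
    (((![3, 4] : Fin 2 → ℕ) j.1 - k).choose (j.2 - k) : A) * s ^ ((j.2 : ℕ) - k) * c ⟨j.1, k⟩ else 0

/-- Upper triangular unipotent matrices. -/
def unip (s : ℂ) : Matrix.SpecialLinearGroup (Fin 2) ℂ :=
  ⟨!![1, -s; 0, 1], by simp [Matrix.det_fin_two]⟩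

theorem formAt_zero (c : Idx ![3, 4] → ℂ) : formAt ![3, 4] c 0 =
    C (c ⟨0, (0 : Fin 4)⟩) * X 0 ^ 3 + C (c ⟨0, (1 : Fin 4)⟩) * X 0 ^ 2 * X 1 +
      C (c ⟨0, (2 : Fin 4)⟩) * X 0 * X 1 ^ 2 + C (c ⟨0, (3 : Fin 4)⟩) * X 1 ^ 3 := by
  refine (Fin.sum_univ_four (fun k : Fin 4 =>
    C (c ⟨0, k⟩) * X 0 ^ (3 - (k : ℕ)) * X 1 ^ (k : ℕ))).trans ?_
  simp

theorem formAt_one (c : Idx ![3, 4] → ℂ) : formAt ![3, 4] c 1 =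
    C (c ⟨1, (0 : Fin 5)⟩) * X 0 ^ 4 + C (c ⟨1, (1 : Fin 5)⟩) * X 0 ^ 3 * X 1 +
      C (c ⟨1, (2 : Fin 5)⟩) * X 0 ^ 2 * X 1 ^ 2 + C (c ⟨1, (3 : Fin 5)⟩) * X 0 * X 1 ^ 3 +
      C (c ⟨1, (4 : Fin 5)⟩) * X 1 ^ 4 := by
  refine (Fin.sum_univ_five (fun k : Fin 5 =>
    C (c ⟨1, k⟩) * X 0 ^ (4 - (k : ℕ)) * X 1 ^ (k : ℕ))).trans ?_
  simp

theorem flow_zero {A : Type*} [CommRing A] (s : A) (c : Idx ![3, 4] → A) (l : Fin 4) :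
    flow s c ⟨0, l⟩ = ∑ k : Fin 4, if (k : ℕ) ≤ l then
      ((3 - k : ℕ).choose (l - k) : A) * s ^ ((l : ℕ) - k) * c ⟨0, k⟩ else 0 := rfl

theorem flow_one {A : Type*} [CommRing A] (s : A) (c : Idx ![3, 4] → A) (l : Fin 5) :
    flow s c ⟨1, l⟩ = ∑ k : Fin 5, if (k : ℕ) ≤ l then
      ((4 - k : ℕ).choose (l - k) : A) * s ^ ((l : ℕ) - k) * c ⟨1, k⟩ else 0 := rfl

theorem actPt_unip (s : ℂ) (c : Idx ![3, 4] → ℂ) : actPt ![3, 4] (unip s) c = flow s c := by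
  funext j
  rw [actPt, ← coeffAt_formAt (flow s c) j]
  congr 1
  obtain ⟨i, k⟩ := j
  have h00 : (↑((unip s)⁻¹) : Matrix (Fin 2) (Fin 2) ℂ) = !![1, s; 0, 1] := by
    rw [Matrix.SpecialLinearGroup.coe_inv, unip, Matrix.adjugate_fin_two_of]; simp
  rw [sl2Act, h00]
  change aeval _ (formAt ![3, 4] c i) = formAt ![3, 4] (flow s c) i
  have e (n : ℕ) [n.AtLeastTwo] : C (OfNat.ofNat n : ℂ) =
      (OfNat.ofNat n : MvPolynomial (Fin 2) ℂ) := map_ofNat C n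
  fin_cases i
  · simp [formAt_zero, flow_zero, Fin.sum_univ_succ, algHom_C]
    simp only [e]
    ring
  · simp [formAt_one, flow_one, Fin.sum_univ_succ, algHom_C, Nat.choose]
    simp only [e]
    ring

/-- The diagonal matrix with entries `1 / 2` and `2`. -/
noncomputable def diag : Matrix.SpecialLinearGroup (Fin 2) ℂ :=
  ⟨!![1 / 2, 0; 0, 2], by simp [Matrix.det_fin_two]⟩

theorem actPt_diag (c : Idx ![3, 4] → ℂ) :
    actPt ![3, 4] diag c = fun j => (2 : ℂ) ^ wt j * c j := by
  funext j
  rw [actPt, ← coeffAt_formAt (fun j => (2 : ℂ) ^ wt j * c j) j]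
  congr 1
  obtain ⟨i, k⟩ := j
  have h00 : (↑(diag⁻¹) : Matrix (Fin 2) (Fin 2) ℂ) = !![2, 0; 0, 1 / 2] := by
    rw [Matrix.SpecialLinearGroup.coe_inv, diag, Matrix.adjugate_fin_two_of]; simp
  rw [sl2Act, h00]
  change aeval _ (formAt ![3, 4] c i) = formAt ![3, 4] _ i
  rw [formAt, formAt, map_sum]
  refine Finset.sum_congr rfl fun k _ => ?_
  have hk : (k : ℕ) ≤ (![3, 4] : Fin 2 → ℕ) i := Nat.lt_succ_iff.1 k.2
  have h2 : (2 : ℂ) ^ wt ⟨i, k⟩ = 2 ^ ((![3, 4] : Fin 2 → ℕ) i - k) * (1 / 2) ^ (k : ℕ) := by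
    rw [wt, one_div, inv_pow, ← zpow_natCast, ← zpow_natCast, ← zpow_neg, ← zpow_add₀ two_ne_zero,
      Nat.cast_sub hk]
    congr 1; ring
  rw [h2]
  simp only [map_mul, map_pow, aeval_X, algHom_C, algebraMap_eq, Fin.sum_univ_two]
  simp
  ring

end CubicQuartic

namespace CubicQuartic

open BinInv

/-- The degree together with the weight of the coefficients. -/
def bideg (j : Idx ![3, 4]) : ℕ × ℤ := (1, wt j)

/-- The images of the coefficients under the raising operator. -/
noncomputable def raiseX (j : Idx ![3, 4]) : Poly ℂ :=
  if 0 < (j.2 : ℕ) then C (((![3, 4] : Fin 2 → ℕ) j.1 : ℂ) - (j.2 : ℕ) + 1) *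
    X ⟨j.1, ⟨(j.2 : ℕ) - 1, (Nat.sub_le _ _).trans_lt j.2.2⟩⟩ else 0

/-- The images of the coefficients under the lowering operator. -/
noncomputable def lowerX (j : Idx ![3, 4]) : Poly ℂ :=
  if h : (j.2 : ℕ) < (![3, 4] : Fin 2 → ℕ) j.1 then C (((j.2 : ℕ) : ℂ) + 1) *
    X ⟨j.1, ⟨(j.2 : ℕ) + 1, Nat.succ_lt_succ h⟩⟩ else 0

/-- The raising operator of `𝔰𝔩₂`. -/
noncomputable def raise : Derivation ℂ (Poly ℂ) (Poly ℂ) := mkDerivation ℂ raiseX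

/-- The lowering operator of `𝔰𝔩₂`. -/
noncomputable def lower : Derivation ℂ (Poly ℂ) (Poly ℂ) := mkDerivation ℂ lowerX

/-- The weight operator of `𝔰𝔩₂`. -/
noncomputable def weightOp : Derivation ℂ (Poly ℂ) (Poly ℂ) :=
  mkDerivation ℂ fun j => C (wt j : ℂ) * X j

theorem lie_raise_lower : ⁅raise, lower⁆ = weightOp := by
  refine derivation_ext fun j => ?_
  obtain ⟨i, k⟩ := j
  rw [Derivation.commutator_apply, weightOp, mkDerivation_X, lower, raise, mkDerivation_X,
    mkDerivation_X]
  have hk : (k : ℕ) ≤ (![3, 4] : Fin 2 → ℕ) i := Nat.lt_succ_iff.1 k.2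
  have h1 : mkDerivation ℂ raiseX (lowerX ⟨i, k⟩) =
      C ((((k : ℕ) : ℂ) + 1) * (((![3, 4] : Fin 2 → ℕ) i : ℂ) - (k : ℕ))) * X ⟨i, k⟩ := by
    rw [lowerX]
    split_ifs with h
    · rw [← smul_eq_C_mul, Derivation.map_smul, mkDerivation_X, raiseX]
      simp only [Nat.succ_pos, if_true, Nat.add_sub_cancel, Fin.eta, smul_eq_C_mul, ← mul_assoc,
        ← C_mul]
      congr 2
      push_cast; ring
    · have : (k : ℕ) = (![3, 4] : Fin 2 → ℕ) i := le_antisymm hk (not_lt.1 h)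
      have h' : (((![3, 4] : Fin 2 → ℕ) i : ℕ) : ℂ) - (k : ℕ) = 0 := by rw [this, sub_self]
      rw [h']; simp
  have h2 : mkDerivation ℂ lowerX (raiseX ⟨i, k⟩) =
      C (((k : ℕ) : ℂ) * (((![3, 4] : Fin 2 → ℕ) i : ℂ) - (k : ℕ) + 1)) * X ⟨i, k⟩ := by
    rw [raiseX]
    split_ifs with h
    · have h' : 0 < (k : ℕ) := h
      have h3 : (k : ℕ) - 1 < (![3, 4] : Fin 2 → ℕ) i := by omega
      have h4 : (k : ℕ) - 1 + 1 = k := by omega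
      have h5 : (((k : ℕ) - 1 : ℕ) : ℂ) + 1 = (k : ℕ) := by exact_mod_cast h4
      rw [← smul_eq_C_mul, Derivation.map_smul, mkDerivation_X, lowerX]
      simp only [h3, dif_pos, h4, Fin.eta, smul_eq_C_mul, ← mul_assoc, ← C_mul, h5]
      congr 2
      ring
    · have : (k : ℕ) = 0 := by simpa using h
      rw [this]; simp
  rw [h1, h2, ← sub_mul, ← C_sub]
  congr 2
  rw [wt]; push_cast; ring

theorem mkDerivation_mem {g : Idx ![3, 4] → Poly ℂ} {δ : ℤ}
    (hg : ∀ j, IsWeightedHomogeneous bideg (g j) (1, wt j + δ)) {f : Poly ℂ} {d : ℕ} {w : ℤ}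
    (hf : IsWeightedHomogeneous bideg f (d, w)) :
    IsWeightedHomogeneous bideg (mkDerivation ℂ g f) (d, w + δ) := by
  rw [← f.support_sum_monomial_coeff, map_sum]
  refine Submodule.sum_mem (weightedHomogeneousSubmodule ℂ bideg (d, w + δ)) fun s hs => ?_
  rw [mkDerivation_monomial]
  refine Submodule.smul_mem _ _ (Submodule.sum_mem _ fun j hj => ?_)
  have h1 := hf (mem_support_iff.1 hs)
  rw [← Finsupp.weight_sub_single_add (w := bideg) (Finsupp.mem_support_iff.1 hj)] at h1
  have h2 := (isWeightedHomogeneous_monomial bideg (s - Finsupp.single j 1) ((s j : ℕ) : ℂ) rfl).mul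
    (hg j)
  rw [mem_weightedHomogeneousSubmodule]
  simp only [smul_eq_mul]
  convert h2 using 1
  rw [Prod.ext_iff] at h1 ⊢
  simp only [Prod.fst_add, Prod.snd_add, bideg] at h1 ⊢
  omega

theorem bideg_X (j : Idx ![3, 4]) : IsWeightedHomogeneous bideg (X j : Poly ℂ) (1, wt j) :=
  isWeightedHomogeneous_X _ _ _

theorem raise_mem {f : Poly ℂ} {d : ℕ} {w : ℤ} (hf : IsWeightedHomogeneous bideg f (d, w)) :
    IsWeightedHomogeneous bideg (raise f) (d, w + 2) := by
  refine mkDerivation_mem (fun j => ?_) hf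
  rw [raiseX]
  split_ifs with h
  · refine IsWeightedHomogeneous.C_mul ?_ _
    convert bideg_X _ using 2
    simp only [wt]
    rw [Nat.cast_sub h]; push_cast; ring
  · exact isWeightedHomogeneous_zero _ _ _

theorem lower_mem {f : Poly ℂ} {d : ℕ} {w : ℤ} (hf : IsWeightedHomogeneous bideg f (d, w)) :
    IsWeightedHomogeneous bideg (lower f) (d, w - 2) := by
  refine mkDerivation_mem (fun j => ?_) hf
  rw [lowerX]
  split_ifs with h
  · refine IsWeightedHomogeneous.C_mul ?_ _
    convert bideg_X _ using 2
    simp only [wt]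
    push_cast; ring
  · exact isWeightedHomogeneous_zero _ _ _

theorem weightOp_monomial (s : Idx ![3, 4] →₀ ℕ) (a : ℂ) :
    weightOp (monomial s a) = C ((Finsupp.weight bideg s).2 : ℂ) * monomial s a := by
  have h : (Finsupp.weight bideg s).2 = s.sum fun j k => (k : ℤ) * wt j := by
    rw [Finsupp.weight_apply, Finsupp.sum, Prod.snd_sum]
    simp [bideg, Finsupp.sum]
  rw [weightOp, mkDerivation_monomial, h, Finsupp.sum, Finsupp.sum, Int.cast_sum, map_sum,
    Finset.sum_mul, Finset.smul_sum]
  refine Finset.sum_congr rfl fun j hj => ?_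
  have h1 : 1 ≤ s j := Nat.one_le_iff_ne_zero.2 (Finsupp.mem_support_iff.1 hj)
  have h2 : s - Finsupp.single j 1 + Finsupp.single j 1 = s :=
    Finsupp.sub_add_single_one_cancel (Finsupp.mem_support_iff.1 hj)
  rw [smul_eq_mul, X, C_mul_monomial, monomial_mul, h2, smul_monomial, C_mul_monomial]
  congr 1
  simp; ring

theorem weightOp_apply {f : Poly ℂ} {d : ℕ} {w : ℤ} (hf : IsWeightedHomogeneous bideg f (d, w)) :
    weightOp f = (w : ℂ) • f := by
  conv_lhs => rw [← f.support_sum_monomial_coeff]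
  conv_rhs => rw [← f.support_sum_monomial_coeff]
  rw [map_sum, Finset.smul_sum]
  refine Finset.sum_congr rfl fun s hs => ?_
  rw [weightOp_monomial, hf (mem_support_iff.1 hs), smul_eq_C_mul]

theorem iterate_raise_mem {f : Poly ℂ} {d : ℕ} {w : ℤ} (hf : IsWeightedHomogeneous bideg f (d, w))
    (k : ℕ) : IsWeightedHomogeneous bideg (raise^[k] f) (d, w + 2 * k) := by
  induction k with
  | zero => simpa using hf
  | succ k ih =>
    rw [Function.iterate_succ_apply']
    convert raise_mem ih using 2
    push_cast; ring

theorem eq_zero_of_weight {f : Poly ℂ} {d : ℕ} {w : ℤ} (hf : IsWeightedHomogeneous bideg f (d, w))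
    (hw : 4 * d < w) : f = 0 := by
  by_contra h
  obtain ⟨s, hs⟩ := ne_zero_iff.1 h
  have h1 := hf hs
  rw [Finsupp.weight_apply, Finsupp.sum, Prod.ext_iff, Prod.fst_sum, Prod.snd_sum] at h1
  obtain ⟨h1, h2⟩ := h1
  have h3 : ∑ j ∈ s.support, (s j • bideg j).2 ≤ ∑ j ∈ s.support, 4 * ((s j • bideg j).1 : ℤ) := by
    refine Finset.sum_le_sum fun j _ => ?_
    have : wt j ≤ 4 := by
      obtain ⟨i, k⟩ := j
      simp only [wt]
      fin_cases i <;> simp <;> omega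
    simp only [bideg, Prod.smul_mk, smul_eq_mul, nsmul_eq_mul, mul_one]
    nlinarith
  rw [← Finset.mul_sum, ← Nat.cast_sum, h1, h2] at h3
  exact absurd h3 (not_le.2 hw)

theorem iterate_raise_lower {f : Poly ℂ} {d : ℕ} {w : ℤ}
    (hf : IsWeightedHomogeneous bideg f (d, w)) (k : ℕ) :
    raise^[k + 1] (lower f) = lower (raise^[k + 1] f) +
      (((k : ℂ) + 1) * (w + k)) • raise^[k] f := by
  have hc {g : Poly ℂ} {v : ℤ} (hg : IsWeightedHomogeneous bideg g (d, v)) :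
      raise (lower g) = lower (raise g) + (v : ℂ) • g := by
    rw [← weightOp_apply hg, ← lie_raise_lower, Derivation.commutator_apply]; ring
  induction k with
  | zero => simpa using hc hf
  | succ k ih =>
    rw [Function.iterate_succ_apply', ih, map_add, Derivation.map_smul,
      hc (iterate_raise_mem hf (k + 1)), ← Function.iterate_succ_apply' raise,
      ← Function.iterate_succ_apply' raise, add_assoc, ← add_smul]
    congr 2
    push_cast; ring

theorem raise_lower_injective {f : Poly ℂ} {d : ℕ} (hf : IsWeightedHomogeneous bideg f (d, 2))
    (h : raise (lower f) = 0) : f = 0 := by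
  by_contra hne
  have hex : ∃ k, raise^[k] f = 0 :=
    ⟨2 * d, eq_zero_of_weight (iterate_raise_mem hf _) (by push_cast; omega)⟩
  classical
  obtain ⟨k, hk⟩ : ∃ k, Nat.find hex = k + 1 := by
    refine Nat.exists_eq_succ_of_ne_zero fun h0 => hne ?_
    have := Nat.find_spec hex
    rwa [h0] at this
  have h1 : raise^[k + 1] f = 0 := hk ▸ Nat.find_spec hex
  have h2 : raise^[k] f ≠ 0 := Nat.find_min hex (by omega)
  have h3 := iterate_raise_lower hf k
  rw [Function.iterate_succ_apply, h, h1, map_zero, zero_add, iterate_map_zero] at h3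
  refine (smul_ne_zero ?_ h2) h3.symm
  exact_mod_cast (by positivity : (k + 1) * (2 + k) ≠ 0)

end CubicQuartic

namespace CubicQuartic

open BinInv

/-- The exponents of given degree and weight. -/
def expo (d : ℕ) (w : ℤ) : Finset (Idx ![3, 4] →₀ ℕ) :=
  (Finset.univ.finsuppAntidiag d).filter fun s => ∑ j, (s j : ℤ) * wt j = w

theorem mem_expo {d : ℕ} {w : ℤ} {s : Idx ![3, 4] →₀ ℕ} :
    s ∈ expo d w ↔ Finsupp.weight bideg s = (d, w) := by
  have h1 : (Finsupp.weight bideg s).1 = ∑ j, s j := by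
    rw [Finsupp.weight_apply, Finsupp.sum_fintype _ _ (by simp), Prod.fst_sum]
    simp [bideg]
  have h2 : (Finsupp.weight bideg s).2 = ∑ j, (s j : ℤ) * wt j := by
    rw [Finsupp.weight_apply, Finsupp.sum_fintype _ _ (by simp), Prod.snd_sum]
    simp [bideg]
  rw [expo, Finset.mem_filter, Prod.ext_iff, h1, h2]
  simp

theorem weightSpace_eq_span (d : ℕ) (w : ℤ) : weightedHomogeneousSubmodule ℂ bideg (d, w) =
    Submodule.span ℂ (Set.range fun s : expo d w => (monomial (s : Idx ![3, 4] →₀ ℕ) (1 : ℂ))) := by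
  apply le_antisymm
  · intro f hf
    rw [← f.support_sum_monomial_coeff]
    refine Submodule.sum_mem _ fun s hs => ?_
    rw [show monomial s (coeff s f) = coeff s f • monomial s (1 : ℂ) by
      rw [smul_monomial, smul_eq_mul, mul_one]]
    exact Submodule.smul_mem _ _
      (Submodule.subset_span ⟨⟨s, mem_expo.2 (hf (mem_support_iff.1 hs))⟩, rfl⟩)
  · rw [Submodule.span_le]
    rintro _ ⟨s, rfl⟩
    exact isWeightedHomogeneous_monomial _ _ _ (mem_expo.1 s.2)

instance (d : ℕ) (w : ℤ) :
    FiniteDimensional ℂ (weightedHomogeneousSubmodule ℂ bideg (d, w)) := by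
  rw [weightSpace_eq_span]
  exact FiniteDimensional.span_of_finite ℂ (Set.finite_range _)

theorem finrank_weightSpace (d : ℕ) (w : ℤ) :
    Module.finrank ℂ (weightedHomogeneousSubmodule ℂ bideg (d, w)) = (expo d w).card := by
  rw [weightSpace_eq_span, finrank_span_eq_card, Fintype.card_coe]
  have := (basisMonomials (Idx ![3, 4]) ℂ).linearIndependent.comp
    (fun s : expo d w => (s : Idx ![3, 4] →₀ ℕ)) Subtype.val_injective
  simpa [Function.comp_def] using this

theorem finrank_le_of_raise_eq_zero {d : ℕ} (U : Submodule ℂ (Poly ℂ))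
    (h0 : U ≤ weightedHomogeneousSubmodule ℂ bideg (d, 0)) (hU : ∀ f ∈ U, raise f = 0) :
    Module.finrank ℂ U + (expo d 2).card ≤ (expo d 0).card := by
  have hE (f) (hf : f ∈ weightedHomogeneousSubmodule ℂ bideg (d, 0)) :
      raise.toLinearMap f ∈ weightedHomogeneousSubmodule ℂ bideg (d, 2) := raise_mem hf
  have hF (f) (hf : f ∈ weightedHomogeneousSubmodule ℂ bideg (d, 2)) :
      lower.toLinearMap f ∈ weightedHomogeneousSubmodule ℂ bideg (d, 0) := lower_mem hf
  set E' := raise.toLinearMap.restrict hE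
  set F' := lower.toLinearMap.restrict hF
  have hinj : Function.Injective (E' ∘ₗ F') := by
    rw [← LinearMap.ker_eq_bot, LinearMap.ker_eq_bot']
    intro f hf
    exact Subtype.ext (raise_lower_injective f.2 (congrArg Subtype.val hf))
  have hsurj : Function.Surjective E' := by
    have := LinearMap.injective_iff_surjective.1 hinj
    exact Function.Surjective.of_comp this
  rw [← finrank_weightSpace, ← finrank_weightSpace, ← LinearMap.finrank_range_add_finrank_ker E',
    LinearMap.range_eq_top.2 hsurj, finrank_top, add_comm]
  refine Nat.add_le_add_left ?_ _
  refine LinearMap.finrank_le_finrank_of_injective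
    (f := (Submodule.inclusion h0).codRestrict (LinearMap.ker E') fun f => ?_) ?_
  · exact Subtype.ext (hU f f.2)
  · intro f g h
    exact Submodule.inclusion_injective h0 (congrArg Subtype.val h)

/-- The one-parameter family of translations of a polynomial function. -/
noncomputable def flowHom : Poly ℂ →ₐ[ℂ] Polynomial (Poly ℂ) :=
  aeval (flow Polynomial.X fun j => Polynomial.C (X j))

theorem coeff_flow (j : Idx ![3, 4]) :
    (flow Polynomial.X (fun j => Polynomial.C (X j : Poly ℂ)) j).coeff 0 = X j ∧
      (flow Polynomial.X (fun j => Polynomial.C (X j : Poly ℂ)) j).coeff 1 = raiseX j := by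
  obtain ⟨i, k⟩ := j
  have e (n m l : ℕ) (x : Poly ℂ) : ((m : Polynomial (Poly ℂ)) * Polynomial.X ^ n *
      Polynomial.C x).coeff l = if l = n then m * x else 0 := by
    rw [← Polynomial.C_eq_natCast, mul_right_comm, ← Polynomial.C_mul, Polynomial.coeff_C_mul_X_pow]
  constructor
  · rw [flow, Polynomial.finsetSum_coeff, Finset.sum_eq_single k]
    · rw [if_pos le_rfl, e]; simp
    · intro l _ hl
      split_ifs with h
      · rw [e, if_neg]
        have : (l : ℕ) ≠ k := fun h => hl (Fin.ext h)
        dsimp only at h ⊢; omega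
      · simp
    · simp
  · rw [raiseX, flow, Polynomial.finsetSum_coeff]
    split_ifs with h0
    · have h0' : 0 < (k : ℕ) := h0
      rw [Finset.sum_eq_single ⟨(k : ℕ) - 1, (Nat.sub_le _ _).trans_lt k.2⟩]
      · have hk : (k : ℕ) ≤ (![3, 4] : Fin 2 → ℕ) i := Nat.lt_succ_iff.1 k.2
        have h1 : (k : ℕ) - (k - 1) = 1 := by omega
        rw [if_pos (Nat.sub_le _ _), e]
        simp only [h1, if_true, Nat.choose_one_right]
        congr 1
        rw [← map_natCast C]
        congr 1
        rw [Nat.cast_sub (by omega), Nat.cast_sub (by omega)]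
        push_cast; ring
      · intro l _ hl
        split_ifs with h
        · rw [e, if_neg]
          have : (l : ℕ) ≠ k - 1 := fun h => hl (Fin.ext h)
          dsimp only at h ⊢; omega
        · simp
      · simp
    · refine Finset.sum_eq_zero fun l _ => ?_
      split_ifs with h
      · rw [e, if_neg]
        dsimp only at h0 h ⊢; omega
      · simp

theorem coeff_flowHom (f : Poly ℂ) :
    (flowHom f).coeff 0 = f ∧ (flowHom f).coeff 1 = raise f := by
  induction f using MvPolynomial.induction_on with
  | C a =>
    rw [flowHom, algHom_C, Polynomial.algebraMap_apply, algebraMap_eq]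
    refine ⟨Polynomial.coeff_C_zero, ?_⟩
    rw [Polynomial.coeff_C, if_neg one_ne_zero, ← algebraMap_eq, Derivation.map_algebraMap]
  | add p q hp hq =>
    rw [map_add, map_add, Polynomial.coeff_add, Polynomial.coeff_add, hp.1, hp.2, hq.1, hq.2]
    exact ⟨rfl, rfl⟩
  | mul_X p j hp =>
    have h : flowHom (X j) = flow Polynomial.X (fun j => Polynomial.C (X j : Poly ℂ)) j := aeval_X _ _
    rw [map_mul, Polynomial.mul_coeff_zero, Polynomial.mul_coeff_one, hp.1, hp.2, h,
      (coeff_flow j).1, (coeff_flow j).2, Derivation.leibniz, smul_eq_mul, smul_eq_mul]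
    refine ⟨rfl, ?_⟩
    rw [show raise (X j) = raiseX j from mkDerivation_X _ _ _]; ring

theorem raise_eq_zero {f : Poly ℂ} (hf : f ∈ invariantRing ![3, 4]) : raise f = 0 := by
  have h1 (s : ℂ) : (flowHom f).eval (C s) = f := by
    refine MvPolynomial.funext fun c => ?_
    rw [← hf (unip s) c, actPt_unip]
    have h2 : ((eval c).comp (Polynomial.evalRingHom (C s))).comp flowHom.toRingHom =
        eval (flow s c) := by
      ext j
      · simp [flowHom]
      · simp [flowHom, flow, Polynomial.eval_finsetSum, apply_ite]
        refine Finset.sum_congr rfl fun x _ => ?_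
        split_ifs <;> ring
    exact DFunLike.congr_fun h2 f
  have h3 : flowHom f - Polynomial.C f = 0 := by
    refine Polynomial.eq_zero_of_infinite_isRoot _ (Set.Infinite.mono ?_
      (Set.infinite_range_of_injective (C_injective (Idx ![3, 4]) ℂ)))
    rintro _ ⟨s, rfl⟩
    simp [Polynomial.IsRoot, h1]
  have h4 := congrArg (fun p => p.coeff 1) h3
  simpa [(coeff_flowHom f).2, Polynomial.coeff_C] using h4

theorem weight_eq_zero {f : Poly ℂ} (hf : f ∈ invariantRing ![3, 4]) {s : Idx ![3, 4] →₀ ℕ}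
    (hs : coeff s f ≠ 0) : (Finsupp.weight bideg s).2 = 0 := by
  have h1 : aeval (fun j => C ((2 : ℂ) ^ wt j) * X j) f = f := by
    refine MvPolynomial.funext fun c => ?_
    rw [← hf diag c, actPt_diag]
    have h2 : (eval c).comp (aeval fun j : Idx ![3, 4] =>
        (C ((2 : ℂ) ^ wt j) * X j : Poly ℂ)).toRingHom =
        eval fun j => (2 : ℂ) ^ wt j * c j := by
      ext j
      · simp
      · simp
    exact DFunLike.congr_fun h2 f
  have h3 (g : Poly ℂ) : coeff s (aeval (fun j => C ((2 : ℂ) ^ wt j) * X j : _ → Poly ℂ) g) =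
      2 ^ (Finsupp.weight bideg s).2 * coeff s g := by
    induction g using MvPolynomial.induction_on' with
    | monomial t a =>
      have : aeval (fun j => C ((2 : ℂ) ^ wt j) * X j : _ → Poly ℂ) (monomial t a) =
          C (2 ^ (Finsupp.weight bideg t).2) * monomial t a := by
        rw [aeval_monomial, monomial_eq (a := a), algebraMap_eq]
        simp only [mul_pow, Finsupp.prod_mul]
        rw [mul_left_comm]
        congr 1
        rw [Finsupp.weight_apply, Finsupp.sum, Prod.snd_sum, Finsupp.prod]
        simp only [← map_pow, ← map_prod]
        congr 1
        simp only [bideg, Prod.smul_snd]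
        induction t.support using Finset.induction_on with
        | empty => simp
        | insert j u hj ih =>
          rw [Finset.prod_insert hj, Finset.sum_insert hj, ih, zpow_add₀ two_ne_zero, mul_comm,
            ← zpow_natCast, ← zpow_mul, mul_comm]
          simp [mul_comm]
      rw [this, coeff_C_mul, coeff_monomial]
      split_ifs with h
      · rw [h]
      · simp
    | add p q hp hq => rw [map_add, coeff_add, hp, hq, coeff_add, mul_add]
  have h4 := h3 f
  rw [h1] at h4
  have h5 : (2 : ℂ) ^ (Finsupp.weight bideg s).2 = 1 := by
    have : (2 : ℂ) ^ (Finsupp.weight bideg s).2 * coeff s f = 1 * coeff s f := by rw [← h4, one_mul]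
    exact mul_right_cancel₀ hs this
  have h6 := congrArg norm h5
  rw [norm_zpow, norm_one, Complex.norm_ofNat] at h6
  exact (zpow_eq_one_iff_right₀ (by norm_num) (by norm_num)).1 h6

/-- The invariants of degree `d`. -/
noncomputable def invDeg (d : ℕ) : Submodule ℂ (Poly ℂ) :=
  Subalgebra.toSubmodule (invariantRing ![3, 4]) ⊓ homogeneousSubmodule (Idx ![3, 4]) ℂ d

theorem invDeg_le (d : ℕ) : invDeg d ≤ weightedHomogeneousSubmodule ℂ bideg (d, 0) := by
  intro f hf s hs
  refine Prod.ext ?_ (weight_eq_zero hf.1 hs)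
  have := hf.2 hs
  rw [← this, Finsupp.weight_apply, Finsupp.weight_apply, Finsupp.sum, Prod.fst_sum]
  rfl

instance (d : ℕ) : FiniteDimensional ℂ (invDeg d) :=
  Submodule.finiteDimensional_of_le (invDeg_le d)

theorem finrank_invDeg_le (d : ℕ) :
    Module.finrank ℂ (invDeg d) + (expo d 2).card ≤ (expo d 0).card :=
  finrank_le_of_raise_eq_zero _ (invDeg_le d) fun _ hf => raise_eq_zero hf.1

end CubicQuartic

namespace CubicQuartic

namespace Cert

/-- Sum of polynomials given by coefficient lists. -/
def addL {S : Type*} (add : S → S → S) : List S → List S → List S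
  | [], m => m
  | l, [] => l
  | a :: l, b :: m => add a b :: addL add l m

/-- Product of polynomials given by coefficient lists. -/
def mulL {S : Type*} (zero : S) (add mul : S → S → S) : List S → List S → List S
  | [], _ => []
  | a :: l, m => addL add (m.map (mul a)) (zero :: mulL zero add mul l m)

/-- Evaluation of a polynomial given by a coefficient list. -/
def ev {S A : Type*} [CommRing A] (φ : S → A) (x : A) : List S → A
  | [] => 0
  | a :: l => φ a + x * ev φ x l

section

variable {S A : Type*} [CommRing A] (φ : S → A) (x : A) {zero : S} {add mul : S → S → S}

theorem ev_addL (hadd : ∀ a b, φ (add a b) = φ a + φ b) (l m : List S) :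
    ev φ x (addL add l m) = ev φ x l + ev φ x m := by
  induction l generalizing m with
  | nil => simp [addL, ev]
  | cons a l ih =>
    cases m with
    | nil => simp [addL, ev]
    | cons b m => simp only [addL, ev, hadd, ih]; ring

theorem ev_mulL (hadd : ∀ a b, φ (add a b) = φ a + φ b) (hmul : ∀ a b, φ (mul a b) = φ a * φ b)
    (hzero : φ zero = 0) (l m : List S) :
    ev φ x (mulL zero add mul l m) = ev φ x l * ev φ x m := by
  have h (a : S) (m : List S) : ev φ x (m.map (mul a)) = φ a * ev φ x m := by
    induction m with
    | nil => simp [ev]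
    | cons b m ih => simp only [List.map_cons, ev, hmul, ih]; ring
  induction l with
  | nil => simp [mulL, ev]
  | cons a l ih => simp only [mulL, ev, ev_addL φ x hadd, h, ih, hzero]; ring

theorem mul_ev_reverse {x y : A} (hxy : x * y = 1) (l : List S) :
    x * ev φ x l.reverse = x ^ l.length * ev φ y l := by
  have h (m : List S) (a : S) : ev φ x (m ++ [a]) = ev φ x m + x ^ m.length * φ a := by
    induction m with
    | nil => simp [ev]
    | cons b m ih => simp only [List.cons_append, ev, ih, List.length_cons]; ring
  induction l with
  | nil => simp [ev]
  | cons a l ih =>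
    rw [List.reverse_cons, h, List.length_reverse, List.length_cons, ev]
    linear_combination ih - x ^ l.length * ev φ y l * hxy

end

/-- Sum of two polynomials in one variable. -/
def add₁ : List ℤ → List ℤ → List ℤ := addL (· + ·)

/-- Product of two polynomials in one variable. -/
def mul₁ : List ℤ → List ℤ → List ℤ := mulL 0 (· + ·) (· * ·)

/-- Sum of two polynomials in two variables. -/
def add₂ : List (List ℤ) → List (List ℤ) → List (List ℤ) := addL add₁

/-- Product of two polynomials in two variables. -/
def mul₂ : List (List ℤ) → List (List ℤ) → List (List ℤ) := mulL [] add₁ mul₁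

section

variable {A : Type*} [CommRing A] (t z : A)

/-- Evaluation of a polynomial in one variable. -/
def ev₁ (l : List ℤ) : A := ev (fun n : ℤ => (n : A)) t l

/-- Evaluation of a polynomial in two variables. -/
def ev₂ (l : List (List ℤ)) : A := ev (ev₁ t) z l

theorem ev₁_add (l m : List ℤ) : ev₁ t (add₁ l m) = ev₁ t l + ev₁ t m :=
  ev_addL _ _ Int.cast_add _ _

theorem ev₁_mul (l m : List ℤ) : ev₁ t (mul₁ l m) = ev₁ t l * ev₁ t m :=
  ev_mulL _ _ Int.cast_add Int.cast_mul Int.cast_zero _ _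

theorem ev₂_add (l m : List (List ℤ)) : ev₂ t z (add₂ l m) = ev₂ t z l + ev₂ t z m :=
  ev_addL _ _ (ev₁_add t) _ _

theorem ev₂_mul (l m : List (List ℤ)) : ev₂ t z (mul₂ l m) = ev₂ t z l * ev₂ t z m :=
  ev_mulL _ _ (ev₁_add t) (ev₁_mul t) rfl _ _

theorem ev₂_eq_zero {l : List (List ℤ)} (h : ∀ m ∈ l, ∀ a ∈ m, a = 0) : ev₂ t z l = 0 := by
  have h1 (m : List ℤ) (hm : ∀ a ∈ m, a = 0) : ev₁ t m = 0 := by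
    induction m with
    | nil => rfl
    | cons a m ih =>
      change (a : A) + t * ev₁ t m = 0
      rw [ih fun b hb => hm b (List.mem_cons_of_mem _ hb), hm a List.mem_cons_self]; simp
  induction l with
  | nil => rfl
  | cons m l ih =>
    change ev₁ t m + z * ev₂ t z l = 0
    rw [ih fun b hb => h b (List.mem_cons_of_mem _ hb), h1 m (h m List.mem_cons_self)]; simp

end

/-- The numerator of the Hilbert series of the invariant ring. -/
def num : List ℤ := [1, 0, 0, 0, 0, 1, 1, 2, 3, 4, 3, 2, 1, 1, 0, 0, 0, 0, 1]

/-- The numerator of the part with positive weights. -/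
def posPart : List (List ℤ) :=
  [[],
    [0, 0, 1, 1, 2, 3, 3, 4, 4, 4, 4, 4, 3, 3, 2, 1, 1],
    [0, 0, 1, 1, 2, 2, 2, 3, 2, 2, 2, 2, 1, 1, 0, 0, 0, -1],
    [0, 1, 1, 0, 0, -1, 0, 0, -1, 0, -1, -2, -3, -4, -4, -3, -2, -1],
    [0, 1, 0, -1, 0, -1, -1, -2, -3, -3, -4, -5, -6, -5, -4, -3, -2, -1],
    [0, 0, -1, -1, 0, -1, -2, -4, -6, -7, -8, -9, -8, -5, -4, -2, -1, -1],
    [0, 0, -1, 0, 0, -1, 0, -1, -1, -1, -2, -2, -1, 0, 1, 2, 2, 2, 2, 1],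
    [0, 0, -1, 0, 0, 0, 1, 0, 1, 1, 0, 0, 1, 2, 3, 3, 3, 3, 2, 1],
    [0, 0, 0, 1, 1, 0, 0, 0, 1, 2, 3, 5, 7, 7, 5, 3, 2, 1, 0, 0, 0, 1, 1],
    [0, 0, 0, 1, 0, 0, 0, 0, 1, 1, 2, 3, 4, 3, 2, 1, 1, 0, 0, 0, 0, 1],
    [0, 0, 0, 0, -1, 0, 0, 0, 0, -1, -1, -2, -3, -4, -3, -2, -1, -1, 0, 0, 0, 0, -1]]

/-- The numerator of the part with negative weights. -/
def negPart : List (List ℤ) :=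
  [[],
    [],
    [-1, 0, 0, 0, 0, -1, -1, -2, -3, -4, -3, -2, -1, -1, 0, 0, 0, 0, -1],
    [0, 1, -1, -1, -2, -3, -2, -3, -2, -1, 0, -1, -1, -2, -1, -1, -1, 0, 0, 1],
    [0, 1, -1, -1, -2, -2, -1, -2, 0, 1, 2, 1, 1, 0, 1, 0, 0, 1, 0, 1],
    [0, 0, -2, 0, 0, 1, 1, 0, 2, 1, 2, 1, 2, 3, 4, 2, 2, 1, 0, 1, -1],
    [0, 0, -1, 1, 0, 1, 2, 2, 4, 4, 5, 4, 5, 4, 4, 2, 2, 1, 0, 1, -1],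
    [0, 0, -1, 1, 0, 1, 2, 2, 4, 3, 2, 1, 2, 1, 2, 0, 1, 1, 0, 0, -2],
    [0, 0, 0, 1, 0, 1, 0, 0, 1, 0, 1, 1, 2, 1, 0, -2, -1, -2, -2, -1, -1, 1],
    [0, 0, 0, 1, 0, 0, -1, -1, -1, -2, -1, -1, 0, -1, -2, -3, -2, -3, -2, -1, -1, 1],
    [0, 0, 0, 0, -1, 0, 0, 0, 0, -1, -1, -2, -3, -4, -3, -2, -1, -1, 0, 0, 0, 0, -1]]

/-- The product of all members of a list of polynomials. -/
def prod₂ (l : List (List (List ℤ))) : List (List ℤ) := l.foldr mul₂ [[1]]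

/-- The denominator of the Hilbert series of the invariant ring. -/
def den : List (List (List ℤ)) :=
  [[[1, 0, -1]], [[1, 0, 0, -1]], [[1, 0, 0, 0, -1]], [[1, 0, 0, 0, 0, -1]],
    [[1, 0, 0, 0, 0, 0, -1]], [[1, 0, 0, 0, 0, 0, 0, -1]]]

/-- The denominator of the part with positive weights. -/
def denPos : List (List (List ℤ)) :=
  [[[1], [0, -1]], [[1], [], [0, -1]], [[1], [], [], [0, -1]], [[1], [], [], [], [0, -1]]]

/-- The denominator of the part with negative weights, multiplied by a monomial. -/
def denNeg : List (List (List ℤ)) :=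
  [[[0, -1], [1]], [[0, -1], [], [1]], [[0, -1], [], [], [1]], [[0, -1], [], [], [], [1]]]

/-- The difference of the two sides of the certificate for the Hilbert series. -/
def diff : List (List ℤ) :=
  add₂ (mul₂ [[], [], [], [], [], [], [], [], [1], [], [-1]] (prod₂ den))
    (mul₂ [[1, -1]] (add₂ (mul₂ (prod₂ denPos) (add₂ (mul₂ [num] (prod₂ denNeg)) negPart.reverse))
      (mul₂ posPart (prod₂ denNeg))))

theorem diff_eq : ∀ m ∈ diff, ∀ a ∈ m, a = 0 := by decide +kernel

theorem identity {A : Type*} [CommRing A] {t z z' : A} (hz : z * z' = 1) :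
    (1 - z' ^ 2) * ((1 - t ^ 2) * (1 - t ^ 3) * (1 - t ^ 4) * (1 - t ^ 5) * (1 - t ^ 6) *
        (1 - t ^ 7)) =
      ev₁ t num * ((1 - t) * ((1 - t * z) * (1 - t * z ^ 2) * (1 - t * z ^ 3) * (1 - t * z ^ 4)) *
        ((1 - t * z') * (1 - t * z' ^ 2) * (1 - t * z' ^ 3) * (1 - t * z' ^ 4))) +
      ev₂ t z posPart * ((1 - t) *
        ((1 - t * z') * (1 - t * z' ^ 2) * (1 - t * z' ^ 3) * (1 - t * z' ^ 4))) +
      ev₂ t z' negPart * ((1 - t) *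
        ((1 - t * z) * (1 - t * z ^ 2) * (1 - t * z ^ 3) * (1 - t * z ^ 4))) := by
  have h := ev₂_eq_zero t z diff_eq
  have h1 : z * ev₂ t z negPart.reverse = z ^ 11 * ev₂ t z' negPart := mul_ev_reverse _ hz _
  have e1 (l : List ℤ) : ev₂ t z [l] = ev₁ t l := by simp [ev₂, ev]
  have e2 : ev₁ t [1, -1] = 1 - t := by simp [ev₁, ev]; ring
  have e3 : ev₂ t z (prod₂ denPos) =
      (1 - t * z) * (1 - t * z ^ 2) * (1 - t * z ^ 3) * (1 - t * z ^ 4) := by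
    simp only [prod₂, denPos, List.foldr, ev₂_mul]
    simp [ev₂, ev₁, ev]; ring
  have e4 : ev₂ t z (prod₂ denNeg) = z ^ 10 *
      ((1 - t * z') * (1 - t * z' ^ 2) * (1 - t * z' ^ 3) * (1 - t * z' ^ 4)) := by
    have e (k : ℕ) : z ^ k * (1 - t * z' ^ k) = z ^ k - t := by
      have : z ^ k * z' ^ k = 1 := by rw [← mul_pow, hz, one_pow]
      linear_combination -t * this
    have e0 := e 1
    rw [pow_one, pow_one] at e0
    trans (z - t) * (z ^ 2 - t) * (z ^ 3 - t) * (z ^ 4 - t)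
    · simp only [prod₂, denNeg, List.foldr, ev₂_mul]
      simp [ev₂, ev₁, ev]; ring
    · rw [← e 2, ← e 3, ← e 4, ← e0]; ring
  have e5 : ev₂ t z (prod₂ den) =
      (1 - t ^ 2) * (1 - t ^ 3) * (1 - t ^ 4) * (1 - t ^ 5) * (1 - t ^ 6) * (1 - t ^ 7) := by
    simp only [prod₂, den, List.foldr, ev₂_mul]
    simp [ev₂, ev₁, ev]; ring
  have e6 : ev₂ t z [[], [], [], [], [], [], [], [], [1], [], [-1]] =
      -z ^ 10 * (1 - z' ^ 2) := by
    have : z ^ 2 * z' ^ 2 = 1 := by rw [← mul_pow, hz, one_pow]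
    simp [ev₂, ev₁, ev]
    linear_combination -z ^ 8 * this
  rw [diff, ev₂_add, ev₂_mul, ev₂_mul, ev₂_add, ev₂_mul, ev₂_add, ev₂_mul, ev₂_mul, e1, e1, e2, e3,
    e4, e5, e6] at h
  have h2 : z ^ 11 * z' ^ 11 = 1 := by rw [← mul_pow, hz, one_pow]
  generalize (1 - t * z) * (1 - t * z ^ 2) * (1 - t * z ^ 3) * (1 - t * z ^ 4) = p at *
  generalize (1 - t * z') * (1 - t * z' ^ 2) * (1 - t * z' ^ 3) * (1 - t * z' ^ 4) = q at *
  generalize (1 - t ^ 2) * (1 - t ^ 3) * (1 - t ^ 4) * (1 - t ^ 5) * (1 - t ^ 6) * (1 - t ^ 7) = r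
    at *
  rw [← sub_eq_zero]
  have h3 : z ^ 11 * ((1 - z' ^ 2) * r - (ev₁ t num * ((1 - t) * p * q) +
      ev₂ t z posPart * ((1 - t) * q) + ev₂ t z' negPart * ((1 - t) * p))) = 0 := by
    linear_combination -z * h + (1 - t) * p * h1
  linear_combination z' ^ 11 * h3 - ((1 - z' ^ 2) * r - (ev₁ t num * ((1 - t) * p * q) +
      ev₂ t z posPart * ((1 - t) * q) + ev₂ t z' negPart * ((1 - t) * p))) * h2

end Cert

end CubicQuartic

namespace CubicQuartic

/-- The coefficientwise constant term of a power series over Laurent polynomials. -/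
noncomputable def constTerm : PowerSeries (LaurentPolynomial ℤ) →+ PowerSeries ℤ where
  toFun f := PowerSeries.mk fun n => (PowerSeries.coeff n f).coeff 0
  map_zero' := by ext; simp
  map_add' f g := by ext; simp

namespace Cert

theorem map_ev₁ {A A' : Type*} [CommRing A] [CommRing A'] (φ : A →+* A') (t : A) (l : List ℤ) :
    φ (ev₁ t l) = ev₁ (φ t) l := by
  induction l with
  | nil => exact map_zero φ
  | cons a l ih =>
    change φ ((a : A) + t * ev₁ t l) = (a : A') + φ t * ev₁ (φ t) l
    rw [map_add, map_mul, ih, map_intCast]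

theorem map_ev₂ {A A' : Type*} [CommRing A] [CommRing A'] (φ : A →+* A') (t z : A)
    (l : List (List ℤ)) : φ (ev₂ t z l) = ev₂ (φ t) (φ z) l := by
  induction l with
  | nil => exact map_zero φ
  | cons a l ih =>
    change φ (ev₁ t a + z * ev₂ t z l) = ev₁ (φ t) a + φ z * ev₂ (φ t) (φ z) l
    rw [map_add, map_mul, ih, map_ev₁]

end Cert

namespace HilbertSeries

open LaurentPolynomial BinInv

/-- The geometric series with ratio `z ^ k * t`. -/
noncomputable def geom (k : ℤ) : PowerSeries ℤ[T;T⁻¹] := PowerSeries.mk fun n => T (n * k)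

theorem geom_mul (k : ℤ) : geom k * (1 - PowerSeries.X * PowerSeries.C (T k)) = 1 := by
  ext n : 1
  rw [mul_sub, mul_one, map_sub, ← mul_assoc, PowerSeries.coeff_mul_C]
  cases n with
  | zero => simp [geom]
  | succ n =>
    rw [PowerSeries.coeff_succ_mul_X, geom, PowerSeries.coeff_mk, PowerSeries.coeff_mk, ← T_add,
      PowerSeries.coeff_one, if_neg n.succ_ne_zero, sub_eq_zero]
    congr 1; push_cast; ring

theorem coeff_prod_geom (d : ℕ) (w : ℤ) :
    (PowerSeries.coeff d (∏ j, geom (wt j))).coeff w = (expo d w).card := by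
  rw [PowerSeries.coeff_prod]
  simp only [geom, PowerSeries.coeff_mk]
  have h (s : Idx ![3, 4] →₀ ℕ) : ∏ j, (T (s j * wt j) : ℤ[T;T⁻¹]) = T (∑ j, (s j : ℤ) * wt j) := by
    induction (Finset.univ : Finset (Idx ![3, 4])) using Finset.induction_on with
    | empty => simp
    | insert j u hj ih => rw [Finset.prod_insert hj, Finset.sum_insert hj, ih, T_add]
  simp only [h]
  rw [AddMonoidAlgebra.coeff_sum, Finsupp.finsetSum_apply]
  simp only [T_apply]
  rw [Finset.sum_boole, expo]

theorem constTerm_map_mul (a : PowerSeries ℤ) (f : PowerSeries ℤ[T;T⁻¹]) :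
    constTerm (PowerSeries.map LaurentPolynomial.C a * f) = a * constTerm f := by
  ext n
  simp only [constTerm, AddMonoidHom.coe_mk, ZeroHom.coe_mk, PowerSeries.coeff_mk,
    PowerSeries.coeff_mul, PowerSeries.coeff_map]
  rw [AddMonoidAlgebra.coeff_sum, Finsupp.finsetSum_apply]
  refine Finset.sum_congr rfl fun x _ => ?_
  rw [← LaurentPolynomial.smul_eq_C_mul, AddMonoidAlgebra.coeff_smul]
  rfl

theorem constTerm_toLaurent (f : PowerSeries (Polynomial ℤ)) :
    constTerm (PowerSeries.map (Polynomial.toLaurent : Polynomial ℤ →+* ℤ[T;T⁻¹])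
      (PowerSeries.C Polynomial.X * f)) = 0 := by
  ext n
  simp only [constTerm, AddMonoidHom.coe_mk, ZeroHom.coe_mk, PowerSeries.coeff_mk,
    PowerSeries.coeff_C_mul, PowerSeries.coeff_map]
  have h (g : Polynomial ℤ) : (Polynomial.toLaurent g).coeff 0 = g.coeff 0 := by
    rw [coeff_toLaurent]
    exact Finsupp.mapDomain_apply Nat.castEmbedding.injective _ 0
  rw [h]; simp

theorem constTerm_invert (f : PowerSeries ℤ[T;T⁻¹]) :
    constTerm (PowerSeries.map ((invert : ℤ[T;T⁻¹] ≃ₐ[ℤ] ℤ[T;T⁻¹]) : ℤ[T;T⁻¹] →+* ℤ[T;T⁻¹]) f) =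
      constTerm f := by
  ext n
  simp [constTerm]

theorem geom_eq_map (k : ℕ) : geom k = PowerSeries.map Polynomial.toLaurent
    (PowerSeries.mk fun n => (Polynomial.X : Polynomial ℤ) ^ (n * k)) := by
  ext n : 1
  simp [geom, Polynomial.toLaurent_X_pow]

theorem geom_neg_eq_map (k : ℤ) : geom (-k) = PowerSeries.map
    ((invert : ℤ[T;T⁻¹] ≃ₐ[ℤ] ℤ[T;T⁻¹]) : ℤ[T;T⁻¹] →+* ℤ[T;T⁻¹]) (geom k) := by
  ext n : 1
  simp [geom]

theorem constTerm_pos (l : List (List ℤ)) : constTerm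
    (Cert.ev₂ PowerSeries.X (PowerSeries.C (T 1)) ([] :: l) *
      (geom 1 * geom 2 * geom 3 * geom 4)) = 0 := by
  have h (k : ℕ) := geom_eq_map k
  have h1 := h 1
  have h2 := h 2
  have h3 := h 3
  have h4 := h 4
  push_cast at h1 h2 h3 h4
  have e : (PowerSeries.X : PowerSeries ℤ[T;T⁻¹]) =
      PowerSeries.map Polynomial.toLaurent PowerSeries.X := by simp
  have e' : (PowerSeries.C (T 1) : PowerSeries ℤ[T;T⁻¹]) =
      PowerSeries.map Polynomial.toLaurent (PowerSeries.C Polynomial.X) := by simp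
  rw [h1, h2, h3, h4, e, e', ← Cert.map_ev₂, ← map_mul, ← map_mul, ← map_mul, ← map_mul]
  have h5 : Cert.ev₂ PowerSeries.X (PowerSeries.C (Polynomial.X : Polynomial ℤ)) ([] :: l) =
      PowerSeries.C Polynomial.X * Cert.ev₂ PowerSeries.X (PowerSeries.C Polynomial.X) l := by
    change (0 : PowerSeries (Polynomial ℤ)) + _ = _
    rw [zero_add]; rfl
  rw [h5, mul_assoc]
  exact constTerm_toLaurent _

theorem constTerm_neg (l : List (List ℤ)) : constTerm
    (Cert.ev₂ PowerSeries.X (PowerSeries.C (T (-1))) ([] :: l) *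
      (geom (-1) * geom (-2) * geom (-3) * geom (-4))) = 0 := by
  rw [← constTerm_pos l, ← constTerm_invert (_ * (geom 1 * _ * _ * _)), geom_neg_eq_map,
    geom_neg_eq_map, geom_neg_eq_map, geom_neg_eq_map]
  simp only [map_mul (PowerSeries.map _), Cert.map_ev₂]
  simp

theorem ev₁_eq_map (l : List ℤ) : Cert.ev₁ (PowerSeries.X : PowerSeries ℤ[T;T⁻¹]) l =
    PowerSeries.map LaurentPolynomial.C (Cert.ev₁ PowerSeries.X l) := by
  rw [Cert.map_ev₁]; simp

/-- The denominator of the Hilbert series of the invariant ring. -/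
noncomputable def den : PowerSeries ℤ :=
  (1 - PowerSeries.X ^ 2) * (1 - PowerSeries.X ^ 3) * (1 - PowerSeries.X ^ 4) *
    (1 - PowerSeries.X ^ 5) * (1 - PowerSeries.X ^ 6) * (1 - PowerSeries.X ^ 7)

theorem weight_series : PowerSeries.mk (fun d => ((expo d 0).card : ℤ) - (expo d 2).card) * den =
    Cert.ev₁ PowerSeries.X Cert.num := by
  set z : PowerSeries ℤ[T;T⁻¹] := PowerSeries.C (T 1)
  set z' : PowerSeries ℤ[T;T⁻¹] := PowerSeries.C (T (-1))
  set t : PowerSeries ℤ[T;T⁻¹] := PowerSeries.X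
  have hz : z * z' = 1 := by rw [← map_mul, ← T_add]; simp
  have h := Cert.identity (t := t) hz
  have hG : ∏ j, geom (wt j) = geom 0 * (geom 1 * geom 2 * geom 3 * geom 4) *
      (geom (-1) * geom (-2) * geom (-3) * geom (-4)) := by
    rw [Fintype.prod_sigma, Fin.prod_univ_two]
    change (∏ k : Fin 4, geom (wt ⟨0, k⟩)) * (∏ k : Fin 5, geom (wt ⟨1, k⟩)) = _
    rw [Fin.prod_univ_four, Fin.prod_univ_five]
    simp only [wt]
    norm_num
    ring
  have hp (k : ℕ) : geom k * (1 - t * z ^ k) = 1 := by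
    have := geom_mul k
    rwa [show (PowerSeries.C (T k) : PowerSeries ℤ[T;T⁻¹]) = z ^ k by
      rw [← map_pow, T_pow, mul_one]] at this
  have hn (k : ℕ) : geom (-k) * (1 - t * z' ^ k) = 1 := by
    have := geom_mul (-k)
    rwa [show (PowerSeries.C (T (-k)) : PowerSeries ℤ[T;T⁻¹]) = z' ^ k by
      rw [← map_pow, T_pow, mul_neg_one]] at this
  have h0 := hp 0
  have hp1 := hp 1
  have hp2 := hp 2
  have hp3 := hp 3
  have hp4 := hp 4
  have hn1 := hn 1
  have hn2 := hn 2
  have hn3 := hn 3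
  have hn4 := hn 4
  rw [pow_one] at hp1 hn1
  rw [pow_zero, mul_one] at h0
  push_cast at h0 hp1 hp2 hp3 hp4 hn1 hn2 hn3 hn4
  have hP : (geom 1 * geom 2 * geom 3 * geom 4) *
      ((1 - t * z) * (1 - t * z ^ 2) * (1 - t * z ^ 3) * (1 - t * z ^ 4)) = 1 := by
    trans (geom 1 * (1 - t * z)) * (geom 2 * (1 - t * z ^ 2)) * (geom 3 * (1 - t * z ^ 3)) *
      (geom 4 * (1 - t * z ^ 4))
    · ring
    · rw [hp1, hp2, hp3, hp4]; ring
  have hN : (geom (-1) * geom (-2) * geom (-3) * geom (-4)) *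
      ((1 - t * z') * (1 - t * z' ^ 2) * (1 - t * z' ^ 3) * (1 - t * z' ^ 4)) = 1 := by
    trans (geom (-1) * (1 - t * z')) * (geom (-2) * (1 - t * z' ^ 2)) *
      (geom (-3) * (1 - t * z' ^ 3)) * (geom (-4) * (1 - t * z' ^ 4))
    · ring
    · rw [hn1, hn2, hn3, hn4]; ring
  have hpos : constTerm (Cert.ev₂ t z Cert.posPart * (geom 1 * geom 2 * geom 3 * geom 4)) = 0 :=
    constTerm_pos _
  have hneg : constTerm (Cert.ev₂ t z' Cert.negPart *
    (geom (-1) * geom (-2) * geom (-3) * geom (-4))) = 0 := constTerm_neg _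
  have hD : (1 - t ^ 2) * (1 - t ^ 3) * (1 - t ^ 4) * (1 - t ^ 5) * (1 - t ^ 6) *
      (1 - t ^ 7) = PowerSeries.map LaurentPolynomial.C den := by
    simp [den, t]
  rw [hD, ev₁_eq_map] at h
  have hc : constTerm ((1 - z' ^ 2) * ∏ j, geom (wt j)) =
      PowerSeries.mk (fun d => ((expo d 0).card : ℤ) - (expo d 2).card) := by
    ext d
    have e : z' ^ 2 = PowerSeries.C (T (-2)) := by rw [← map_pow, T_pow]; rfl
    rw [sub_mul, one_mul, map_sub, map_sub, PowerSeries.coeff_mk, ← coeff_prod_geom,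
      ← coeff_prod_geom, e]
    simp only [constTerm, AddMonoidHom.coe_mk, ZeroHom.coe_mk, PowerSeries.coeff_mk,
      PowerSeries.coeff_C_mul]
    congr 1
    rw [T, AddMonoidAlgebra.coeff_single_mul_apply, one_mul]
    rfl
  rw [hG] at hc
  rw [← hc, mul_comm, ← constTerm_map_mul]
  generalize (geom 1 * geom 2 * geom 3 * geom 4) = gp at *
  generalize (geom (-1) * geom (-2) * geom (-3) * geom (-4)) = gq at *
  generalize (1 - t * z) * (1 - t * z ^ 2) * (1 - t * z ^ 3) * (1 - t * z ^ 4) = p at *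
  generalize (1 - t * z') * (1 - t * z' ^ 2) * (1 - t * z' ^ 3) * (1 - t * z' ^ 4) = q at *
  have h5 : PowerSeries.map LaurentPolynomial.C den * ((1 - z' ^ 2) * (geom 0 * gp * gq)) =
      PowerSeries.map LaurentPolynomial.C (Cert.ev₁ PowerSeries.X Cert.num) +
      Cert.ev₂ t z Cert.posPart * gp + Cert.ev₂ t z' Cert.negPart * gq := by
    generalize PowerSeries.map LaurentPolynomial.C 
      (Cert.ev₁ (PowerSeries.X : PowerSeries ℤ) Cert.num) = N at *
    generalize PowerSeries.map LaurentPolynomial.C den = D at *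
    generalize Cert.ev₂ t z Cert.posPart = U at *
    generalize Cert.ev₂ t z' Cert.negPart = W at *
    calc _ = ((1 - z' ^ 2) * D) * (geom 0 * gp * gq) := by ring
      _ = N * (geom 0 * (1 - t)) * (gp * p) * (gq * q) + U * gp * (geom 0 * (1 - t)) * (gq * q) +
          W * gq * (geom 0 * (1 - t)) * (gp * p) := by rw [h]; ring
      _ = _ := by rw [h0, hP, hN]; ring
  rw [h5, map_add, map_add, hpos, hneg, add_zero, add_zero]
  have := constTerm_map_mul (Cert.ev₁ PowerSeries.X Cert.num) 1
  rw [mul_one] at this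
  rw [this]
  have h6 : constTerm (1 : PowerSeries ℤ[T;T⁻¹]) = 1 := by
    ext n
    simp only [constTerm, AddMonoidHom.coe_mk, ZeroHom.coe_mk, PowerSeries.coeff_mk,
      PowerSeries.coeff_one]
    split_ifs <;> simp
  rw [h6, mul_one]

end HilbertSeries

end CubicQuartic

namespace CubicQuartic

open BinInv

/-- The degrees of the elements of the module basis. -/
def degB : Fin 20 → ℕ := ![0, 5, 6, 7, 7, 8, 8, 8, 9, 9, 9, 9, 10, 10, 11, 10, 11, 12, 13, 18]

theorem isHomogeneous_B (A : Type*) [CommRing A] (i : Fin 20) :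
    (B A i).IsHomogeneous (degB i) := by
  have h := isHomogeneous_S A
  unfold B
  generalize S A = s at h ⊢
  fin_cases i
  · exact isHomogeneous_one _ _
  · exact h 0
  · exact h 1
  · exact h 2
  · exact h 3
  · exact h 4
  · exact h 5
  · exact h 6
  · exact h 7
  · exact h 8
  · exact h 9
  · exact h 10
  · exact h 11
  · exact h 12
  · exact h 13
  · exact (h 0).mul (h 0)
  · exact (h 0).mul (h 1)
  · exact (h 1).mul (h 1)
  · exact (h 1).mul (h 2)
  · exact (h 9).mul (h 9)

theorem B_mem (i : Fin 20) : B ℂ i ∈ invariantRing ![3, 4] := by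
  have h := S_mem
  unfold B
  generalize S ℂ = s at h ⊢
  fin_cases i
  · exact one_mem _
  · exact h 0
  · exact h 1
  · exact h 2
  · exact h 3
  · exact h 4
  · exact h 5
  · exact h 6
  · exact h 7
  · exact h 8
  · exact h 9
  · exact h 10
  · exact h 11
  · exact h 12
  · exact h 13
  · exact mul_mem (h 0) (h 0)
  · exact mul_mem (h 0) (h 1)
  · exact mul_mem (h 1) (h 1)
  · exact mul_mem (h 1) (h 2)
  · exact mul_mem (h 9) (h 9)

theorem mon_eq (A : Type*) [CommRing A] (x : Fin 20 × (Fin 6 →₀ ℕ)) :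
    mon A x = (∏ k, P A k ^ x.2 k) * B A x.1 := by
  rw [mon, aeval_monomial, map_one, one_mul, Finsupp.prod_fintype]
  simp

theorem mon_mem (x : Fin 20 × (Fin 6 →₀ ℕ)) : mon ℂ x ∈ invariantRing ![3, 4] := by
  rw [mon_eq]
  exact mul_mem (prod_mem fun k _ => pow_mem (P_mem k) _) (B_mem _)

/-- The degree of `mon A x`. -/
def degMon (x : Fin 20 × (Fin 6 →₀ ℕ)) : ℕ := ∑ k : Fin 6, ((k : ℕ) + 2) * x.2 k + degB x.1

theorem isHomogeneous_mon (A : Type*) [CommRing A] (x : Fin 20 × (Fin 6 →₀ ℕ)) :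
    (mon A x).IsHomogeneous (degMon x) := by
  rw [mon_eq]
  refine IsHomogeneous.mul (IsHomogeneous.prod _ _ _ fun k _ => ?_) (isHomogeneous_B A _)
  have := (isHomogeneous_P A k).pow (x.2 k)
  convert this using 2
  fin_cases k <;> rfl

/-- Tuples of multiples of `2, …, 7` with given sum. -/
def multiples (e : ℕ) : Finset (Fin 6 →₀ ℕ) :=
  (Finset.univ.finsuppAntidiag e).filter fun l => ∀ k : Fin 6, (k : ℕ) + 2 ∣ l k

namespace HilbertSeries

/-- The geometric series with ratio `t ^ k`. -/
noncomputable def geomPow (k : ℕ) : PowerSeries ℤ :=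
  PowerSeries.mk fun n => if k ∣ n then 1 else 0

theorem geomPow_mul {k : ℕ} (hk : 0 < k) : geomPow k * (1 - PowerSeries.X ^ k) = 1 := by
  ext n
  rw [mul_sub, mul_one, map_sub, PowerSeries.coeff_mul_X_pow', geomPow, PowerSeries.coeff_mk,
    PowerSeries.coeff_one]
  rcases le_or_gt k n with h | h
  · rw [if_pos h, if_neg (by omega : n ≠ 0), PowerSeries.coeff_mk]
    obtain ⟨m, rfl⟩ := Nat.exists_eq_add_of_le h
    simp
  · rw [if_neg (not_le.2 h), sub_zero]
    refine if_congr ⟨fun h1 => ?_, fun h1 => h1 ▸ dvd_zero k⟩ rfl rfl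
    exact Nat.eq_zero_of_dvd_of_lt h1 h

theorem coeff_prod_geomPow (e : ℕ) :
    PowerSeries.coeff e (∏ k : Fin 6, geomPow (k + 2)) = (multiples e).card := by
  rw [PowerSeries.coeff_prod]
  simp only [geomPow, PowerSeries.coeff_mk]
  rw [multiples, ← Finset.sum_boole]
  refine Finset.sum_congr rfl fun l _ => ?_
  rw [Finset.prod_boole]
  simp

theorem sum_X_pow_degB : ∑ i, (PowerSeries.X : PowerSeries ℤ) ^ degB i =
    Cert.ev₁ PowerSeries.X Cert.num := by
  simp [degB, Fin.sum_univ_succ, Cert.ev₁, Cert.ev, Cert.num]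
  ring

theorem prod_geomPow_mul_den : (∏ k : Fin 6, geomPow (k + 2)) * den = 1 := by
  have h : den = ∏ k : Fin 6, (1 - PowerSeries.X ^ ((k : ℕ) + 2)) := by
    rw [Fin.prod_univ_six, den]; rfl
  rw [h, ← Finset.prod_mul_distrib]
  exact Finset.prod_eq_one fun k _ => geomPow_mul (by omega)

end HilbertSeries

/-- Indices for the basis elements of a given degree. -/
def monIdx (d : ℕ) : Finset (Σ _ : Fin 20, Fin 6 →₀ ℕ) :=
  Finset.univ.sigma fun i => if degB i ≤ d then multiples (d - degB i) else ∅

open HilbertSeries in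
theorem card_monIdx (d : ℕ) : (monIdx d).card + (expo d 2).card = (expo d 0).card := by
  have h : PowerSeries.mk (fun d => ((expo d 0).card : ℤ) - (expo d 2).card) =
      (∑ i, PowerSeries.X ^ degB i) * ∏ k : Fin 6, geomPow (k + 2) := by
    rw [sum_X_pow_degB, ← weight_series, mul_assoc, mul_comm den, prod_geomPow_mul_den, mul_one]
  have h1 := congrArg (PowerSeries.coeff d) h
  rw [PowerSeries.coeff_mk, Finset.sum_mul, map_sum] at h1
  simp only [PowerSeries.coeff_X_pow_mul', coeff_prod_geomPow] at h1
  have h2 : ((monIdx d).card : ℤ) = (expo d 0).card - (expo d 2).card := by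
    rw [h1, monIdx, Finset.card_sigma, Nat.cast_sum]
    refine Finset.sum_congr rfl fun i _ => ?_
    split_ifs <;> simp
  omega

theorem invDeg_le_span (d : ℕ) :
    invDeg d ≤ Submodule.span ℂ (mon ℂ '' {x | degMon x = d}) := by
  let φ : monIdx d → Fin 20 × (Fin 6 →₀ ℕ) := fun y =>
    (y.1.1, Finsupp.equivFunOnFinite.symm fun k => y.1.2 k / (k + 2))
  have hy (y : monIdx d) : degB y.1.1 ≤ d ∧ y.1.2 ∈ multiples (d - degB y.1.1) := by
    have := (Finset.mem_sigma.1 y.2).2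
    split_ifs at this with h
    · exact ⟨h, this⟩
    · simp at this
  have hm (y : monIdx d) (k : Fin 6) : ((k : ℕ) + 2) * (y.1.2 k / (k + 2)) = y.1.2 k :=
    Nat.mul_div_cancel' ((Finset.mem_filter.1 (hy y).2).2 k)
  have hφ : Function.Injective φ := by
    intro y y' h
    have h1 : y.1.1 = y'.1.1 := congrArg Prod.fst h
    have h2 : y.1.2 = y'.1.2 := by
      ext k
      have h3 : y.1.2 k / (k + 2) = y'.1.2 k / (k + 2) :=
        DFunLike.congr_fun (congrArg Prod.snd h) k
      rw [← hm, h3, hm]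
    exact Subtype.ext (Sigma.ext h1 (heq_of_eq h2))
  have hdeg (y : monIdx d) : degMon (φ y) = d := by
    have h1 : ∑ k, y.1.2 k = d - degB y.1.1 := by
      have := (Finset.mem_filter.1 (hy y).2).1
      rw [Finset.mem_finsuppAntidiag] at this
      exact this.1
    have h2 : degMon (φ y) = ∑ k : Fin 6, ((k : ℕ) + 2) * (y.1.2 k / (k + 2)) + degB y.1.1 := rfl
    rw [h2, Finset.sum_congr rfl fun k _ => hm y k, h1]
    exact Nat.sub_add_cancel (hy y).1
  have hli := linearIndependent_mon.comp φ hφ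
  have hle : Submodule.span ℂ (Set.range (mon ℂ ∘ φ)) ≤ invDeg d := by
    rw [Submodule.span_le]
    rintro _ ⟨y, rfl⟩
    refine ⟨mon_mem _, ?_⟩
    have := isHomogeneous_mon ℂ (φ y)
    rw [hdeg] at this
    exact this
  have hcard := finrank_span_eq_card hli
  have heq := Submodule.eq_of_le_of_finrank_le hle (by
    rw [hcard, Fintype.card_coe]
    have h1 := finrank_invDeg_le d
    have h2 := card_monIdx d
    omega)
  rw [← heq]
  refine Submodule.span_mono ?_
  rintro _ ⟨y, rfl⟩
  exact ⟨φ y, hdeg y, rfl⟩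

end CubicQuartic

namespace CubicQuartic

open BinInv

theorem actPt_smul {p : ℕ} (n : Fin p → ℕ) (g : Matrix.SpecialLinearGroup (Fin 2) ℂ) (t : ℂ)
    (c : Idx n → ℂ) : actPt n g (t • c) = t • actPt n g c := by
  funext j
  have h : formAt n (t • c) j.1 = C t * formAt n c j.1 := by
    rw [formAt, formAt, Finset.mul_sum]
    refine Finset.sum_congr rfl fun k _ => ?_
    rw [Pi.smul_apply, smul_eq_mul, C_mul]; ring
  rw [Pi.smul_apply, actPt, actPt, h, sl2Act, map_mul, algHom_C, algebraMap_eq, coeffAt,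
    coeff_C_mul]
  rfl

theorem eval_smul_of_isHomogeneous {σ : Type*} [Fintype σ] {f : MvPolynomial σ ℂ} {d : ℕ}
    (hf : f.IsHomogeneous d) (t : ℂ) (c : σ → ℂ) : eval (t • c) f = t ^ d * eval c f := by
  rw [eval_eq', eval_eq', Finset.mul_sum]
  refine Finset.sum_congr rfl fun s hs => ?_
  have h := hf (mem_support_iff.1 hs)
  rw [Finsupp.weight_apply, Finsupp.sum_fintype _ _ (by simp)] at h
  simp only [Pi.one_apply, smul_eq_mul, mul_one] at h
  simp only [Pi.smul_apply, smul_eq_mul, mul_pow, Finset.prod_mul_distrib]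
  rw [Finset.prod_pow_eq_pow_sum, h]; ring

theorem homogeneousComponent_mem {p : ℕ} {n : Fin p → ℕ} {f : MvPolynomial (Idx n) ℂ}
    (hf : f ∈ invariantRing n) (d : ℕ) : homogeneousComponent d f ∈ invariantRing n := by
  intro g c
  by_cases hd : d ∈ Finset.range (f.totalDegree + 1)
  · have key (t : ℂ) (c : Idx n → ℂ) : eval (t • c) f =
        ∑ i ∈ Finset.range (f.totalDegree + 1), t ^ i * eval c (homogeneousComponent i f) := by
      conv_lhs => rw [← sum_homogeneousComponent f, map_sum]
      exact Finset.sum_congr rfl fun i _ =>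
        eval_smul_of_isHomogeneous (homogeneousComponent_isHomogeneous _ _) _ _
    let q (c : Idx n → ℂ) : Polynomial ℂ := ∑ i ∈ Finset.range (f.totalDegree + 1),
      Polynomial.monomial i (eval c (homogeneousComponent i f))
    have hq : q (actPt n g c) = q c := by
      refine Polynomial.funext fun t => ?_
      have h := hf g (t • c)
      rw [actPt_smul, key, key] at h
      simp only [q, Polynomial.eval_finsetSum, Polynomial.eval_monomial, mul_comm (eval _ _)]
      exact h
    have := congrArg (fun p => p.coeff d) hq
    simpa only [q, Polynomial.finsetSum_coeff, Polynomial.coeff_monomial, Finset.sum_ite_eq',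
      if_pos hd] using this
  · rw [homogeneousComponent_eq_zero]
    · simp
    · simpa using hd

theorem mem_span_mon {f : Poly ℂ} (hf : f ∈ invariantRing ![3, 4]) :
    f ∈ Submodule.span ℂ (Set.range (mon ℂ)) := by
  rw [← sum_homogeneousComponent f]
  refine Submodule.sum_mem _ fun d _ => ?_
  exact Submodule.span_mono (Set.image_subset_range _ _)
    (invDeg_le_span d ⟨homogeneousComponent_mem hf d, homogeneousComponent_isHomogeneous _ _⟩)

theorem exists_coord : ∃ Λ : Poly ℂ →ₗ[ℂ] (Fin 20 × (Fin 6 →₀ ℕ) →₀ ℂ),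
    Λ ∘ₗ Finsupp.linearCombination ℂ (mon ℂ) = LinearMap.id :=
  LinearMap.exists_leftInverse_of_injective _
    (LinearMap.ker_eq_bot.2 linearIndependent_mon.finsuppLinearCombination_injective)

/-- The coordinates of an invariant in the basis `mon ℂ`. -/
noncomputable def coord : Poly ℂ →ₗ[ℂ] (Fin 20 × (Fin 6 →₀ ℕ) →₀ ℂ) := exists_coord.choose

theorem coord_linearCombination (l : Fin 20 × (Fin 6 →₀ ℕ) →₀ ℂ) :
    coord (Finsupp.linearCombination ℂ (mon ℂ) l) = l :=
  LinearMap.congr_fun exists_coord.choose_spec l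

theorem coord_mon (x : Fin 20 × (Fin 6 →₀ ℕ)) : coord (mon ℂ x) = Finsupp.single x 1 := by
  rw [← coord_linearCombination (Finsupp.single x 1), Finsupp.linearCombination_single, one_smul]

theorem coord_apply_eq_zero {f : Poly ℂ} {d : ℕ} (hf : f ∈ invariantRing ![3, 4])
    (hd : f.IsHomogeneous d) {x : Fin 20 × (Fin 6 →₀ ℕ)} (hx : degMon x ≠ d) :
    coord f x = 0 := by
  obtain ⟨l, hl, rfl⟩ := (Finsupp.mem_span_image_iff_linearCombination ℂ).1
    (invDeg_le_span d ⟨hf, hd⟩)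
  rw [coord_linearCombination]
  by_contra h
  exact hx (hl (Finsupp.mem_support_iff.2 h))

theorem B_zero (A : Type*) [CommRing A] : B A 0 = 1 := rfl

theorem algebraicIndependent_P : AlgebraicIndependent ℂ (P ℂ) := by
  rw [algebraicIndependent_iff]
  intro p hp
  have h (m : Fin 6 →₀ ℕ) (p : MvPolynomial (Fin 6) ℂ) :
      coord (aeval (P ℂ) p) (0, m) = coeff m p := by
    induction p using MvPolynomial.induction_on' with
    | monomial s a =>
      have : aeval (P ℂ) (monomial s a) = a • mon ℂ (0, s) := by
        rw [mon, B_zero, mul_one, ← map_smul, smul_monomial, smul_eq_mul, mul_one]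
      rw [this, map_smul, coord_mon, Finsupp.smul_apply, coeff_monomial, Finsupp.single_apply]
      simp [Prod.ext_iff]
    | add p q hp hq => rw [map_add, map_add, Finsupp.add_apply, hp, hq, coeff_add]
  ext m
  rw [← h, hp]; simp

theorem isIntegral_P {f : Poly ℂ} (hf : f ∈ invariantRing ![3, 4]) :
    IsIntegral (Algebra.adjoin ℂ (Set.range (P ℂ))) f := by
  set A := Algebra.adjoin ℂ (Set.range (P ℂ))
  have hA : A ≤ invariantRing ![3, 4] := Algebra.adjoin_le (by rintro _ ⟨k, rfl⟩; exact P_mem k)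
  let R' : Subalgebra A (Poly ℂ) :=
    { (invariantRing ![3, 4]).toSubsemiring with
      algebraMap_mem' := fun a => hA a.2 }
  refine IsIntegral.of_mem_of_fg R' ⟨Finset.univ.image (B ℂ), ?_⟩ f hf
  apply le_antisymm
  · rw [Submodule.span_le]
    intro b hb
    simp only [Finset.coe_image, Finset.coe_univ, Set.image_univ] at hb
    obtain ⟨i, rfl⟩ := hb
    exact B_mem i
  · intro g hg
    have := mem_span_mon hg
    refine Submodule.span_induction (p := fun g _ => g ∈ Submodule.span A _) ?_ (zero_mem _)
      (fun _ _ _ _ => add_mem) ?_ this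
    · rintro _ ⟨x, rfl⟩
      have hx : aeval (P ℂ) (monomial x.2 (1 : ℂ)) ∈ A := by
        simp only [A, ← aeval_range]
        exact AlgHom.mem_range_self _ _
      have h : mon ℂ x = (⟨_, hx⟩ : A) • B ℂ x.1 := rfl
      rw [h]
      refine Submodule.smul_mem _ _ (Submodule.subset_span ?_)
      simp
    · intro a x _ hx
      rw [← algebraMap_smul A a x]
      exact Submodule.smul_mem _ _ hx

theorem isHSOP_P : IsHSOP ![3, 4] (P ℂ) ![2, 3, 4, 5, 6, 7] :=
  ⟨P_mem, by decide, isHomogeneous_P ℂ, algebraicIndependent_P, fun _ => isIntegral_P⟩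

end CubicQuartic

namespace CubicQuartic

open BinInv

/-- The first components of the indices of the generators among the basis elements. -/
def genB : Fin 20 → Fin 20 := ![0, 0, 0, 0, 1, 0, 2, 0, 3, 4, 5, 6, 7, 8, 9, 10, 11, 12, 13, 14]

/-- The exponents of the primary invariants in the generators. -/
def genP : Fin 20 → Fin 6 → ℕ :=
  ![![1, 0, 0, 0, 0, 0], ![0, 1, 0, 0, 0, 0], ![0, 0, 1, 0, 0, 0], ![0, 0, 0, 1, 0, 0], 0,
    ![0, 0, 0, 0, 1, 0], 0, ![0, 0, 0, 0, 0, 1], 0, 0, 0, 0, 0, 0, 0, 0, 0, 0, 0, 0]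

/-- The indices of the generators among the basis elements. -/
noncomputable def genIdx (j : Fin 20) : Fin 20 × (Fin 6 →₀ ℕ) :=
  (genB j, Finsupp.equivFunOnFinite.symm (genP j))

theorem genIdx_injective : Function.Injective genIdx := by
  have h : ∀ i j, genB i = genB j → genP i = genP j → i = j := by decide
  intro i j hij
  exact h i j (congrArg Prod.fst hij)
    (Finsupp.equivFunOnFinite.symm.injective (congrArg Prod.snd hij))

/-- The degrees of the generators. -/
def degGen : Fin 20 → ℕ := ![2, 3, 4, 5, 5, 6, 6, 7, 7, 7, 8, 8, 8, 9, 9, 9, 9, 10, 10, 11]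

theorem degMon_genIdx (j : Fin 20) : degMon (genIdx j) = degGen j := by
  have h : ∀ j, ∑ k : Fin 6, ((k : ℕ) + 2) * genP j k + degB (genB j) = degGen j := by decide
  exact h j

theorem genIdx_size (j : Fin 20) :
    (if (genIdx j).1 = 0 then 0 else 1) + ∑ k, (genIdx j).2 k = 1 := by
  have h : ∀ j, (if genB j = 0 then 0 else 1) + ∑ k, genP j k = 1 := by decide
  exact h j

theorem mon_zero : mon ℂ 0 = 1 := by
  rw [mon_eq]; simp [B_zero]

theorem mon_add (a : Fin 20) (s t : Fin 6 →₀ ℕ) :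
    mon ℂ (a, s + t) = mon ℂ (0, s) * mon ℂ (a, t) := by
  rw [mon_eq, mon_eq, mon_eq]
  simp [B_zero, pow_add, Finset.prod_mul_distrib, mul_assoc]

theorem mon_eq_mul (a : Fin 20) (s : Fin 6 →₀ ℕ) : mon ℂ (a, s) = mon ℂ (0, s) * B ℂ a := by
  rw [mon_eq, mon_eq]; simp [B_zero]

theorem coord_mon_mul_of_fst_eq_zero {x y : Fin 20 × (Fin 6 →₀ ℕ)} (hx : x ≠ 0) (hy : y ≠ 0)
    (h0 : x.1 = 0) (j : Fin 20) : coord (mon ℂ x * mon ℂ y) (genIdx j) = 0 := by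
  obtain ⟨a, s⟩ := x
  obtain ⟨b, t⟩ := y
  obtain rfl : a = 0 := h0
  rw [← mon_add, coord_mon, Finsupp.single_apply, if_neg]
  intro h
  have h1 := genIdx_size j
  rw [← h] at h1
  simp only [Finsupp.add_apply, Finset.sum_add_distrib] at h1
  have hs : ∑ k, s k ≠ 0 := by
    intro hs
    refine hx (Prod.ext rfl (Finsupp.ext fun k => ?_))
    exact Finset.sum_eq_zero_iff.1 hs k (Finset.mem_univ k)
  split_ifs at h1 with hb
  · have ht : ∑ k, t k ≠ 0 := by
      intro ht
      refine hy (Prod.ext hb (Finsupp.ext fun k => ?_))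
      exact Finset.sum_eq_zero_iff.1 ht k (Finset.mem_univ k)
    omega
  · omega

theorem B_one_mul_B_one : B ℂ 1 * B ℂ 1 = B ℂ 15 := by
  unfold B
  generalize S ℂ = s
  rfl

theorem B_one_mul_B_two : B ℂ 1 * B ℂ 2 = B ℂ 16 := by
  unfold B
  generalize S ℂ = s
  rfl

theorem coord_mon_mul_mon {x y : Fin 20 × (Fin 6 →₀ ℕ)} (hx : x ≠ 0) (hy : y ≠ 0) (j : Fin 20) :
    coord (mon ℂ x * mon ℂ y) (genIdx j) = 0 := by
  by_cases hx0 : x.1 = 0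
  · exact coord_mon_mul_of_fst_eq_zero hx hy hx0 j
  by_cases hy0 : y.1 = 0
  · rw [mul_comm]; exact coord_mon_mul_of_fst_eq_zero hy hx hy0 j
  obtain ⟨a, s⟩ := x
  obtain ⟨b, t⟩ := y
  have key : ∀ a b : Fin 20, a ≠ 0 → b ≠ 0 → 12 ≤ degB a + degB b ∨
      (a = 1 ∧ b = 1) ∨ (a = 1 ∧ b = 2) ∨ (a = 2 ∧ b = 1) := by decide
  have hmul : mon ℂ (a, s) * mon ℂ (b, t) = mon ℂ (0, s + t) * (B ℂ a * B ℂ b) := by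
    rw [mon_eq_mul a, mon_eq_mul b, mon_add]; ring
  have hsp (c : Fin 20) (hc : ∀ j, genB j ≠ c) (h : B ℂ a * B ℂ b = B ℂ c) :
      coord (mon ℂ (a, s) * mon ℂ (b, t)) (genIdx j) = 0 := by
    rw [hmul, h, ← mon_eq_mul, coord_mon, Finsupp.single_apply, if_neg]
    exact fun h => hc j (congrArg Prod.fst h).symm
  rcases key a b hx0 hy0 with h | ⟨rfl, rfl⟩ | ⟨rfl, rfl⟩ | ⟨rfl, rfl⟩
  · refine coord_apply_eq_zero (mul_mem (mon_mem _) (mon_mem _))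
      ((isHomogeneous_mon ℂ _).mul (isHomogeneous_mon ℂ _)) ?_
    have h1 : ∀ j, degGen j ≤ 11 := by decide
    have h2 := h1 j
    rw [degMon_genIdx, degMon, degMon]
    dsimp only
    omega
  · exact hsp 15 (by decide) B_one_mul_B_one
  · exact hsp 16 (by decide) B_one_mul_B_two
  · exact hsp 16 (by decide) (by rw [mul_comm, B_one_mul_B_two])

theorem zero_ne_genIdx (j : Fin 20) : 0 ≠ genIdx j := by
  intro h
  have h1 := genIdx_size j
  rw [← h] at h1
  simp at h1

theorem coord_mul {f g : Poly ℂ} (hf : f ∈ invariantRing ![3, 4])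
    (hg : g ∈ invariantRing ![3, 4]) (j : Fin 20) : coord (f * g) (genIdx j) =
      coord f 0 * coord g (genIdx j) + coord g 0 * coord f (genIdx j) := by
  refine Submodule.span_induction₂ (p := fun f g _ _ => coord (f * g) (genIdx j) =
    coord f 0 * coord g (genIdx j) + coord g 0 * coord f (genIdx j)) ?_ (by simp) (by simp)
    ?_ ?_ ?_ ?_ (mem_span_mon hf) (mem_span_mon hg)
  · rintro _ _ ⟨x, rfl⟩ ⟨y, rfl⟩
    by_cases hx : x = 0
    · rw [hx, mon_zero, one_mul, ← mon_zero, coord_mon 0, Finsupp.single_eq_same,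
        Finsupp.single_eq_of_ne (zero_ne_genIdx j).symm]
      ring
    by_cases hy : y = 0
    · rw [hy, mon_zero, mul_one, ← mon_zero, coord_mon 0, Finsupp.single_eq_same,
        Finsupp.single_eq_of_ne (zero_ne_genIdx j).symm]
      ring
    rw [coord_mon_mul_mon hx hy, coord_mon, coord_mon, Finsupp.single_eq_of_ne (Ne.symm hx),
      Finsupp.single_eq_of_ne (Ne.symm hy)]
    ring
  · intro f f' g _ _ _ h h'
    rw [add_mul, map_add, map_add, Finsupp.add_apply, Finsupp.add_apply, Finsupp.add_apply, h, h']
    ring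
  · intro f g g' _ _ _ h h'
    rw [mul_add, map_add, map_add, Finsupp.add_apply, Finsupp.add_apply, Finsupp.add_apply, h, h']
    ring
  · intro a f g _ _ h
    rw [smul_mul_assoc, map_smul, map_smul, Finsupp.smul_apply, Finsupp.smul_apply,
      Finsupp.smul_apply, h, smul_eq_mul, smul_eq_mul, smul_eq_mul]
    ring
  · intro a f g _ _ h
    rw [mul_smul_comm, map_smul, map_smul, Finsupp.smul_apply, Finsupp.smul_apply,
      Finsupp.smul_apply, h, smul_eq_mul, smul_eq_mul, smul_eq_mul]
    ring

/-- The coordinates at the generators. -/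
noncomputable def genCoord : Poly ℂ →ₗ[ℂ] Fin 20 → ℂ :=
  LinearMap.pi fun j => Finsupp.lapply (genIdx j) ∘ₗ coord

theorem genCoord_apply (f : Poly ℂ) (j : Fin 20) : genCoord f j = coord f (genIdx j) := rfl

theorem card_generators_ge {s : Finset (Poly ℂ)}
    (hs : Algebra.adjoin ℂ (s : Set (Poly ℂ)) = invariantRing ![3, 4]) : 20 ≤ s.card := by
  classical
  have h1 (f : Poly ℂ) (hf : f ∈ Algebra.adjoin ℂ (s : Set (Poly ℂ))) :
      genCoord f ∈ Submodule.span ℂ ((s.image genCoord : Finset (Fin 20 → ℂ)) : Set (Fin 20 → ℂ)) := by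
    induction hf using Algebra.adjoin_induction with
    | mem f hf =>
      exact Submodule.subset_span (Finset.mem_coe.2 (Finset.mem_image_of_mem _ hf))
    | algebraMap r =>
      have : genCoord (algebraMap ℂ (Poly ℂ) r) = 0 := by
        funext j
        rw [genCoord_apply, Algebra.algebraMap_eq_smul_one, ← mon_zero, map_smul, coord_mon,
          Finsupp.smul_apply, Finsupp.single_eq_of_ne (zero_ne_genIdx j).symm]
        simp
      rw [this]
      exact zero_mem _
    | add f g _ _ hf hg => rw [map_add]; exact add_mem hf hg
    | mul f g hf' hg' hf hg =>
      have : genCoord (f * g) = coord f 0 • genCoord g + coord g 0 • genCoord f := by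
        funext j
        exact coord_mul (hs ▸ hf') (hs ▸ hg') j
      rw [this]
      exact add_mem (Submodule.smul_mem _ _ hg) (Submodule.smul_mem _ _ hf)
  have h2 : Submodule.span ℂ ((s.image genCoord : Finset (Fin 20 → ℂ)) : Set (Fin 20 → ℂ)) = ⊤ := by
    rw [eq_top_iff, ← (Pi.basisFun ℂ (Fin 20)).span_eq, Submodule.span_le]
    rintro _ ⟨j, rfl⟩
    have : genCoord (mon ℂ (genIdx j)) = Pi.basisFun ℂ (Fin 20) j := by
      funext i
      rw [genCoord_apply, coord_mon, Pi.basisFun_apply, Finsupp.single_apply, Pi.single_apply]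
      exact if_congr (genIdx_injective.eq_iff.trans eq_comm) rfl rfl
    rw [← this]
    exact h1 _ (hs ▸ mon_mem _)
  have h3 : Set.finrank ℂ ((s.image genCoord : Finset (Fin 20 → ℂ)) : Set (Fin 20 → ℂ)) ≤ _ :=
    finrank_span_finset_le_card (R := ℂ) (s.image genCoord)
  rw [Set.finrank, h2, finrank_top, Module.finrank_fin_fun] at h3
  exact h3.trans Finset.card_image_le

theorem adjoin_generators :
    Algebra.adjoin ℂ (Set.range fun j => mon ℂ (genIdx j)) = invariantRing ![3, 4] := by
  apply le_antisymm
  · exact Algebra.adjoin_le (by rintro _ ⟨j, rfl⟩; exact mon_mem _)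
  set A := Algebra.adjoin ℂ (Set.range fun j => mon ℂ (genIdx j))
  have hG (j) : mon ℂ (genIdx j) ∈ A := Algebra.subset_adjoin ⟨j, rfl⟩
  have hP (k : Fin 6) : P ℂ k ∈ A := by
    have h : ∀ k : Fin 6, ∃ j, genB j = 0 ∧ genP j = Pi.single k 1 := by decide
    obtain ⟨j, h1, h2⟩ := h k
    have := hG j
    rw [mon_eq] at this
    simp only [genIdx, h1, h2, B_zero, mul_one, Finsupp.equivFunOnFinite_symm_apply_apply] at this
    rwa [Finset.prod_eq_single k (fun l _ hl => by rw [Pi.single_eq_of_ne hl, pow_zero])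
      (by simp), Pi.single_eq_same, pow_one] at this
  have hB' (i : Fin 20) (hi : 1 ≤ i ∧ i ≤ 14) : B ℂ i ∈ A := by
    have h : ∀ i : Fin 20, 1 ≤ i ∧ i ≤ 14 → ∃ j, genB j = i ∧ genP j = 0 := by decide
    obtain ⟨j, h1, h2⟩ := h i hi
    have := hG j
    rw [mon_eq] at this
    simpa [genIdx, h1, h2] using this
  have hS (i : Fin 14) : S ℂ i ∈ A := by
    have h : ∀ i : Fin 14, (1 : Fin 20) ≤ ⟨i + 1, by omega⟩ ∧
        (⟨i + 1, by omega⟩ : Fin 20) ≤ 14 := by decide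
    have := hB' ⟨i + 1, by omega⟩ (h i)
    unfold B at this
    generalize S ℂ = s at this ⊢
    fin_cases i <;> exact this
  have hB (i : Fin 20) : B ℂ i ∈ A := by
    unfold B
    generalize S ℂ = s at hS ⊢
    clear hP hB'
    fin_cases i
    · exact one_mem _
    · exact hS 0
    · exact hS 1
    · exact hS 2
    · exact hS 3
    · exact hS 4
    · exact hS 5
    · exact hS 6
    · exact hS 7
    · exact hS 8
    · exact hS 9
    · exact hS 10
    · exact hS 11
    · exact hS 12
    · exact hS 13
    · exact mul_mem (hS 0) (hS 0)
    · exact mul_mem (hS 0) (hS 1)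
    · exact mul_mem (hS 1) (hS 1)
    · exact mul_mem (hS 1) (hS 2)
    · exact mul_mem (hS 9) (hS 9)
  intro f hf
  refine (Submodule.span_le (p := Subalgebra.toSubmodule A)).2 ?_ (mem_span_mon hf)
  rintro _ ⟨x, rfl⟩
  have : mon ℂ x ∈ A := by
    rw [mon_eq]
    exact mul_mem (prod_mem fun k _ => pow_mem (hP k) _) (hB _)
  exact this

theorem hasMinimalGens : HasMinimalGens ![3, 4] degGen := by
  have hinj : Function.Injective fun j => mon ℂ (genIdx j) :=
    linearIndependent_mon.injective.comp genIdx_injective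
  refine ⟨⟨⟨Finset.univ.map ⟨_, hinj⟩, ?_, ?_⟩, ?_⟩, _, hinj, fun j => ?_, adjoin_generators⟩
  · simp
  · rw [Finset.coe_map, Finset.coe_univ, Set.image_univ]
    exact adjoin_generators
  · rintro _ ⟨s, rfl, hs⟩
    exact card_generators_ge hs
  · have := isHomogeneous_mon ℂ (genIdx j)
    rwa [degMon_genIdx] at this

end CubicQuartic

open BinInv in
/-- For `V = V₃ ⊕ V₄`: there is a homogeneous system of parameters of degrees
`2, 3, 4, 5, 6, 7`, and the minimal number of generators is `20`, with degrees
`2, 3, 4, 5, 5, 6, 6, 7, 7, 7, 8, 8, 8, 9, 9, 9, 9, 10, 10, 11`. -/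
theorem V3_V4_hsop_and_generators :
    (∃ P : Fin 6 → MvPolynomial (Idx ![3, 4]) ℂ,
      IsHSOP ![3, 4] P ![2, 3, 4, 5, 6, 7]) ∧
    HasMinimalGens ![3, 4]
      ![2, 3, 4, 5, 5, 6, 6, 7, 7, 7, 8, 8, 8, 9, 9, 9, 9, 10, 10, 11] := by
  exact ⟨⟨_, CubicQuartic.isHSOP_P⟩, CubicQuartic.hasMinimalGens⟩
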